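/- For every γ > 0 there exist an integer n₀ and a real η > 0 such that the following holds: if α satisfies 3/8 + γ ≤ α < 1/2 and G is an oriented graph on n ≥ n₀ vertices with minimum semidegree δ⁰(G) ≥ (α − η)n and maximum semidegree Δ⁰(G) ≤ (α + η)n, then G contains at least (α − γ)n pairwise edge-disjoint Hamilton cycles. -/

import Mathlib

open scoped Classical

/-- Outdegree of a vertex in a digraph given as a relation. -/
noncomputable def outDeg {V : Type*} [Fintype V] (G : V → V → Prop) (v : V) : ℕ :=
  (Finset.univ.filter fun u => G v u).card

/-- Indegree of a vertex in a digraph given as a relation. -/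
noncomputable def inDeg {V : Type*} [Fintype V] (G : V → V → Prop) (v : V) : ℕ :=
  (Finset.univ.filter fun u => G u v).card

/-- A Hamilton cycle of a digraph `G`, encoded as a permutation which is a single cycle
moving every vertex, all of whose transition edges lie in `G`. -/
def IsHamCycle {V : Type*} [Fintype V] [DecidableEq V] (G : V → V → Prop)
    (σ : Equiv.Perm V) : Prop :=
  σ.IsCycle ∧ (∀ v, σ v ≠ v) ∧ (∀ v, G v (σ v))

/-- A Chernoff bound for a uniformly random function `φ : ι → C`, in counting form. -/
theorem card_le_sum_apply {ι C : Type*} [Fintype ι] [DecidableEq ι] [Fintype C]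
    (a : ι → C → ℝ) (ha : ∀ i c, |a i c| ≤ 1) (ha0 : ∀ i, ∑ c, a i c = 0)
    (l : ℝ) (hl : 0 ≤ l) (hι : 0 < Fintype.card ι) (hl2 : l ≤ 2 * Fintype.card ι) :
    ((Finset.univ.filter fun φ : ι → C => l ≤ ∑ i, a i (φ i)).card : ℝ) ≤
      Real.exp (-(l ^ 2 / (4 * Fintype.card ι))) * (Fintype.card C : ℝ) ^ Fintype.card ι := by
  set n : ℝ := (Fintype.card ι : ℝ) with hn
  have hn0 : 0 < n := by simpa [hn] using hι
  set t : ℝ := l / (2 * n) with ht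
  have ht0 : 0 ≤ t := by positivity
  have ht1 : t ≤ 1 := by rw [ht, div_le_one (by positivity)]; exact hl2
  have key : ((Finset.univ.filter fun φ : ι → C => l ≤ ∑ i, a i (φ i)).card : ℝ) * Real.exp (t * l)
      ≤ ∑ φ : ι → C, ∏ i, Real.exp (t * a i (φ i)) := by
    rw [← nsmul_eq_mul, ← Finset.sum_const]
    refine (Finset.sum_le_sum (f := fun _ => Real.exp (t * l))
      (g := fun φ : ι → C => ∏ i, Real.exp (t * a i (φ i))) ?_).trans
      (Finset.sum_le_sum_of_subset_of_nonneg (Finset.subset_univ _) ?_)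
    · intro φ hφ
      rw [← Real.exp_sum, ← Finset.mul_sum]
      exact Real.exp_le_exp.2 (mul_le_mul_of_nonneg_left (Finset.mem_filter.1 hφ).2 ht0)
    · intro φ _ _
      positivity
  have hprod : ∑ φ : ι → C, ∏ i, Real.exp (t * a i (φ i)) =
      ∏ i, ∑ c, Real.exp (t * a i c) := by
    rw [Finset.prod_univ_sum]
    simp
  have hfac : ∀ i, ∑ c, Real.exp (t * a i c) ≤ Fintype.card C * Real.exp (t ^ 2) := by
    intro i
    have h1 : ∀ c, Real.exp (t * a i c) ≤ (1 + t ^ 2) + t * a i c := by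
      intro c
      have hx : |t * a i c| ≤ 1 := by
        rw [abs_mul, abs_of_nonneg ht0]
        exact mul_le_one₀ ht1 (abs_nonneg _) (ha i c)
      have h2 := (abs_le.1 (Real.abs_exp_sub_one_sub_id_le hx)).2
      have h3 : (a i c) ^ 2 ≤ 1 := (sq_le_one_iff_abs_le_one _).2 (ha i c)
      have h4 : (t * a i c) ^ 2 ≤ t ^ 2 := by
        rw [mul_pow]; exact mul_le_of_le_one_right (sq_nonneg t) h3
      linarith
    calc ∑ c, Real.exp (t * a i c) ≤ ∑ c, ((1 + t ^ 2) + t * a i c) :=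
          Finset.sum_le_sum fun c _ => h1 c
      _ = Fintype.card C * (1 + t ^ 2) := by
          rw [Finset.sum_add_distrib, ← Finset.mul_sum, ha0]
          simp
          ring
      _ ≤ _ := mul_le_mul_of_nonneg_left (by linarith [Real.add_one_le_exp (t ^ 2)])
          (Nat.cast_nonneg _)
  have hall : ∏ i, ∑ c, Real.exp (t * a i c) ≤
      (Fintype.card C : ℝ) ^ Fintype.card ι * Real.exp (n * t ^ 2) := by
    calc ∏ i, ∑ c, Real.exp (t * a i c) ≤ ∏ _i : ι, (Fintype.card C * Real.exp (t ^ 2)) :=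
          Finset.prod_le_prod (fun i _ => Finset.sum_nonneg fun c _ => (Real.exp_pos _).le)
            fun i _ => hfac i
      _ = _ := by
          rw [Finset.prod_const, mul_pow, ← Real.exp_nat_mul]
          rfl
  have hfin := key.trans (hprod.le.trans hall)
  have he : Real.exp (-(l ^ 2 / (4 * n))) * Real.exp (t * l) = Real.exp (n * t ^ 2) := by
    rw [← Real.exp_add]
    congr 1
    rw [ht]
    field_simp
    ring
  refine le_of_mul_le_mul_right ?_ (Real.exp_pos (t * l))
  refine hfin.trans (le_of_eq ?_)
  rw [← he]
  ring

/-- Concentration of the number of `i ∈ S` with `φ i ∈ A` for a random function `φ`. -/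
theorem card_deviation_le {ι C : Type*} [Fintype ι] [DecidableEq ι] [Fintype C] [Nonempty C]
    (S : Finset ι) (A : Finset C)
    (l : ℝ) (hl : 0 ≤ l) (hι : 0 < Fintype.card ι) (hl2 : l ≤ 2 * Fintype.card ι) :
    ((Finset.univ.filter fun φ : ι → C =>
        l ≤ |((S.filter fun i => φ i ∈ A).card : ℝ) - S.card * (A.card / Fintype.card C)|).card : ℝ)
      ≤ 2 * Real.exp (-(l ^ 2 / (4 * Fintype.card ι))) *
        (Fintype.card C : ℝ) ^ Fintype.card ι := by
  set r : ℝ := A.card / Fintype.card C with hr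
  have hC : (0 : ℝ) < Fintype.card C := by exact_mod_cast Fintype.card_pos
  have hr0 : 0 ≤ r := by positivity
  have hr1 : r ≤ 1 := by
    rw [hr, div_le_one hC]; exact_mod_cast A.card_le_univ
  set a : ι → C → ℝ := fun i c => if i ∈ S then (if c ∈ A then 1 else 0) - r else 0 with ha
  have ha1 : ∀ i c, |a i c| ≤ 1 := by
    intro i c
    simp only [ha]
    split_ifs <;> rw [abs_le] <;> constructor <;> linarith
  have ha0 : ∀ i, ∑ c, a i c = 0 := by
    intro i
    simp only [ha]
    split_ifs
    · rw [Finset.sum_sub_distrib]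
      simp [hr]
      field_simp
      simp
    · simp
  have hsum : ∀ φ : ι → C, ∑ i, a i (φ i) =
      ((S.filter fun i => φ i ∈ A).card : ℝ) - S.card * r := by
    intro φ
    simp only [ha]
    rw [Finset.sum_ite_mem, Finset.univ_inter, Finset.sum_sub_distrib, Finset.sum_const,
      nsmul_eq_mul, Finset.sum_boole]
  have h1 := card_le_sum_apply a ha1 ha0 l hl hι hl2
  have h2 := card_le_sum_apply (fun i c => -a i c) (by simpa using ha1)
    (by intro i; simp [ha0 i]) l hl hι hl2
  have h3 : (Finset.univ.filter fun φ : ι → C =>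
        l ≤ |((S.filter fun i => φ i ∈ A).card : ℝ) - S.card * r|) ⊆
      (Finset.univ.filter fun φ : ι → C => l ≤ ∑ i, a i (φ i)) ∪
      (Finset.univ.filter fun φ : ι → C => l ≤ ∑ i, -a i (φ i)) := by
    intro φ hφ
    simp only [Finset.mem_filter, Finset.mem_univ, true_and, Finset.mem_union,
      Finset.sum_neg_distrib, hsum] at hφ ⊢
    exact le_abs.1 hφ
  have h4 : ((Finset.univ.filter fun φ : ι → C =>
        l ≤ |((S.filter fun i => φ i ∈ A).card : ℝ) - S.card * r|).card : ℝ) ≤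
      (Finset.univ.filter fun φ : ι → C => l ≤ ∑ i, a i (φ i)).card +
      (Finset.univ.filter fun φ : ι → C => l ≤ ∑ i, -a i (φ i)).card := by
    exact_mod_cast (Finset.card_le_card h3).trans (Finset.card_union_le _ _)
  linarith

theorem eventually_pow_mul_exp_lt (c d : ℝ) (hd : 0 < d) (a : ℕ) :
    ∃ n₀ : ℕ, ∀ n : ℕ, n₀ ≤ n → c * (n : ℝ) ^ a * Real.exp (-(d * n)) < 1 := by
  have h := (tendsto_rpow_mul_exp_neg_mul_atTop_nhds_zero a d hd).comp
    (tendsto_natCast_atTop_atTop (R := ℝ))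
  have h2 := h.const_mul c
  rw [mul_zero] at h2
  have h3 := h2.eventually (gt_mem_nhds (show (0 : ℝ) < 1 by norm_num))
  obtain ⟨n₀, hn₀⟩ := Filter.eventually_atTop.1 h3
  refine ⟨n₀, fun n hn => ?_⟩
  have := hn₀ n hn
  simpa [mul_assoc, neg_mul] using this

/-- Random colourings split every member of a polynomially large family of sets evenly. -/
theorem exists_balanced_coloring (k : ℕ) (hk : 0 < k) (δ : ℝ) (hδ : 0 < δ) (hδ1 : δ ≤ 1) :
    ∃ n₀ : ℕ, ∀ n : ℕ, n₀ ≤ n → ∀ (V C J : Type) [Fintype V] [Fintype C] [Fintype J],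
      Fintype.card V = n → Fintype.card C = k → Fintype.card J ≤ 4 * n →
      ∀ S : J → Finset V, ∃ f : V → C, ∀ j c,
        |(((S j).filter fun v => f v = c).card : ℝ) - (S j).card / k| ≤ δ * n := by
  obtain ⟨n₀, hn₀⟩ := eventually_pow_mul_exp_lt (8 * k) (δ ^ 2 / 4) (by positivity) 1
  refine ⟨max n₀ 1, fun n hn V C J _ _ _ hV hC hJ S => ?_⟩
  have hn1 : 0 < n := lt_of_lt_of_le one_pos ((le_max_right _ _).trans hn)
  have hnR : (0 : ℝ) < n := by exact_mod_cast hn1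
  have : Nonempty C := Fintype.card_pos_iff.1 (hC ▸ hk)
  have hkR : (0 : ℝ) < k := by exact_mod_cast hk
  by_contra hcon
  push Not at hcon
  have hcov : (Finset.univ : Finset (V → C)) ⊆
      Finset.univ.biUnion fun jc : J × C => Finset.univ.filter fun φ : V → C =>
        δ * n ≤ |(((S jc.1).filter fun i => φ i ∈ ({jc.2} : Finset C)).card : ℝ) -
          (S jc.1).card * ((({jc.2} : Finset C)).card / Fintype.card C)| := by
    intro φ _
    obtain ⟨j, c, h⟩ := hcon φ
    refine Finset.mem_biUnion.2 ⟨(j, c), Finset.mem_univ _, ?_⟩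
    simp only [Finset.mem_filter, Finset.mem_univ, true_and, Finset.mem_singleton,
      Finset.card_singleton, hC]
    rw [show ((S j).card : ℝ) * (((1 : ℕ) : ℝ) / k) = (S j).card / k by push_cast; ring]
    exact h.le
  have h1 := (Finset.card_le_card hcov).trans Finset.card_biUnion_le
  have h2 : ((Finset.univ : Finset (V → C)).card : ℝ) ≤
      ∑ jc : J × C, 2 * Real.exp (-((δ * n) ^ 2 / (4 * Fintype.card V))) *
        (Fintype.card C : ℝ) ^ Fintype.card V := by
    refine (Nat.cast_le.2 h1).trans ?_
    push_cast
    refine Finset.sum_le_sum fun jc _ => ?_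
    exact card_deviation_le _ _ _ (by positivity) (hV ▸ hn1) (by rw [hV]; nlinarith)
  rw [Finset.sum_const, Finset.card_univ, Finset.card_univ, Fintype.card_fun, Fintype.card_prod,
    hV, hC, nsmul_eq_mul] at h2
  have h3 := hn₀ n ((le_max_left _ _).trans hn)
  have h4 : (δ * n) ^ 2 / (4 * n) = δ ^ 2 / 4 * n := by field_simp
  rw [h4] at h2
  push_cast at h2
  have hkn : (0 : ℝ) < (k : ℝ) ^ n := by positivity
  have hJR : (Fintype.card J : ℝ) ≤ 4 * n := by exact_mod_cast hJ
  have hE := Real.exp_pos (-(δ ^ 2 / 4 * n))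
  have h5 : (Fintype.card J : ℝ) * k * (2 * Real.exp (-(δ ^ 2 / 4 * n)) * (k : ℝ) ^ n) ≤
      (8 * k * n ^ 1 * Real.exp (-(δ ^ 2 / 4 * n))) * (k : ℝ) ^ n := by
    have : (Fintype.card J : ℝ) * (k * (2 * Real.exp (-(δ ^ 2 / 4 * n)) * (k : ℝ) ^ n)) ≤
      (4 * n) * (k * (2 * Real.exp (-(δ ^ 2 / 4 * n)) * (k : ℝ) ^ n)) :=
      mul_le_mul_of_nonneg_right hJR (by positivity)
    nlinarith
  nlinarith

/-- A nonnegative integer matrix with all line sums `r + 1` dominates a permutation matrix. -/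
theorem exists_perm_pos_of_sum_eq {ι : Type*} [Fintype ι] (r : ℕ) (M : ι → ι → ℕ)
    (hrow : ∀ i, ∑ j, M i j = r + 1) (hcol : ∀ j, ∑ i, M i j = r + 1) :
    ∃ σ : Equiv.Perm ι, ∀ i, 0 < M i (σ i) := by
  have hr : (0 : ℝ) < r + 1 := by positivity
  have hmem : (Matrix.of fun i j => (M i j : ℝ) / (r + 1)) ∈ doublyStochastic ℝ ι := by
    rw [mem_doublyStochastic_iff_sum]
    refine ⟨fun i j => by simp only [Matrix.of_apply]; positivity, fun i => ?_, fun j => ?_⟩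
    · simp only [Matrix.of_apply]
      rw [← Finset.sum_div, ← Nat.cast_sum, hrow]
      push_cast
      exact div_self hr.ne'
    · simp only [Matrix.of_apply]
      rw [← Finset.sum_div, ← Nat.cast_sum, hcol]
      push_cast
      exact div_self hr.ne'
  obtain ⟨w, hw0, hw1, hw⟩ := exists_eq_sum_perm_of_mem_doublyStochastic hmem
  obtain ⟨σ, -, hσ⟩ : ∃ σ ∈ Finset.univ, 0 < w σ := by
    refine (Finset.sum_pos_iff_of_nonneg fun σ _ => hw0 σ).1 ?_
    rw [hw1]; norm_num
  refine ⟨σ, fun i => ?_⟩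
  have h1 : w σ ≤ (M i (σ i) : ℝ) / (r + 1) := by
    have h2 := congrFun (congrFun hw i) (σ i)
    simp only [Matrix.sum_apply, Matrix.smul_apply, Matrix.of_apply, smul_eq_mul] at h2
    rw [← h2]
    refine le_trans ?_ (Finset.single_le_sum
      (f := fun τ : Equiv.Perm ι => w τ * τ.permMatrix ℝ i (σ i)) (fun τ _ => ?_)
      (Finset.mem_univ σ))
    · simp [Equiv.Perm.permMatrix, PEquiv.toMatrix_apply]
    · refine mul_nonneg (hw0 τ) ?_
      simp only [Equiv.Perm.permMatrix, PEquiv.toMatrix_apply]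
      split_ifs <;> norm_num
  have h3 : 0 < (M i (σ i) : ℝ) / (r + 1) := hσ.trans_le h1
  have h4 : (0 : ℝ) < M i (σ i) := by
    rcases (Nat.cast_nonneg (M i (σ i)) : (0 : ℝ) ≤ _).eq_or_lt with h | h
    · rw [← h] at h3; simp at h3
    · exact h
  exact_mod_cast h4

/-- A nonnegative integer matrix with all line sums `r` is a sum of `r` permutation matrices. -/
theorem exists_perms_of_sum_eq {ι : Type*} [Fintype ι] (r : ℕ) :
    ∀ M : ι → ι → ℕ, (∀ i, ∑ j, M i j = r) → (∀ j, ∑ i, M i j = r) →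
    ∃ ρ : Fin r → Equiv.Perm ι, ∀ i j, M i j = ∑ l, if ρ l i = j then 1 else 0 := by
  induction r with
  | zero =>
    intro M hrow _
    refine ⟨fun l => l.elim0, fun i j => ?_⟩
    have := (Finset.sum_eq_zero_iff.1 (hrow i)) j (Finset.mem_univ j)
    simp [this]
  | succ r ih =>
    intro M hrow hcol
    obtain ⟨σ, hσ⟩ := exists_perm_pos_of_sum_eq r M hrow hcol
    have hle : ∀ i j, (if σ i = j then 1 else 0) ≤ M i j := by
      intro i j
      split_ifs with h
      · exact h ▸ hσ i
      · exact Nat.zero_le _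
    have hadd : ∀ i j, M i j = (M i j - if σ i = j then 1 else 0) + if σ i = j then 1 else 0 :=
      fun i j => (Nat.sub_add_cancel (hle i j)).symm
    have hrow' : ∀ i, ∑ j, (M i j - if σ i = j then 1 else 0) = r := by
      intro i
      have h := hrow i
      rw [Finset.sum_congr rfl fun j _ => hadd i j, Finset.sum_add_distrib] at h
      simp only [Finset.sum_ite_eq, Finset.mem_univ, if_true] at h
      omega
    have hcol' : ∀ j, ∑ i, (M i j - if σ i = j then 1 else 0) = r := by
      intro j
      have h := hcol j
      rw [Finset.sum_congr rfl fun i _ => hadd i j, Finset.sum_add_distrib] at h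
      have h2 : ∑ i, (if σ i = j then 1 else 0) = 1 := by
        rw [Finset.sum_eq_single (σ.symm j)]
        · simp
        · intro b _ hb
          rw [if_neg]
          intro hc
          exact hb (by rw [← hc]; simp)
        · simp
      rw [h2] at h
      omega
    obtain ⟨ρ, hρ⟩ := ih _ hrow' hcol'
    refine ⟨Fin.cons σ ρ, fun i j => ?_⟩
    rw [Fin.sum_univ_succ, hadd i j, hρ i j, add_comm]
    simp

/-- König's edge colouring theorem for digraphs: a relation with all semidegrees at most `D`
decomposes into `D` partial matchings, with exact control of the unmatched vertices. -/
theorem exists_matching_decomposition {V : Type*} [Fintype V] (H : V → V → Prop) (D : ℕ)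
    (hout : ∀ u, (Finset.univ.filter fun v => H u v).card ≤ D)
    (hin : ∀ v, (Finset.univ.filter fun u => H u v).card ≤ D) :
    ∃ F : Fin D → V → V → Prop,
      (∀ l u v, F l u v → H u v) ∧
      (∀ u v, H u v → ∃! l, F l u v) ∧
      (∀ l u v v', F l u v → F l u v' → v = v') ∧
      (∀ l u u' v, F l u v → F l u' v → u = u') ∧
      (∀ u, (Finset.univ.filter fun l => ∀ v, ¬ F l u v).card +
        (Finset.univ.filter fun v => H u v).card = D) ∧
      (∀ v, (Finset.univ.filter fun l => ∀ u, ¬ F l u v).card +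
        (Finset.univ.filter fun u => H u v).card = D) := by
  obtain ⟨M, hM1, hM2, hM3, hM4⟩ : ∃ M : V ⊕ V → V ⊕ V → ℕ,
      (∀ u v, M (.inl u) (.inl v) = if H u v then 1 else 0) ∧
      (∀ u v, M (.inl u) (.inr v) =
        if u = v then D - (Finset.univ.filter fun v => H u v).card else 0) ∧
      (∀ u v, M (.inr u) (.inl v) =
        if u = v then D - (Finset.univ.filter fun w => H w v).card else 0) ∧
      (∀ u v, M (.inr u) (.inr v) = if H v u then 1 else 0) :=
    ⟨fun i j => match i, j with
      | .inl u, .inl v => if H u v then 1 else 0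
      | .inl u, .inr v => if u = v then D - (Finset.univ.filter fun v => H u v).card else 0
      | .inr u, .inl v => if u = v then D - (Finset.univ.filter fun w => H w v).card else 0
      | .inr u, .inr v => if H v u then 1 else 0,
      fun _ _ => rfl, fun _ _ => rfl, fun _ _ => rfl, fun _ _ => rfl⟩
  obtain ⟨ρ, hρ⟩ := exists_perms_of_sum_eq D M (by
    rintro (u | u)
    · rw [Fintype.sum_sum_type]
      simp only [hM1, hM2, Finset.sum_boole, Finset.sum_ite_eq, Finset.mem_univ, if_true, Nat.cast_id]
      have := hout u
      omega
    · rw [Fintype.sum_sum_type]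
      simp only [hM3, hM4, Finset.sum_boole, Finset.sum_ite_eq, Finset.mem_univ, if_true, Nat.cast_id]
      have := hin u
      omega) (by
    rintro (u | u)
    · rw [Fintype.sum_sum_type]
      simp only [hM1, hM3, Finset.sum_boole, Finset.sum_ite_eq', Finset.mem_univ, if_true, Nat.cast_id]
      have := hin u
      omega
    · rw [Fintype.sum_sum_type]
      simp only [hM2, hM4, Finset.sum_boole, Finset.sum_ite_eq', Finset.mem_univ, if_true, Nat.cast_id]
      have := hout u
      omega)
  have hcount : ∀ i j, M i j = (Finset.univ.filter fun l => ρ l i = j).card := by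
    intro i j
    rw [hρ i j, Finset.card_filter]
    exact Finset.sum_congr rfl fun l _ => by congr
  have hH : ∀ l u v, ρ l (.inl u) = .inl v → H u v := by
    intro l u v h
    by_contra hn
    have h0 : M (.inl u) (.inl v) = 0 := (hM1 _ _).trans (if_neg hn)
    rw [hcount, Finset.card_eq_zero] at h0
    exact (Finset.filter_eq_empty_iff.1 h0) (Finset.mem_univ l) h
  have hmiss : ∀ u l, (∀ v, ¬ ρ l (.inl u) = .inl v) ↔ ρ l (.inl u) = .inr u := by
    intro u l
    constructor
    · intro h
      rcases hx : ρ l (.inl u) with v | v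
      · exact absurd hx (h v)
      · by_contra hne
        have huv : u ≠ v := fun e => hne (by rw [e])
        have h0 : M (.inl u) (.inr v) = 0 := (hM2 _ _).trans (if_neg huv)
        rw [hcount, Finset.card_eq_zero] at h0
        exact (Finset.filter_eq_empty_iff.1 h0) (Finset.mem_univ l) hx
    · intro h v hv
      rw [h] at hv
      cases hv
  have hmiss' : ∀ v l, (∀ u, ¬ ρ l (.inl u) = .inl v) ↔ ρ l (.inr v) = .inl v := by
    intro v l
    constructor
    · intro h
      obtain ⟨x, hx⟩ := (ρ l).surjective (.inl v)
      rcases x with u | u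
      · exact absurd hx (h u)
      · by_contra hne
        have huv : u ≠ v := fun e => hne (by rw [← hx, e])
        have h0 : M (.inr u) (.inl v) = 0 := (hM3 _ _).trans (if_neg huv)
        rw [hcount, Finset.card_eq_zero] at h0
        exact (Finset.filter_eq_empty_iff.1 h0) (Finset.mem_univ l) hx
    · intro h u hu
      have := (ρ l).injective (h.trans hu.symm)
      cases this
  refine ⟨fun l u v => ρ l (.inl u) = .inl v, hH, ?_, ?_, ?_, ?_, ?_⟩
  · intro u v huv
    have h1 : M (.inl u) (.inl v) = 1 := (hM1 _ _).trans (if_pos huv)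
    rw [hcount, Finset.card_eq_one] at h1
    obtain ⟨l, hl⟩ := h1
    refine ⟨l, ?_, fun l' hl' => ?_⟩
    · have : l ∈ (Finset.univ.filter fun l => ρ l (.inl u) = .inl v) := by rw [hl]; simp
      exact (Finset.mem_filter.1 this).2
    · have : l' ∈ (Finset.univ.filter fun l => ρ l (.inl u) = .inl v) :=
        Finset.mem_filter.2 ⟨Finset.mem_univ _, hl'⟩
      rw [hl] at this
      exact Finset.mem_singleton.1 this
  · intro l u v v' h h'
    exact Sum.inl_injective (h.symm.trans h')
  · intro l u u' v h h'
    exact Sum.inl_injective ((ρ l).injective (h.trans h'.symm))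
  · intro u
    have h1 : M (.inl u) (.inr u) = D - (Finset.univ.filter fun v => H u v).card :=
      (hM2 _ _).trans (if_pos rfl)
    rw [hcount] at h1
    simp only [hmiss]
    have := hout u
    omega
  · intro v
    have h1 : M (.inr v) (.inl v) = D - (Finset.univ.filter fun u => H u v).card :=
      (hM3 _ _).trans (if_pos rfl)
    rw [hcount] at h1
    simp only [hmiss']
    have := hin v
    omega

/-- The vertices with at least `k` in-neighbours in `S`. -/
noncomputable def robustNbhd {X : Type*} [Fintype X] (E : X → X → Prop) (k : ℝ) (S : Finset X) :
    Finset X :=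
  Finset.univ.filter fun v => k ≤ ((S.filter fun u => E u v).card : ℝ)

theorem mem_robustNbhd {X : Type*} [Fintype X] {E : X → X → Prop} {k : ℝ} {S : Finset X} {v : X} :
    v ∈ robustNbhd E k S ↔ k ≤ ((S.filter fun u => E u v).card : ℝ) := by
  simp [robustNbhd]

/-- The number of edges from `A` to `B`. -/
noncomputable def edgeCount {X : Type*} (E : X → X → Prop) (A B : Finset X) : ℝ :=
  ∑ u ∈ A, ∑ v ∈ B, if E u v then 1 else 0

section edgeCount
variable {X : Type*} (E : X → X → Prop)

theorem edgeCount_nonneg (A B : Finset X) : 0 ≤ edgeCount E A B :=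
  Finset.sum_nonneg fun _ _ => Finset.sum_nonneg fun _ _ => by split_ifs <;> norm_num

theorem edgeCount_eq_out (A B : Finset X) :
    edgeCount E A B = ∑ u ∈ A, ((B.filter fun v => E u v).card : ℝ) := by
  simp [edgeCount]

theorem edgeCount_eq_in (A B : Finset X) :
    edgeCount E A B = ∑ v ∈ B, ((A.filter fun u => E u v).card : ℝ) := by
  rw [edgeCount, Finset.sum_comm]
  simp

theorem edgeCount_le_mul (A B : Finset X) : edgeCount E A B ≤ A.card * B.card := by
  rw [edgeCount_eq_out, ← nsmul_eq_mul, ← Finset.sum_const]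
  exact Finset.sum_le_sum fun u _ => Nat.cast_le.2 (Finset.card_filter_le _ _)

theorem edgeCount_union_right (A : Finset X) {B C : Finset X} (h : Disjoint B C) :
    edgeCount E A (B ∪ C) = edgeCount E A B + edgeCount E A C := by
  simp only [edgeCount, Finset.sum_union h, Finset.sum_add_distrib]

theorem edgeCount_union_left {A B : Finset X} (C : Finset X) (h : Disjoint A B) :
    edgeCount E (A ∪ B) C = edgeCount E A C + edgeCount E B C := by
  simp only [edgeCount, Finset.sum_union h]

theorem edgeCount_add_swap_le (hE : ∀ u v, E u v → ¬ E v u) (A B : Finset X) :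
    edgeCount E A B + edgeCount E B A ≤ A.card * B.card := by
  rw [edgeCount, edgeCount, Finset.sum_comm (s := B), ← Finset.sum_add_distrib, ← nsmul_eq_mul,
    ← Finset.sum_const]
  refine Finset.sum_le_sum fun u _ => ?_
  rw [← Finset.sum_add_distrib, Finset.card_eq_sum_ones, Nat.cast_sum]
  refine Finset.sum_le_sum fun v _ => ?_
  have := hE u v
  split_ifs <;> simp_all

end edgeCount

theorem oriented_expansion_numeric {γ τ ξ p q M o : ℝ} (hξ : 0 < ξ) (hξτ : 2 * ξ ≤ τ)
    (hξγ : 10 * ξ ≤ γ) (hξ1 : ξ ≤ 1 / 100)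
    (hsum : p + q + M + o = 1)
    (hs : τ ≤ p + q) (hs' : p + q ≤ 5 / 8) (hM : M ≤ q + ξ ^ 2)
    (h1 : (3 / 8 + γ) * p ≤ p * p / 2 + p * M + ξ ^ 2)
    (h2 : (3 / 8 + γ) * o ≤ o * o / 2 + o * M + ξ ^ 2)
    (h3 : 2 * (3 / 8 + γ) * q ≤ q * (p + M + o) + 2 * ξ ^ 2)
    (h4 : (3 / 8 + γ) * q ≤ q * p + q * M + ξ ^ 2) : False := by
  have hξ2 : ξ ^ 2 ≤ ξ / 100 := by nlinarith
  have div : ∀ x y c : ℝ, ξ ≤ x → x * y ≤ c * ξ ^ 2 → 0 ≤ c → y ≤ c * ξ := by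
    intro x y c hx h hc
    by_contra hcon
    push Not at hcon
    have : 0 ≤ c * ξ := by positivity
    nlinarith [mul_lt_mul_of_pos_left hcon (hξ.trans_le hx),
      mul_le_mul_of_nonneg_right hx this]
  have e3 : ξ ≤ q → 2 * (3 / 8 + γ) - (1 - q) ≤ 2 * ξ := fun hq' =>
    div q _ 2 hq' (by rw [show 1 - q = p + M + o by linarith]; linarith) (by norm_num)
  have e1 : ξ ≤ p → (3 / 8 + γ) - p / 2 - M ≤ 1 * ξ := fun h =>
    div p _ 1 h (by linarith) (by norm_num)
  have e2 : ξ ≤ o → (3 / 8 + γ) - o / 2 - M ≤ 1 * ξ := fun h =>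
    div o _ 1 h (by linarith) (by norm_num)
  have e4 : ξ ≤ q → (3 / 8 + γ) - p - M ≤ 1 * ξ := fun h =>
    div q _ 1 h (by linarith) (by norm_num)
  rcases lt_or_ge q ξ with hq' | hq'
  · have := e1 (by linarith)
    linarith
  · have a3 := e3 hq'
    have a4 := e4 hq'
    rcases lt_or_ge p ξ with hp' | hp'
    · linarith
    · have a1 := e1 hp'
      rcases lt_or_ge o ξ with ho' | ho'
      · linarith
      · have a2 := e2 ho'
        linarith

/-- Oriented graphs with minimum semidegree above `3/8` of the order are robust expanders. -/
theorem oriented_robust_expansion {γ τ : ℝ} (hγ : 0 < γ) (hτ : 0 < τ) :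
    ∃ ν : ℝ, 0 < ν ∧ ν ≤ τ ∧ ∀ (X : Type) [Fintype X] (E : X → X → Prop),
      (∀ u v, E u v → ¬ E v u) →
      (∀ v, (3 / 8 + γ) * Fintype.card X ≤ ((Finset.univ.filter fun u => E v u).card : ℝ)) →
      (∀ v, (3 / 8 + γ) * Fintype.card X ≤ ((Finset.univ.filter fun u => E u v).card : ℝ)) →
      ∀ S : Finset X, τ * Fintype.card X ≤ S.card →
        robustNbhd E (ν * Fintype.card X) S = Finset.univ ∨
        (S.card + ν * Fintype.card X ≤ ((robustNbhd E (ν * Fintype.card X) S).card : ℝ)) := by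
  set ξ : ℝ := min (τ / 2) (min (γ / 10) (1 / 100)) with hξdef
  have hξ : 0 < ξ := by positivity
  have hξτ : ξ ≤ τ / 2 := min_le_left _ _
  have hξγ : ξ ≤ γ / 10 := (min_le_right _ _).trans (min_le_left _ _)
  have hξ1 : ξ ≤ 1 / 100 := (min_le_right _ _).trans (min_le_right _ _)
  have hν1 : ξ ^ 2 ≤ ξ := by nlinarith
  refine ⟨ξ ^ 2, by positivity, by linarith, ?_⟩
  intro X _ E hE hout hin S hS
  rcases (Fintype.card X).eq_zero_or_pos with hm | hm
  · left
    have : IsEmpty X := Fintype.card_eq_zero_iff.1 hm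
    exact Subsingleton.elim _ _
  set m : ℝ := (Fintype.card X : ℝ) with hmdef
  have hm0 : 0 < m := Nat.cast_pos.2 hm
  by_cases hbig : 5 / 8 * m ≤ S.card
  · left
    rw [Finset.eq_univ_iff_forall]
    intro v
    rw [mem_robustNbhd]
    have h1 := hin v
    have h2 : (Finset.univ.filter fun u => E u v) ⊆ (S.filter fun u => E u v) ∪ Sᶜ := by
      intro u hu
      simp only [Finset.mem_filter, Finset.mem_univ, true_and] at hu
      by_cases hS : u ∈ S <;> simp [hS, hu]
    have h3 : ((Finset.univ.filter fun u => E u v).card : ℝ) ≤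
        (S.filter fun u => E u v).card + (Sᶜ.card : ℝ) := by
      exact_mod_cast (Finset.card_le_card h2).trans (Finset.card_union_le _ _)
    have h4 : (Sᶜ.card : ℝ) = m - S.card := by
      rw [Finset.card_compl, Nat.cast_sub (Finset.card_le_univ S)]
    nlinarith
  · right
    push Not at hbig
    by_contra hcon
    push Not at hcon
    set N := robustNbhd E (ξ ^ 2 * m) S with hN
    set P := S ∩ N with hP
    set Q := S \ N with hQ
    set M := N \ S with hM
    set O := (S ∪ N)ᶜ with hO
    have hSd : Disjoint P Q := by
      rw [Finset.disjoint_left]; intro a; simp [hP, hQ]; tauto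
    have hSe : P ∪ Q = S := by ext a; simp [hP, hQ]; tauto
    have hQO : Disjoint Q O := by
      rw [Finset.disjoint_left]; intro a; simp [hQ, hO]; tauto
    have hQOe : Q ∪ O = Nᶜ := by ext a; simp [hQ, hO]; tauto
    have hPM : Disjoint P M := by
      rw [Finset.disjoint_left]; intro a; simp [hP, hM]; tauto
    have hPMe : P ∪ M = N := by ext a; simp [hP, hM]; tauto
    have hMO : Disjoint M O := by
      rw [Finset.disjoint_left]; intro a; simp [hM, hO]; tauto
    have hMOe : M ∪ O = Sᶜ := by ext a; simp [hM, hO]; tauto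
    have hright : ∀ A, edgeCount E A Finset.univ =
        edgeCount E A P + edgeCount E A M + (edgeCount E A Q + edgeCount E A O) := by
      intro A
      rw [← edgeCount_union_right E A hPM, ← edgeCount_union_right E A hQO, hPMe, hQOe,
        ← edgeCount_union_right E A disjoint_compl_right, Finset.union_compl]
    have hleft : ∀ A, edgeCount E Finset.univ A =
        edgeCount E P A + edgeCount E Q A + (edgeCount E M A + edgeCount E O A) := by
      intro A
      rw [← edgeCount_union_left E A hSd, ← edgeCount_union_left E A hMO, hSe, hMOe,
        ← edgeCount_union_left E A disjoint_compl_right, Finset.union_compl]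
    have hlow : edgeCount E S Nᶜ ≤ ξ ^ 2 * m * m := by
      rw [edgeCount_eq_in]
      calc _ ≤ ∑ v ∈ Nᶜ, ξ ^ 2 * m := by
            refine Finset.sum_le_sum fun v hv => ?_
            rw [Finset.mem_compl, hN, mem_robustNbhd, not_le] at hv
            exact hv.le
        _ ≤ _ := by
            rw [Finset.sum_const, nsmul_eq_mul, mul_comm]
            refine mul_le_mul_of_nonneg_left ?_ (by positivity)
            exact Nat.cast_le.2 (Finset.card_le_univ _)
    rw [← hSe, ← hQOe, edgeCount_union_left E _ hSd, edgeCount_union_right E _ hQO,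
      edgeCount_union_right E _ hQO] at hlow
    have hdout : ∀ A, (3 / 8 + γ) * m * A.card ≤ edgeCount E A Finset.univ := by
      intro A
      rw [edgeCount_eq_out, mul_comm, ← nsmul_eq_mul, ← Finset.sum_const]
      exact Finset.sum_le_sum fun v _ => hout v
    have hdin : ∀ A, (3 / 8 + γ) * m * A.card ≤ edgeCount E Finset.univ A := by
      intro A
      rw [edgeCount_eq_in, mul_comm, ← nsmul_eq_mul, ← Finset.sum_const]
      exact Finset.sum_le_sum fun v _ => hin v
    have hself : ∀ A, edgeCount E A A ≤ (A.card : ℝ) * A.card / 2 := by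
      intro A
      have := edgeCount_add_swap_le E hE A A
      linarith
    have hSc : (P.card : ℝ) + Q.card = S.card := by
      rw [← hSe, Finset.card_union_of_disjoint hSd]; push_cast; rfl
    have hNc : (P.card : ℝ) + M.card = N.card := by
      rw [← hPMe, Finset.card_union_of_disjoint hPM]; push_cast; rfl
    have hScc : (M.card : ℝ) + O.card = m - S.card := by
      have h : (M.card : ℝ) + O.card = (Sᶜ.card : ℝ) := by
        rw [← hMOe, Finset.card_union_of_disjoint hMO]; push_cast; rfl
      rw [h, Finset.card_compl, Nat.cast_sub (Finset.card_le_univ S)]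
    have n1 := edgeCount_nonneg E P Q
    have n2 := edgeCount_nonneg E P O
    have n3 := edgeCount_nonneg E Q Q
    have n4 := edgeCount_nonneg E Q O
    have o1 := hdout P
    have o2 := hdin O
    have o3 := hdout Q
    have o4 := hdin Q
    rw [hright] at o1 o3
    rw [hleft] at o2 o4
    have s1 := hself P
    have s2 := hself O
    have l1 := edgeCount_le_mul E P M
    have l2 := edgeCount_le_mul E M O
    have l3 := edgeCount_le_mul E Q P
    have l4 := edgeCount_le_mul E Q M
    have w1 := edgeCount_add_swap_le E hE Q P
    have w2 := edgeCount_add_swap_le E hE Q M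
    have w3 := edgeCount_add_swap_le E hE Q O
    have hm2 : 0 < m * m := by positivity
    obtain ⟨p, hp⟩ : ∃ p : ℝ, (P.card : ℝ) = p * m := ⟨P.card / m, by field_simp⟩
    obtain ⟨q, hq⟩ : ∃ p : ℝ, (Q.card : ℝ) = p * m := ⟨Q.card / m, by field_simp⟩
    obtain ⟨r, hr⟩ : ∃ p : ℝ, (M.card : ℝ) = p * m := ⟨M.card / m, by field_simp⟩
    obtain ⟨o, ho⟩ : ∃ p : ℝ, (O.card : ℝ) = p * m := ⟨O.card / m, by field_simp⟩
    rw [hp, hq] at hSc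
    rw [hp, hr] at hNc
    rw [hr, ho] at hScc
    rw [hp] at o1 s1
    rw [ho] at o2 s2
    rw [hq] at o3 o4
    rw [hp, hr] at l1
    rw [hr, ho] at l2
    rw [hq, hp] at l3 w1
    rw [hq, hr] at l4 w2
    rw [hq, ho] at w3
    refine oriented_expansion_numeric (γ := γ) (τ := τ) (ξ := ξ) (p := p)
      (q := q) (M := r) (o := o) hξ (by linarith) (by linarith) hξ1 ?_ ?_ ?_ ?_ ?_ ?_ ?_ ?_
    · exact mul_right_cancel₀ hm0.ne' (by linarith)
    · exact le_of_mul_le_mul_right (by linarith) hm0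
    · exact le_of_mul_le_mul_right (by linarith) hm0
    · exact le_of_mul_le_mul_right (by linarith) hm0
    · exact le_of_mul_le_mul_right (by linarith) hm2
    · exact le_of_mul_le_mul_right (by linarith) hm2
    · exact le_of_mul_le_mul_right (by linarith) hm2
    · exact le_of_mul_le_mul_right (by linarith) hm2

/-- `l` is a walk of the digraph `E` from `x` to `y`, given by its list of vertices. -/
def IsWalk {X : Type*} (E : X → X → Prop) (x y : X) (l : List X) : Prop :=
  l.IsChain E ∧ l.head? = some x ∧ l.getLast? = some y

section IsWalk
variable {X : Type*} {E : X → X → Prop}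

theorem IsWalk.singleton (x : X) : IsWalk E x x [x] := ⟨by simp, rfl, rfl⟩

theorem IsWalk.append {a b c d : X} {l l' : List X} (h : IsWalk E a b l) (h' : IsWalk E c d l')
    (hbc : E b c) : IsWalk E a d (l ++ l') := by
  refine ⟨List.isChain_append.2 ⟨h.1, h'.1, ?_⟩, ?_, ?_⟩
  · intro x hx y hy
    rw [h.2.2] at hx
    rw [h'.2.1] at hy
    simp only [Option.mem_def, Option.some.injEq] at hx hy
    exact hx ▸ hy ▸ hbc
  · simp [List.head?_append, h.2.1]
  · simp [List.getLast?_append, h'.2.2]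

theorem IsWalk.last_mem {a b : X} {l : List X} (h : IsWalk E a b l) : b ∈ l :=
  List.mem_of_getLast? h.2.2

theorem IsWalk.head_mem {a b : X} {l : List X} (h : IsWalk E a b l) : a ∈ l :=
  List.mem_of_head? h.2.1

/-- `B` can absorb any walk leading from an out-neighbour of `w` to an in-neighbour of `u`. -/
def IsAbsorber (E : X → X → Prop) (u w : X) (B : List X) : Prop :=
  ∃ a b, IsWalk E a b B ∧ ∀ c d I, IsWalk E c d I → E w c → E d u →
    ∃ B', B'.Perm (B ++ I) ∧ IsWalk E a b B'

theorem IsAbsorber.pair {u w : X} (h : E w u) : IsAbsorber E u w [w, u] := by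
  refine ⟨w, u, (IsWalk.singleton w).append (IsWalk.singleton u) h, fun c d I hI hc hd => ?_⟩
  refine ⟨[w] ++ (I ++ [u]), ?_, (IsWalk.singleton w).append (hI.append (IsWalk.singleton u) hd) hc⟩
  rw [show [w, u] ++ I = [w] ++ ([u] ++ I) from rfl]
  exact List.Perm.append_left _ List.perm_append_comm

end IsWalk

/-- A digraph in which large sets expand robustly, in both directions. -/
structure IsExpander {X : Type*} [Fintype X] (E : X → X → Prop) (ν τ δ : ℝ) : Prop where
  out_deg : ∀ v, δ * Fintype.card X ≤ ((Finset.univ.filter fun u => E v u).card : ℝ)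
  in_deg : ∀ v, δ * Fintype.card X ≤ ((Finset.univ.filter fun u => E u v).card : ℝ)
  expand : ∀ S : Finset X, τ * Fintype.card X ≤ S.card →
    min (S.card + ν * Fintype.card X) ((1 - τ) * Fintype.card X) ≤
      ((robustNbhd E (ν * Fintype.card X) S).card : ℝ)
  expand_flip : ∀ S : Finset X, τ * Fintype.card X ≤ S.card →
    min (S.card + ν * Fintype.card X) ((1 - τ) * Fintype.card X) ≤
      ((robustNbhd (flip E) (ν * Fintype.card X) S).card : ℝ)

section IsExpander
variable {X : Type*} [Fintype X] {E : X → X → Prop} {ν τ δ : ℝ}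

theorem IsExpander.flip (h : IsExpander E ν τ δ) : IsExpander (flip E) ν τ δ :=
  ⟨h.in_deg, h.out_deg, h.expand_flip, h.expand⟩

theorem IsExpander.robustNbhd_eq_univ (h : IsExpander E ν τ δ) (hντ : ν + τ ≤ δ)
    {S : Finset X} (hS : (1 - τ) * Fintype.card X ≤ S.card) :
    robustNbhd E (ν * Fintype.card X) S = Finset.univ := by
  rw [Finset.eq_univ_iff_forall]
  intro v
  rw [mem_robustNbhd]
  have h1 := h.in_deg v
  have h2 : (Finset.univ.filter fun u => E u v) ⊆ (S.filter fun u => E u v) ∪ Sᶜ := by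
    intro u hu
    simp only [Finset.mem_filter, Finset.mem_univ, true_and] at hu
    by_cases hS : u ∈ S <;> simp [hS, hu]
  have h3 : ((Finset.univ.filter fun u => E u v).card : ℝ) ≤
      (S.filter fun u => E u v).card + (Sᶜ.card : ℝ) := by
    exact_mod_cast (Finset.card_le_card h2).trans (Finset.card_union_le _ _)
  have h4 : (Sᶜ.card : ℝ) = Fintype.card X - S.card := by
    rw [Finset.card_compl, Nat.cast_sub (Finset.card_le_univ S)]
  have : (0 : ℝ) ≤ Fintype.card X := Nat.cast_nonneg _
  nlinarith

/-- Iterating an expanding set operation reaches everything. -/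
theorem iterate_eq_univ (hν : 0 < ν) (F : Finset X → Finset X)
    (hF : ∀ S : Finset X, τ * Fintype.card X ≤ S.card →
      min (S.card + ν * Fintype.card X) ((1 - τ) * Fintype.card X) ≤ ((F S).card : ℝ))
    (hF' : ∀ S : Finset X, (1 - τ) * Fintype.card X ≤ S.card → F S = Finset.univ)
    (hτ : 2 * τ ≤ 1) (hτ0 : 0 ≤ τ) (S : Finset X) (hS : τ * Fintype.card X ≤ S.card) :
    F^[⌈1 / ν⌉₊ + 1] S = Finset.univ := by
  have hm : (0 : ℝ) ≤ Fintype.card X := Nat.cast_nonneg _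
  have key : ∀ j : ℕ, min ((τ + j * ν) * Fintype.card X) ((1 - τ) * Fintype.card X) ≤
      ((F^[j] S).card : ℝ) := by
    intro j
    induction j with
    | zero => simpa using Or.inl hS
    | succ j ih =>
      rw [Function.iterate_succ_apply']
      have hj : (0 : ℝ) ≤ j * ν := by positivity
      have h1 : τ * Fintype.card X ≤ ((F^[j] S).card : ℝ) := by
        refine le_trans (le_min ?_ ?_) ih
        · exact mul_le_mul_of_nonneg_right (by linarith) hm
        · exact mul_le_mul_of_nonneg_right (by linarith) hm
      refine le_trans (le_min ?_ (min_le_right _ _)) (hF _ h1)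
      rcases le_total ((τ + j * ν) * Fintype.card X) ((1 - τ) * Fintype.card X) with h | h
      · rw [min_eq_left h] at ih
        refine (min_le_left _ _).trans ?_
        push_cast
        linarith
      · rw [min_eq_right h] at ih
        refine (min_le_right _ _).trans ?_
        have : 0 ≤ ν * Fintype.card X := by positivity
        linarith
  rw [Function.iterate_succ_apply']
  refine hF' _ (le_trans (le_min ?_ le_rfl) (key _))
  refine mul_le_mul_of_nonneg_right ?_ hm
  have h1 : 1 ≤ (⌈1 / ν⌉₊ : ℝ) * ν := by
    have := Nat.le_ceil (1 / ν)
    rwa [div_le_iff₀ hν] at this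
  linarith

theorem exists_mem_robustNbhd {k : ℝ} {S Z : Finset X} {v : X} (h : v ∈ robustNbhd E k S)
    (hZ : (Z.card : ℝ) < k) : ∃ u ∈ S, E u v ∧ u ∉ Z := by
  rw [mem_robustNbhd] at h
  have : Z.card < (S.filter fun u => E u v).card := by exact_mod_cast hZ.trans_le h
  obtain ⟨u, hu, huZ⟩ := Finset.exists_mem_notMem_of_card_lt_card this
  rw [Finset.mem_filter] at hu
  exact ⟨u, hu.1, hu.2, huZ⟩

theorem exists_walk_of_mem_iterate {k : ℝ} (x : X) (j : ℕ) : ∀ (y : X) (Z : Finset X),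
    y ∈ (robustNbhd E k)^[j] (Finset.univ.filter fun u => E x u) → y ∉ Z → (Z.card : ℝ) + j < k →
    ∃ a l, E x a ∧ IsWalk E a y l ∧ l.Nodup ∧ (∀ z ∈ l, z ∉ Z) ∧ l.length ≤ j + 1 := by
  induction j with
  | zero =>
    intro y Z hy hyZ _
    exact ⟨y, [y], by simpa using hy, IsWalk.singleton y, by simp, by simpa using hyZ, by simp⟩
  | succ j ih =>
    intro y Z hy hyZ hk
    rw [Function.iterate_succ_apply'] at hy
    push_cast at hk
    have hc : ((insert y Z).card : ℝ) ≤ Z.card + 1 := by exact_mod_cast Finset.card_insert_le y Z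
    have hj : (0 : ℝ) ≤ j := Nat.cast_nonneg _
    obtain ⟨u, huR, huy, huZ⟩ := exists_mem_robustNbhd hy (Z := insert y Z) (by linarith)
    obtain ⟨a, l, hxa, hl, hnd, hlZ, hlen⟩ := ih u (insert y Z) huR huZ (by linarith)
    refine ⟨a, l ++ [y], hxa, hl.append (IsWalk.singleton y) huy, ?_, ?_, by simp; omega⟩
    · rw [List.nodup_append']
      refine ⟨hnd, by simp, ?_⟩
      intro z hz hz'
      rw [List.mem_singleton] at hz'
      exact hlZ z hz (by simp [hz'])
    · intro z hz
      rw [List.mem_append, List.mem_singleton] at hz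
      rcases hz with hz | hz
      · exact fun h => hlZ z hz (by simp [h])
      · exact hz ▸ hyZ

/-- Any vertex of an expander can be reached from any other by a short path avoiding a
small set. -/
theorem IsExpander.exists_walk (h : IsExpander E ν τ δ) (hν : 0 < ν) (hτ0 : 0 ≤ τ)
    (hτ : 2 * τ ≤ 1) (hντ : ν + τ ≤ δ) (x y : X) (Z : Finset X) (hy : y ∉ Z)
    (hZ : (Z.card : ℝ) + (⌈1 / ν⌉₊ + 1 : ℕ) < ν * Fintype.card X) :
    ∃ a l, E x a ∧ IsWalk E a y l ∧ l.Nodup ∧ (∀ z ∈ l, z ∉ Z) ∧ l.length ≤ ⌈1 / ν⌉₊ + 2 := by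
  refine exists_walk_of_mem_iterate (k := ν * Fintype.card X) x (⌈1 / ν⌉₊ + 1) y Z ?_ hy hZ
  rw [iterate_eq_univ hν _ h.expand (fun S hS => h.robustNbhd_eq_univ hντ hS) hτ hτ0]
  · exact Finset.mem_univ y
  · refine le_trans (mul_le_mul_of_nonneg_right ?_ (Nat.cast_nonneg _)) (h.out_deg x)
    linarith

/-- The set operation driving the construction of absorbers. -/
noncomputable def absorberStep (E : X → X → Prop) (k : ℝ) (S : Finset X) : Finset X :=
  robustNbhd (_root_.flip E) k (robustNbhd E k
    (robustNbhd (_root_.flip E) k (robustNbhd E k S)))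

theorem exists_absorber_of_mem_iterate {k : ℝ} {c : ℕ}
    (hconn : ∀ (x y : X) (Z : Finset X), y ∉ Z → (Z.card : ℝ) + c < k →
      ∃ a l, E x a ∧ IsWalk E a y l ∧ l.Nodup ∧ (∀ z ∈ l, z ∉ Z) ∧ l.length ≤ c)
    (u : X) (j : ℕ) : ∀ (w : X) (Z : Finset X),
    w ∈ (absorberStep E k)^[j] (Finset.univ.filter fun v => E v u) → u ∉ Z → w ∉ Z → u ≠ w →
    (Z.card : ℝ) + ((j + 1) * (2 * c + 10) : ℕ) < k →
    ∃ B, IsAbsorber E u w B ∧ B.Nodup ∧ (∀ z ∈ B, z ∉ Z) ∧ B.length ≤ (j + 1) * (2 * c + 2) := by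
  induction j with
  | zero =>
    intro w Z hw hu hwZ huw _
    have hwu : E w u := by simpa using hw
    refine ⟨[w, u], IsAbsorber.pair hwu, by simp [huw.symm], ?_, by simp⟩
    intro z hz
    simp only [List.mem_cons, List.not_mem_nil, or_false] at hz
    rcases hz with rfl | rfl <;> assumption
  | succ j ih =>
    intro w Z hw hu hwZ huw hk
    rw [Function.iterate_succ_apply', absorberStep] at hw
    have hkN : ∀ n : ℕ, n ≤ Z.card + (j + 1 + 1) * (2 * c + 10) → (n : ℝ) < k := by
      intro n hn
      refine lt_of_le_of_lt ?_ hk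
      exact_mod_cast hn
    have hexp : (j + 1 + 1) * (2 * c + 10) = (j + 1) * (2 * c + 10) + (2 * c + 10) := by ring
    have hexp' : (j + 1) * (2 * c + 10) = (j + 1) * (2 * c + 2) + 8 * (j + 1) := by ring
    have hexp'' : (j + 1 + 1) * (2 * c + 2) = (j + 1) * (2 * c + 2) + (2 * c + 2) := by ring
    have c0 := Finset.card_insert_le w Z
    have c1 := Finset.card_insert_le u (insert w Z)
    obtain ⟨y2, hy2, hwy2, hy2Z⟩ := exists_mem_robustNbhd hw (Z := insert u (insert w Z))
      (hkN _ (by omega))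
    have c2 := Finset.card_insert_le y2 (insert u (insert w Z))
    obtain ⟨x1, hx1, hxy2, hx1Z⟩ := exists_mem_robustNbhd hy2
      (Z := insert y2 (insert u (insert w Z))) (hkN _ (by omega))
    have c3 := Finset.card_insert_le x1 (insert y2 (insert u (insert w Z)))
    obtain ⟨y1, hy1, hxy1, hy1Z⟩ := exists_mem_robustNbhd hx1
      (Z := insert x1 (insert y2 (insert u (insert w Z)))) (hkN _ (by omega))
    have c4 := Finset.card_insert_le y1 (insert x1 (insert y2 (insert u (insert w Z))))
    obtain ⟨w', hw', hw'y1, hw'Z⟩ := exists_mem_robustNbhd hy1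
      (Z := insert y1 (insert x1 (insert y2 (insert u (insert w Z))))) (hkN _ (by omega))
    simp only [_root_.flip, Finset.mem_insert, not_or] at hwy2 hxy1 hy2Z hx1Z hy1Z hw'Z
    set Z' := insert y1 (insert x1 (insert y2 (insert w Z))) with hZ'
    have d2 := Finset.card_insert_le y2 (insert w Z)
    have d3 := Finset.card_insert_le x1 (insert y2 (insert w Z))
    have d4 : Z'.card ≤ _ := Finset.card_insert_le y1 (insert x1 (insert y2 (insert w Z)))
    obtain ⟨B, ⟨a, b, hB, habs⟩, hBnd, hBZ, hBlen⟩ := ih w' Z' hw'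
      (by simp only [hZ', Finset.mem_insert, not_or]; tauto)
      (by simp only [hZ', Finset.mem_insert, not_or]; tauto) (Ne.symm hw'Z.2.2.2.1)
      (by have := hkN (Z'.card + (j + 1) * (2 * c + 10)) (by omega); push_cast at this ⊢; exact this)
    have hBZ2 : ∀ z ∈ B, z ≠ y1 ∧ z ≠ x1 ∧ z ≠ y2 ∧ z ≠ w ∧ z ∉ Z := by
      intro z hz
      have := hBZ z hz
      simpa only [hZ', Finset.mem_insert, not_or] using this
    set Z1 := insert y1 (insert x1 (insert y2 (Z ∪ B.toFinset))) with hZ1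
    have f1 : Z1.card ≤ Z.card + B.length + 3 := by
      have g0 := Finset.card_union_le Z B.toFinset
      have g1 := B.toFinset_card_le
      have g2 := Finset.card_insert_le y2 (Z ∪ B.toFinset)
      have g3 := Finset.card_insert_le x1 (insert y2 (Z ∪ B.toFinset))
      have g4 : Z1.card ≤ _ := Finset.card_insert_le y1 (insert x1 (insert y2 (Z ∪ B.toFinset)))
      omega
    have hwZ1 : w ∉ Z1 := by
      simp only [hZ1, Finset.mem_insert, Finset.mem_union, List.mem_toFinset, not_or]
      refine ⟨fun h => hy1Z.2.2.2.1 h.symm, fun h => hx1Z.2.2.1 h.symm,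
        fun h => hy2Z.2.1 h.symm, hwZ, fun h => (hBZ2 w h).2.2.2.1 rfl⟩
    obtain ⟨e, D, hy1e, hD, hDnd, hDZ, hDlen⟩ := hconn y1 w Z1 hwZ1
      (by have := hkN (Z1.card + c) (by omega); push_cast at this ⊢; exact this)
    have hDZ2 : ∀ z ∈ D, z ≠ y1 ∧ z ≠ x1 ∧ z ≠ y2 ∧ z ∉ Z ∧ z ∉ B := by
      intro z hz
      have := hDZ z hz
      simpa only [hZ1, Finset.mem_insert, Finset.mem_union, List.mem_toFinset, not_or] using this
    set Z2 := insert y1 (insert y2 ((Z ∪ B.toFinset) ∪ D.toFinset)) with hZ2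
    have f2 : Z2.card ≤ Z.card + B.length + D.length + 2 := by
      have g0 := Finset.card_union_le Z B.toFinset
      have g1 := B.toFinset_card_le
      have g2 := Finset.card_union_le (Z ∪ B.toFinset) D.toFinset
      have g3 := D.toFinset_card_le
      have g4 := Finset.card_insert_le y2 ((Z ∪ B.toFinset) ∪ D.toFinset)
      have g5 : Z2.card ≤ _ := Finset.card_insert_le y1 (insert y2 ((Z ∪ B.toFinset) ∪ D.toFinset))
      omega
    have hx1Z2 : x1 ∉ Z2 := by
      simp only [hZ2, Finset.mem_insert, Finset.mem_union, List.mem_toFinset, not_or]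
      refine ⟨fun h => hy1Z.1 h.symm, hx1Z.1, ⟨hx1Z.2.2.2, fun h => (hBZ2 _ h).2.1 rfl⟩,
        fun h => (hDZ2 _ h).2.1 rfl⟩
    obtain ⟨f, C, hbf, hC, hCnd, hCZ, hClen⟩ := hconn b x1 Z2 hx1Z2
      (by have := hkN (Z2.card + c) (by omega); push_cast at this ⊢; exact this)
    have hCZ2 : ∀ z ∈ C, z ≠ y1 ∧ z ≠ y2 ∧ z ∉ Z ∧ z ∉ B ∧ z ∉ D := by
      intro z hz
      have := hCZ z hz
      simp only [hZ2, Finset.mem_insert, Finset.mem_union, List.mem_toFinset, not_or] at this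
      tauto
    have hD' : IsWalk E y1 w ([y1] ++ D) := (IsWalk.singleton y1).append hD hy1e
    have hy2w := IsWalk.singleton (E := E) y2
    refine ⟨B ++ (C ++ (([y1] ++ D) ++ [y2])), ⟨a, y2, ?_, ?_⟩, ?_, ?_, ?_⟩
    · exact hB.append (hC.append (hD'.append hy2w hwy2) hxy1) hbf
    · intro g h I hI hwg hhu
      obtain ⟨B', hB'p, hB'⟩ := habs y1 h (([y1] ++ D) ++ I) (hD'.append hI hwg) hw'y1 hhu
      refine ⟨B' ++ (C ++ [y2]), ?_, hB'.append (hC.append hy2w hxy2) hbf⟩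
      refine (hB'p.append_right _).trans ?_
      rw [← Multiset.coe_eq_coe]
      simp only [← Multiset.coe_add]
      abel
    · simp only [List.nodup_append', List.disjoint_left, List.mem_append, List.mem_singleton]
      refine ⟨hBnd, ⟨hCnd, ⟨⟨by simp, hDnd, ?_⟩, by simp, ?_⟩, ?_⟩, ?_⟩
      · rintro z rfl hz
        exact (hDZ2 _ hz).1 rfl
      · rintro z (rfl | hz) rfl
        · exact hy1Z.2.1 rfl
        · exact (hDZ2 _ hz).2.2.1 rfl
      · rintro z hz ((rfl | hz') | rfl)
        · exact (hCZ2 _ hz).1 rfl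
        · exact (hCZ2 _ hz).2.2.2.2 hz'
        · exact (hCZ2 _ hz).2.1 rfl
      · rintro z hz (hz' | (rfl | hz') | rfl)
        · exact (hCZ2 _ hz').2.2.2.1 hz
        · exact (hBZ2 _ hz).1 rfl
        · exact (hDZ2 _ hz').2.2.2.2 hz
        · exact (hBZ2 _ hz).2.2.1 rfl
    · simp only [List.mem_append, List.mem_singleton]
      rintro z (hz | hz | (rfl | hz) | rfl)
      · exact (hBZ2 _ hz).2.2.2.2
      · exact (hCZ2 _ hz).2.2.1
      · exact hy1Z.2.2.2.2
      · exact (hDZ2 _ hz).2.2.2.1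
      · exact hy2Z.2.2
    · simp only [List.length_append, List.length_singleton]
      omega

theorem IsExpander.absorberStep_card (h : IsExpander E ν τ δ) (hν : 0 ≤ ν) (hτ : 2 * τ ≤ 1)
    (S : Finset X) (hS : τ * Fintype.card X ≤ S.card) :
    min (S.card + ν * Fintype.card X) ((1 - τ) * Fintype.card X) ≤
      ((absorberStep E (ν * Fintype.card X) S).card : ℝ) := by
  have hm : (0 : ℝ) ≤ Fintype.card X := Nat.cast_nonneg _
  have hνm : 0 ≤ ν * Fintype.card X := by positivity
  set t := min (S.card + ν * Fintype.card X) ((1 - τ) * Fintype.card X) with ht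
  have ht1 : τ * Fintype.card X ≤ t :=
    le_min (by linarith) (mul_le_mul_of_nonneg_right (by linarith) hm)
  have step : ∀ T : Finset X, t ≤ T.card →
      t ≤ min (T.card + ν * Fintype.card X) ((1 - τ) * Fintype.card X) := fun T hT =>
    le_min (by linarith) (min_le_right _ _)
  have a1 : t ≤ _ := h.expand S hS
  have a2 := (step _ a1).trans (h.expand_flip _ (ht1.trans a1))
  have a3 := (step _ a2).trans (h.expand _ (ht1.trans a2))
  exact (step _ a3).trans (h.expand_flip _ (ht1.trans a3))

/-- Any two vertices of an expander have a short absorber avoiding a small set. -/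
theorem IsExpander.exists_absorber (h : IsExpander E ν τ δ) (hν : 0 < ν) (hτ0 : 0 ≤ τ)
    (hτ : 2 * τ ≤ 1) (hντ : ν + τ ≤ δ) (u w : X) (Z : Finset X) (hu : u ∉ Z) (hw : w ∉ Z)
    (huw : u ≠ w)
    (hZ : (Z.card : ℝ) + ((⌈1 / ν⌉₊ + 2) * (2 * (⌈1 / ν⌉₊ + 2) + 10) : ℕ) < ν * Fintype.card X) :
    ∃ B, IsAbsorber E u w B ∧ B.Nodup ∧ (∀ z ∈ B, z ∉ Z) ∧
      B.length ≤ (⌈1 / ν⌉₊ + 2) * (2 * (⌈1 / ν⌉₊ + 2) + 2) := by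
  refine exists_absorber_of_mem_iterate (k := ν * Fintype.card X) (c := ⌈1 / ν⌉₊ + 2)
    (fun x y Z' hy hZ' => h.exists_walk hν hτ0 hτ hντ x y Z' hy ?_) u (⌈1 / ν⌉₊ + 1) w Z ?_
    hu hw huw hZ
  · push_cast at hZ' ⊢
    linarith
  · have hm : (0 : ℝ) ≤ Fintype.card X := Nat.cast_nonneg _
    have huniv : (1 - τ) * Fintype.card X ≤ ((Finset.univ : Finset X).card : ℝ) := by
      rw [Finset.card_univ]
      nlinarith
    rw [iterate_eq_univ hν _ (h.absorberStep_card hν.le hτ) ?_ hτ hτ0]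
    · exact Finset.mem_univ w
    · refine le_trans (mul_le_mul_of_nonneg_right ?_ hm) (h.in_deg u)
      linarith
    · intro S hS
      rw [absorberStep, h.robustNbhd_eq_univ hντ hS, h.flip.robustNbhd_eq_univ hντ huniv,
        h.robustNbhd_eq_univ hντ huniv, h.flip.robustNbhd_eq_univ hντ huniv]

end IsExpander

/-- A functional, injective relation that increases a rank function splits a finite set into
walks, one for every vertex without successor. -/
theorem exists_walk_partition {Y : Type*} (F : Y → Y → Prop) (rk : Y → ℕ)
    (hrk : ∀ x y, F x y → rk x < rk y) (hfun : ∀ x y y', F x y → F x y' → y = y')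
    (hinj : ∀ x x' y, F x y → F x' y → x = x') (T : Finset Y) :
    ∃ J : List (List Y), (∀ l ∈ J, ∃ a b, IsWalk F a b l ∧ (∀ y ∈ T, ¬ F y a) ∧ ∀ y ∈ T, ¬ F b y) ∧
      J.flatten.Nodup ∧ (∀ x, x ∈ J.flatten ↔ x ∈ T) ∧
      J.length = (T.filter fun x => ∀ y ∈ T, ¬ F x y).card := by
  induction T using Finset.induction_on_max_value rk with
  | empty => exact ⟨[], by simp⟩
  | insert v T hv hmax ih =>
    obtain ⟨J, hJw, hJnd, hJT, hJlen⟩ := ih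
    have hvout : ∀ y ∈ insert v T, ¬ F v y := by
      intro y hy h
      have h1 := hrk _ _ h
      rcases Finset.mem_insert.1 hy with rfl | hy
      · exact lt_irrefl _ h1
      · exact absurd (hmax y hy) (not_le.2 h1)
    by_cases hpred : ∃ u ∈ T, F u v
    · obtain ⟨u, huT, huv⟩ := hpred
      obtain ⟨l, hlJ, hul⟩ := List.mem_flatten.1 ((hJT u).2 huT)
      obtain ⟨J1, J2, rfl⟩ := List.append_of_mem hlJ
      obtain ⟨a, b, hl, ha, hb⟩ := hJw l hlJ
      have hbu : b = u := by
        obtain ⟨l1, l2, rfl⟩ := List.append_of_mem hul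
        cases l2 with
        | nil =>
          have := hl.2.2
          simp at this
          exact this.symm
        | cons y l2 =>
          exfalso
          have h1 := hl.1
          rw [List.isChain_append_cons_cons] at h1
          have hyv := hfun _ _ _ h1.2.1 huv
          refine hv ((hJT v).1 (List.mem_flatten.2 ⟨_, hlJ, ?_⟩))
          simp [hyv]
      subst hbu
      have hperm : (J1 ++ (l ++ [v]) :: J2).flatten.Perm (v :: (J1 ++ l :: J2).flatten) := by
        have := List.perm_middle (a := v) (l₁ := J1.flatten ++ l) (l₂ := J2.flatten)
        simpa using this
      have hother : ∀ l' ∈ J1 ++ J2, b ∉ l' := by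
        intro l' hl' hbl'
        rw [List.nodup_flatten] at hJnd
        have h2 := hJnd.2
        rw [List.pairwise_append, List.pairwise_cons] at h2
        rcases List.mem_append.1 hl' with h | h
        · exact h2.2.2 l' h l (by simp) hbl' hul
        · exact h2.2.1.1 l' h hul hbl'
      refine ⟨J1 ++ (l ++ [v]) :: J2, ?_, ?_, ?_, ?_⟩
      · intro l' hl'
        have hcase : l' = l ++ [v] ∨ l' ∈ J1 ++ J2 := by
          simp only [List.mem_append, List.mem_cons] at hl' ⊢
          tauto
        rcases hcase with rfl | hl''
        · refine ⟨a, v, hl.append (IsWalk.singleton v) huv, ?_, hvout⟩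
          intro y hy h
          rcases Finset.mem_insert.1 hy with rfl | hy
          · exact hvout a (Finset.mem_insert_of_mem
              ((hJT a).1 (List.mem_flatten.2 ⟨l, hlJ, hl.head_mem⟩))) h
          · exact ha y hy h
        · have hl3 : l' ∈ J1 ++ l :: J2 := by
            simp only [List.mem_append, List.mem_cons] at hl'' ⊢
            tauto
          obtain ⟨a', b', hw, ha', hb'⟩ := hJw l' hl3
          refine ⟨a', b', hw, ?_, ?_⟩
          · intro y hy h
            rcases Finset.mem_insert.1 hy with rfl | hy
            · exact hvout a' (Finset.mem_insert_of_mem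
                ((hJT a').1 (List.mem_flatten.2 ⟨l', hl3, hw.head_mem⟩))) h
            · exact ha' y hy h
          · intro y hy h
            rcases Finset.mem_insert.1 hy with rfl | hy
            · exact hother l' hl'' (hinj _ _ _ huv h ▸ hw.last_mem)
            · exact hb' y hy h
      · rw [hperm.nodup_iff, List.nodup_cons]
        exact ⟨fun h => hv ((hJT v).1 h), hJnd⟩
      · intro x
        rw [hperm.mem_iff, List.mem_cons, hJT, Finset.mem_insert]
      · have hset : ((insert v T).filter fun x => ∀ y ∈ insert v T, ¬ F x y) =
            insert v ((T.filter fun x => ∀ y ∈ T, ¬ F x y).erase b) := by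
          ext x
          simp only [Finset.mem_filter, Finset.mem_insert, Finset.mem_erase]
          constructor
          · rintro ⟨rfl | hx, h⟩
            · exact Or.inl rfl
            · refine Or.inr ⟨?_, hx, fun y hy => h y (Or.inr hy)⟩
              rintro rfl
              exact h v (Or.inl rfl) huv
          · rintro (rfl | ⟨hxb, hx, h⟩)
            · exact ⟨Or.inl rfl, fun y hy => hvout y (Finset.mem_insert.2 hy)⟩
            · refine ⟨Or.inr hx, ?_⟩
              rintro y (rfl | hy)
              · exact fun h' => hxb (hinj _ _ _ h' huv)
              · exact h y hy
        have hbmem : b ∈ T.filter fun x => ∀ y ∈ T, ¬ F x y := by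
          simp only [Finset.mem_filter]
          exact ⟨huT, hb⟩
        rw [hset, Finset.card_insert_of_notMem, Finset.card_erase_add_one hbmem, ← hJlen]
        · simp
        · simp [hv]
    · push Not at hpred
      refine ⟨[v] :: J, ?_, ?_, ?_, ?_⟩
      · intro l hl
        rcases List.mem_cons.1 hl with rfl | hlJ
        · refine ⟨v, v, IsWalk.singleton v, ?_, hvout⟩
          intro y hy h
          rcases Finset.mem_insert.1 hy with rfl | hy
          · exact hvout _ (Finset.mem_insert_self _ _) h
          · exact hpred y hy h
        · obtain ⟨a, b, hw, ha, hb⟩ := hJw l hlJ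
          refine ⟨a, b, hw, ?_, ?_⟩
          · intro y hy h
            rcases Finset.mem_insert.1 hy with rfl | hy
            · exact hvout a (Finset.mem_insert_of_mem
                ((hJT a).1 (List.mem_flatten.2 ⟨l, hlJ, hw.head_mem⟩))) h
            · exact ha y hy h
          · intro y hy h
            rcases Finset.mem_insert.1 hy with rfl | hy
            · exact hpred b ((hJT b).1 (List.mem_flatten.2 ⟨l, hlJ, hw.last_mem⟩)) h
            · exact hb y hy h
      · rw [List.flatten_cons, List.singleton_append, List.nodup_cons]
        exact ⟨fun h => hv ((hJT v).1 h), hJnd⟩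
      · intro x
        rw [List.flatten_cons, List.singleton_append, List.mem_cons, hJT, Finset.mem_insert]
      · have hset : ((insert v T).filter fun x => ∀ y ∈ insert v T, ¬ F x y) =
            insert v (T.filter fun x => ∀ y ∈ T, ¬ F x y) := by
          ext x
          simp only [Finset.mem_filter, Finset.mem_insert]
          constructor
          · rintro ⟨rfl | hx, h⟩
            · exact Or.inl rfl
            · exact Or.inr ⟨hx, fun y hy => h y (Or.inr hy)⟩
          · rintro (rfl | ⟨hx, h⟩)
            · exact ⟨Or.inl rfl, fun y hy => hvout y (Finset.mem_insert.2 hy)⟩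
            · refine ⟨Or.inr hx, ?_⟩
              rintro y (rfl | hy)
              · exact hpred x hx
              · exact h y hy
        rw [hset, Finset.card_insert_of_notMem (by simp [hv]), ← hJlen]
        simp

/-- A walk assembled from pieces, some of which can absorb further walks; the list records, for
every absorbing piece, the pairs of endpoints of the walks it can absorb. -/
inductive IsFlexWalk {X : Type*} (E : X → X → Prop) :
    X → X → List X → List (X → X → Prop) → Prop
  | base {a b : X} {P : List X} (h : IsWalk E a b P) : IsFlexWalk E a b P []
  | absorber {a b : X} {B : List X} {r : X → X → Prop} (h : IsWalk E a b B)
      (habs : ∀ p q I, r p q → IsWalk E p q I → ∃ B', B'.Perm (B ++ I) ∧ IsWalk E a b B') :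
      IsFlexWalk E a b B [r]
  | append {a b c d : X} {P Q : List X} {R S : List (X → X → Prop)} (h : IsFlexWalk E a b P R)
      (h' : IsFlexWalk E c d Q S) (hbc : E b c) : IsFlexWalk E a d (P ++ Q) (R ++ S)

section IsFlexWalk
variable {X : Type*} {E : X → X → Prop} {a b : X} {P : List X} {R : List (X → X → Prop)}

/-- The number of pieces able to absorb a walk from `p` to `q`. -/
noncomputable def absorbCount (R : List (X → X → Prop)) (p q : X) : ℕ :=
  R.countP fun r => r p q

theorem IsFlexWalk.isWalk (h : IsFlexWalk E a b P R) : IsWalk E a b P := by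
  induction h with
  | base h => exact h
  | absorber h _ => exact h
  | append _ _ hbc ih ih' => exact ih.append ih' hbc

theorem IsFlexWalk.absorb (h : IsFlexWalk E a b P R) {p q : X} {I : List X}
    (hR : 0 < absorbCount R p q) (hI : IsWalk E p q I) :
    ∃ P' R', P'.Perm (P ++ I) ∧ IsFlexWalk E a b P' R' ∧
      ∀ p' q', absorbCount R p' q' ≤ absorbCount R' p' q' + 1 := by
  induction h with
  | base h => simp [absorbCount] at hR
  | @absorber a b B r h habs =>
    have hr : r p q := by
      by_contra hr
      simp [absorbCount, hr] at hR
    obtain ⟨B', hp, hw⟩ := habs p q I hr hI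
    refine ⟨B', [], hp, .base hw, fun p' q' => ?_⟩
    exact List.countP_le_length.trans (by simp)
  | @append a b c d P Q R S h h' hbc ih ih' =>
    have hadd : ∀ R S : List (X → X → Prop), ∀ p q,
        absorbCount (R ++ S) p q = absorbCount R p q + absorbCount S p q :=
      fun R S p q => List.countP_append
    rw [hadd] at hR
    rcases Nat.eq_zero_or_pos (absorbCount R p q) with h0 | h0
    · obtain ⟨Q', S', hp, hw, hc⟩ := ih' (by omega)
      refine ⟨P ++ Q', R ++ S', ?_, .append h hw hbc, fun p' q' => ?_⟩
      · rw [List.append_assoc]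
        exact List.Perm.append_left _ hp
      · rw [hadd, hadd]
        have := hc p' q'
        omega
    · obtain ⟨P', R', hp, hw, hc⟩ := ih h0
      refine ⟨P' ++ Q, R' ++ S, ?_, .append hw h' hbc, fun p' q' => ?_⟩
      · refine (hp.append_right Q).trans ?_
        rw [List.append_assoc, List.append_assoc]
        exact List.Perm.append_left _ List.perm_append_comm
      · rw [hadd, hadd]
        have := hc p' q'
        omega

theorem IsFlexWalk.absorb_all (J : List (List X)) : ∀ (P : List X) (R : List (X → X → Prop)),
    IsFlexWalk E a b P R → (∀ I ∈ J, ∃ p q, IsWalk E p q I) →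
    (∀ p q, J.length ≤ absorbCount R p q) →
    ∃ P', P'.Perm (P ++ J.flatten) ∧ IsWalk E a b P' := by
  induction J with
  | nil =>
    intro P R h _ _
    exact ⟨P, by simp, h.isWalk⟩
  | cons I J ih =>
    intro P R h hJ hc
    obtain ⟨p, q, hI⟩ := hJ I (by simp)
    obtain ⟨P', R', hp, hw, hc'⟩ := h.absorb (p := p) (q := q) (by
      have := hc p q
      simp at this
      omega) hI
    obtain ⟨P'', hp', hw'⟩ := ih P' R' hw (fun I' hI' => hJ I' (by simp [hI'])) (fun p' q' => by
      have h1 := hc p' q'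
      have h2 := hc' p' q'
      simp at h1
      omega)
    refine ⟨P'', hp'.trans ?_, hw'⟩
    rw [List.flatten_cons, ← List.append_assoc]
    exact hp.append_right _

end IsFlexWalk

section heavy
variable {X : Type*} [Fintype X] {E : X → X → Prop} {ν τ δ : ℝ}

theorem exists_heavy_pair
    (hout : ∀ v, δ * Fintype.card X ≤ ((Finset.univ.filter fun u => E v u).card : ℝ))
    (hin : ∀ v, δ * Fintype.card X ≤ ((Finset.univ.filter fun u => E u v).card : ℝ))
    (Z : Finset X) (hZ : (Z.card : ℝ) + 1 < δ / 2 * Fintype.card X) (wt : X × X → ℝ)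
    (hwt : ∀ x, 0 ≤ wt x) (hpos : 0 < ∑ x, wt x) :
    ∃ w ∉ Z, ∃ u ∉ Z, u ≠ w ∧
      δ ^ 2 / 4 * ∑ x, wt x ≤ ∑ x, if E w x.1 ∧ E x.2 u then wt x else 0 := by
  set m : ℝ := (Fintype.card X : ℝ) with hm
  by_contra hcon
  push Not at hcon
  set A : Finset (X × X) := Finset.univ.filter fun y => y.1 ∉ Z ∧ y.2 ∉ Z ∧ y.2 ≠ y.1 with hA
  have hZ0 : (0 : ℝ) ≤ Z.card := Nat.cast_nonneg _
  have h1 : ∑ y ∈ A, (∑ x : X × X, if E y.1 x.1 ∧ E x.2 y.2 then wt x else 0) ≤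
      m ^ 2 * (δ ^ 2 / 4 * ∑ x, wt x) := by
    have hAc : (A.card : ℝ) ≤ m ^ 2 := by
      have : A.card ≤ Fintype.card (X × X) := Finset.card_le_univ _
      rw [Fintype.card_prod] at this
      have h2 : (A.card : ℝ) ≤ ((Fintype.card X * Fintype.card X : ℕ) : ℝ) := Nat.cast_le.2 this
      rw [Nat.cast_mul] at h2
      rw [sq]
      exact h2
    refine (Finset.sum_le_card_nsmul A _ (δ ^ 2 / 4 * ∑ x, wt x) ?_).trans ?_
    · intro y hy
      rw [hA, Finset.mem_filter] at hy
      exact (hcon y.1 hy.2.1 y.2 hy.2.2.1 hy.2.2.2).le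
    · rw [nsmul_eq_mul]
      exact mul_le_mul_of_nonneg_right hAc (by positivity)
  have h2 : ∀ x : X × X, (δ / 2 * m + 1) * (δ / 2 * m) * wt x ≤
      ∑ y ∈ A, if E y.1 x.1 ∧ E x.2 y.2 then wt x else 0 := by
    intro x
    rw [← Finset.sum_filter, Finset.sum_const, nsmul_eq_mul]
    refine mul_le_mul_of_nonneg_right ?_ (hwt x)
    set W := (Finset.univ.filter fun w => E w x.1) \ Z with hW
    set U := (Finset.univ.filter fun u => E x.2 u) \ Z with hU
    have hWc : δ / 2 * m + 1 ≤ W.card := by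
      have h3 : (Finset.univ.filter fun w => E w x.1).card ≤ W.card + Z.card :=
        Finset.card_le_card_sdiff_add_card
      have h4 : ((Finset.univ.filter fun w => E w x.1).card : ℝ) ≤ W.card + Z.card := by
        rw [← Nat.cast_add]
        exact Nat.cast_le.2 h3
      linarith [hin x.1]
    have hUc : δ / 2 * m + 1 ≤ U.card := by
      have h3 : (Finset.univ.filter fun u => E x.2 u).card ≤ U.card + Z.card :=
        Finset.card_le_card_sdiff_add_card
      have h4 : ((Finset.univ.filter fun u => E x.2 u).card : ℝ) ≤ U.card + Z.card := by
        rw [← Nat.cast_add]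
        exact Nat.cast_le.2 h3
      linarith [hout x.2]
    have h5 : (W ×ˢ U).card ≤
        (A.filter fun y => E y.1 x.1 ∧ E x.2 y.2).card + W.card := by
      rw [← Finset.card_filter_add_card_filter_not (s := W ×ˢ U) (fun y => y.2 ≠ y.1)]
      refine add_le_add (Finset.card_le_card ?_) ?_
      · intro y hy
        simp only [hW, hU, hA, Finset.mem_filter, Finset.mem_product, Finset.mem_sdiff,
          Finset.mem_univ, true_and] at hy ⊢
        tauto
      · refine Finset.card_le_card_of_injOn Prod.fst ?_ ?_
        · intro y hy
          simp only [Finset.coe_filter, Set.mem_ofPred_eq, Finset.mem_product] at hy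
          exact hy.1.1
        · intro y hy y' hy' hyy
          simp only [Finset.coe_filter, Set.mem_ofPred_eq, not_not] at hy hy'
          exact Prod.ext hyy (by rw [hy.2, hy'.2, hyy])
    rw [Finset.card_product] at h5
    have h6 : (W.card : ℝ) * U.card ≤
        ((A.filter fun y => E y.1 x.1 ∧ E x.2 y.2).card : ℝ) + W.card := by
      rw [← Nat.cast_mul, ← Nat.cast_add]
      exact Nat.cast_le.2 h5
    have h7 : 0 ≤ δ / 2 * m := by linarith
    nlinarith
  have h3 := Finset.sum_le_sum fun (x : X × X) (_ : x ∈ Finset.univ) => h2 x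
  rw [Finset.sum_comm, ← Finset.mul_sum] at h3
  have h4 : 0 < δ / 2 * m := by linarith
  nlinarith [mul_pos h4 hpos]

theorem IsExpander.exists_flexWalk (h : IsExpander E ν τ δ) (hν : 0 < ν) (hτ0 : 0 ≤ τ)
    (hτ : 2 * τ ≤ 1) (hντ : ν + τ ≤ δ) (hδ : δ ≤ 1) (x₀ : X) (c : ℕ) (hc : c = ⌈1 / ν⌉₊ + 2)
    (j : ℕ)
    (hj : ((1 + j * (c * (2 * c + 20)) : ℕ) : ℝ) < ν / 2 * Fintype.card X) :
    ∃ a b P R, IsFlexWalk E a b P R ∧ P.Nodup ∧ P.length ≤ 1 + j * (c * (2 * c + 20)) ∧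
      ∑ x : X × X, (1 / 2 : ℝ) ^ absorbCount R x.1 x.2 ≤
        (Fintype.card X : ℝ) ^ 2 * (1 - δ ^ 2 / 8) ^ j := by
  induction j with
  | zero =>
    refine ⟨x₀, x₀, [x₀], [], .base (IsWalk.singleton x₀), by simp, by simp, ?_⟩
    simp [absorbCount, sq]
  | succ j ih =>
    have hc2 : 2 ≤ c := by omega
    obtain ⟨a, b, P, R, hflex, hnd, hlen, hpot⟩ := ih (lt_of_le_of_lt (by
      refine Nat.cast_le.2 ?_
      gcongr
      omega) hj)
    set m : ℝ := (Fintype.card X : ℝ) with hm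
    have hνδ : ν ≤ δ := by linarith
    have hm0 : 0 ≤ m := Nat.cast_nonneg _
    have hZc : P.toFinset.card ≤ 1 + j * (c * (2 * c + 20)) := (List.toFinset_card_le P).trans hlen
    have hZR : (P.toFinset.card : ℝ) + (c * (2 * c + 20) : ℕ) < ν / 2 * m := by
      refine lt_of_le_of_lt ?_ hj
      rw [← Nat.cast_add]
      refine Nat.cast_le.2 ?_
      rw [add_mul]
      omega
    have hνm : ν / 2 * m ≤ δ / 2 * m := by gcongr
    have hcL : c * (2 * c + 20) = 2 * c * c + 20 * c := by ring
    have hc1 : (1 : ℝ) ≤ (c * (2 * c + 20) : ℕ) := by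
      rw [← Nat.cast_one]
      refine Nat.cast_le.2 ?_
      nlinarith
    have hX : Nonempty X := ⟨x₀⟩
    obtain ⟨w, hw, u, hu, huw, hheavy⟩ := exists_heavy_pair h.out_deg h.in_deg P.toFinset
      (by linarith) (fun x => (1 / 2 : ℝ) ^ absorbCount R x.1 x.2) (fun x => by positivity)
      (Finset.sum_pos (fun x _ => by positivity) Finset.univ_nonempty)
    obtain ⟨B, ⟨a', b', hB, habs⟩, hBnd, hBZ, hBlen⟩ := h.exists_absorber hν hτ0 hτ hντ u w
      P.toFinset hu hw huw (by
        rw [← hc]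
        have h1 : ((c * (2 * c + 10) : ℕ) : ℝ) ≤ (c * (2 * c + 20) : ℕ) :=
          Nat.cast_le.2 (by gcongr; omega)
        have : 0 ≤ ν / 2 * m := by positivity
        linarith)
    rw [← hc] at hBlen
    set Z' := P.toFinset ∪ B.toFinset with hZ'
    have hZ'c : Z'.card ≤ P.toFinset.card + c * (2 * c + 2) :=
      (Finset.card_union_le _ _).trans
        (add_le_add le_rfl ((List.toFinset_card_le B).trans hBlen))
    have hZ'R : (Z'.card : ℝ) + (c : ℕ) < ν / 2 * m := by
      refine lt_of_le_of_lt ?_ hZR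
      rw [← Nat.cast_add, ← Nat.cast_add]
      refine Nat.cast_le.2 ?_
      nlinarith
    obtain ⟨y, hy, hyZ⟩ : ∃ y ∈ Finset.univ.filter fun y => E y a', y ∉ Z' := by
      refine Finset.exists_mem_notMem_of_card_lt_card ?_
      have h1 := h.in_deg a'
      have h2 : (Z'.card : ℝ) < ((Finset.univ.filter fun y => E y a').card : ℝ) := by
        have : 0 ≤ (c : ℝ) := Nat.cast_nonneg _
        have : 0 ≤ ν / 2 * m := by positivity
        linarith
      exact Nat.cast_lt.1 h2
    rw [Finset.mem_filter] at hy
    obtain ⟨a₁, C, hba, hC, hCnd, hCZ, hClen⟩ := h.exists_walk hν hτ0 hτ hντ b y Z' hyZ (by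
      have h1 : ((⌈1 / ν⌉₊ + 1 : ℕ) : ℝ) ≤ (c : ℕ) := Nat.cast_le.2 (by omega)
      have : 0 ≤ ν / 2 * m := by positivity
      linarith)
    refine ⟨a, b', (P ++ C) ++ B, (R ++ []) ++ [fun p q => E w p ∧ E q u],
      .append (.append hflex (.base hC) hba)
        (.absorber hB fun p q I hpq hI => habs p q I hI hpq.1 hpq.2) hy.2, ?_, ?_, ?_⟩
    · rw [List.nodup_append, List.nodup_append]
      refine ⟨⟨hnd, hCnd, ?_⟩, hBnd, ?_⟩
      · rintro z hz _ hz' rfl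
        exact hCZ z hz' (by simp [hZ', hz])
      · rintro z hz _ hz' rfl
        rcases List.mem_append.1 hz with hz | hz
        · exact hBZ z hz' (by simp [hz])
        · exact hCZ z hz (by simp [hZ', hz'])
    · simp only [List.length_append]
      rw [add_mul]
      nlinarith
    · have hsum : ∑ x : X × X, (1 / 2 : ℝ) ^
          absorbCount ((R ++ []) ++ [fun p q => E w p ∧ E q u]) x.1 x.2 =
          ∑ x : X × X, (1 / 2 : ℝ) ^ absorbCount R x.1 x.2 - 1 / 2 *
          ∑ x : X × X, if E w x.1 ∧ E x.2 u then (1 / 2 : ℝ) ^ absorbCount R x.1 x.2 else 0 := by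
        rw [Finset.mul_sum, ← Finset.sum_sub_distrib]
        refine Finset.sum_congr rfl fun x _ => ?_
        simp only [absorbCount, List.append_nil, List.countP_append, List.countP_singleton]
        split_ifs with h1 h2 h2
        · rw [pow_succ]; ring
        · simp_all
        · simp_all
        · simp
      rw [hsum, pow_succ (1 - δ ^ 2 / 8)]
      have hδ2 : 0 ≤ 1 - δ ^ 2 / 8 := by nlinarith
      have := mul_le_mul_of_nonneg_right hpot hδ2
      linarith

end heavy

/-- A robust form of Hall's condition yields spanning regular subgraphs. -/
theorem exists_regular_subrelation {Y : Type*} [Fintype Y] (E : Y → Y → Prop) (r : ℕ)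
    (h : ∀ S : Finset Y, S.card ≤ (robustNbhd E r S).card ∨
      ∃ x ∈ S, S.card + r ≤ (Finset.univ.filter fun y => E x y).card) :
    ∃ J : Y → Y → Prop, (∀ x y, J x y → E x y) ∧
      (∀ x, (Finset.univ.filter fun y => J x y).card = r) ∧
      ∀ y, (Finset.univ.filter fun x => J x y).card = r := by
  suffices H : ∀ i ≤ r, ∃ J : Y → Y → Prop, (∀ x y, J x y → E x y) ∧
      (∀ x, (Finset.univ.filter fun y => J x y).card = i) ∧
      ∀ y, (Finset.univ.filter fun x => J x y).card = i from H r le_rfl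
  intro i
  induction i with
  | zero => exact fun _ => ⟨fun _ _ => False, by simp⟩
  | succ i ih =>
    intro hi
    obtain ⟨J, hJE, hout, hin⟩ := ih (by omega)
    have hall : ∀ S : Finset Y, S.card ≤
        (S.biUnion fun x => Finset.univ.filter fun y => E x y ∧ ¬ J x y).card := by
      intro S
      rcases h S with hS | ⟨x, hx, hS⟩
      · refine hS.trans (Finset.card_le_card fun y hy => ?_)
        rw [mem_robustNbhd, Nat.cast_le] at hy
        have h1 : (Finset.univ.filter fun x => J x y).card < (S.filter fun x => E x y).card := by
          rw [hin]; omega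
        obtain ⟨x, hx, hxJ⟩ := Finset.exists_mem_notMem_of_card_lt_card h1
        simp only [Finset.mem_filter, Finset.mem_univ, true_and] at hx hxJ
        simp only [Finset.mem_biUnion, Finset.mem_filter, Finset.mem_univ, true_and]
        exact ⟨x, hx.1, hx.2, hxJ⟩
      · have h1 : (Finset.univ.filter fun y => E x y).card ≤
            ((Finset.univ.filter fun y => E x y) \ (Finset.univ.filter fun y => J x y)).card +
            (Finset.univ.filter fun y => J x y).card := Finset.card_le_card_sdiff_add_card
        rw [hout] at h1
        have h2 : ((Finset.univ.filter fun y => E x y) \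
            (Finset.univ.filter fun y => J x y)).card ≤
            (S.biUnion fun x => Finset.univ.filter fun y => E x y ∧ ¬ J x y).card := by
          refine Finset.card_le_card fun y hy => ?_
          simp only [Finset.mem_sdiff, Finset.mem_filter, Finset.mem_univ, true_and] at hy
          simp only [Finset.mem_biUnion, Finset.mem_filter, Finset.mem_univ, true_and]
          exact ⟨x, hx, hy⟩
        omega
    obtain ⟨f, hf, hfE⟩ := (Finset.all_card_le_biUnion_card_iff_exists_injective _).1 hall
    simp only [Finset.mem_filter, Finset.mem_univ, true_and] at hfE
    have hbij := Finite.injective_iff_bijective.1 hf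
    refine ⟨fun x y => J x y ∨ y = f x, ?_, fun x => ?_, fun y => ?_⟩
    · rintro x y (hxy | rfl)
      · exact hJE x y hxy
      · exact (hfE x).1
    · refine (congrArg Finset.card (?_ : _ = insert (f x) (Finset.univ.filter fun y => J x y))).trans ?_
      · ext y; simp [or_comm]
      rw [Finset.card_insert_of_notMem, hout]
      simpa using (hfE x).2
    · obtain ⟨x, rfl⟩ := hbij.2 y
      refine (congrArg Finset.card
        (?_ : _ = insert x (Finset.univ.filter fun z => J z (f x)))).trans ?_
      · ext z; simp [hf.eq_iff, or_comm, eq_comm]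
      rw [Finset.card_insert_of_notMem, hin]
      simpa using (hfE x).2

/-- Dense regular digraphs can be covered by few disjoint paths. -/
theorem exists_path_cover {ξ c : ℝ} (hξ : 0 < ξ) (hc : 0 < c) :
    ∃ N₀ : ℕ, ∀ (Y : Type) [Fintype Y], N₀ ≤ Fintype.card Y → ∀ (J : Y → Y → Prop) (r : ℕ),
      ξ * Fintype.card Y ≤ r →
      (∀ x, (Finset.univ.filter fun y => J x y).card = r) →
      (∀ y, (Finset.univ.filter fun x => J x y).card = r) →
      ∃ L : List (List Y), (∀ l ∈ L, ∃ a b, IsWalk J a b l) ∧ L.flatten.Nodup ∧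
        (∀ x, x ∈ L.flatten) ∧ (L.length : ℝ) ≤ c * Fintype.card Y := by
  obtain ⟨p, hp⟩ := exists_nat_gt (4 / c)
  have hpR : (0 : ℝ) < p := lt_trans (by positivity) hp
  have hp0 : 0 < p := Nat.cast_pos.1 hpR
  set ε : ℝ := min 1 (min (c / 8) (c * ξ / (8 * p))) with hε
  have hε0 : 0 < ε := by positivity
  have hε1 : ε ≤ 1 := min_le_left _ _
  have hε2 : ε ≤ c / 8 := (min_le_right _ _).trans (min_le_left _ _)
  have hε3 : ε ≤ c * ξ / (8 * p) := (min_le_right _ _).trans (min_le_right _ _)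
  obtain ⟨N₁, hN₁⟩ := exists_balanced_coloring p hp0 ε hε0 hε1
  obtain ⟨N₂, hN₂⟩ := exists_nat_gt (1 / ε)
  refine ⟨max N₁ (max N₂ 1), fun Y _ hY J r hr hout hin => ?_⟩
  set N : ℝ := (Fintype.card Y : ℝ) with hN
  have hY1 : N₁ ≤ Fintype.card Y := (le_max_left _ _).trans hY
  have hY2 : N₂ ≤ Fintype.card Y := (le_max_left _ _).trans ((le_max_right _ _).trans hY)
  have hY3 : 1 ≤ Fintype.card Y := (le_max_right _ _).trans ((le_max_right _ _).trans hY)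
  have hN0 : 0 < N := Nat.cast_pos.2 hY3
  have hεN : 1 < ε * N := by
    have : 1 / ε < N := hN₂.trans_le (Nat.cast_le.2 hY2)
    rwa [div_lt_iff₀' hε0] at this
  obtain ⟨b, hb⟩ := hN₁ _ hY1 Y (Fin p) (Y ⊕ Y ⊕ Unit) rfl (by simp) (by
    simp only [Fintype.card_sum, Fintype.card_unit]; omega)
    (Sum.elim (fun x => Finset.univ.filter fun y => J x y)
      (Sum.elim (fun y => Finset.univ.filter fun x => J x y) fun _ => Finset.univ))
  have hbout : ∀ x k, |(((Finset.univ.filter fun y => J x y).filter fun v => b v = k).card : ℝ) -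
      r / p| ≤ ε * N := by
    intro x k
    have := hb (Sum.inl x) k
    simp only [Sum.elim_inl, hout] at this
    convert this
  have hbin : ∀ y k, |(((Finset.univ.filter fun x => J x y).filter fun v => b v = k).card : ℝ) -
      r / p| ≤ ε * N := by
    intro x k
    have := hb (Sum.inr (Sum.inl x)) k
    simp only [Sum.elim_inl, Sum.elim_inr, hin] at this
    convert this
  have hbuniv : ∀ k, |((Finset.univ.filter fun v => b v = k).card : ℝ) - N / p| ≤ ε * N := by
    intro k
    have := hb (Sum.inr (Sum.inr ())) k
    simp only [Sum.elim_inr, Finset.card_univ] at this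
    convert this
  obtain ⟨H, hH⟩ : ∃ H : Y → Y → Prop, ∀ x y, H x y ↔ J x y ∧ (b y : ℕ) = b x + 1 :=
    ⟨_, fun _ _ => Iff.rfl⟩
  set D : ℕ := ⌊(r : ℝ) / p + ε * N⌋₊ with hD
  have hrp : 0 ≤ (r : ℝ) / p := by positivity
  have hDle : (D : ℝ) ≤ r / p + ε * N := Nat.floor_le (by positivity)
  have hDge : (r : ℝ) / p < D := by
    have := Nat.lt_floor_add_one ((r : ℝ) / p + ε * N)
    rw [← hD] at this
    linarith
  have hHout : ∀ x, (Finset.univ.filter fun y => H x y).card ≤ D := by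
    intro x
    by_cases hx : (b x : ℕ) + 1 < p
    · have h1 : (Finset.univ.filter fun y => H x y) =
          (Finset.univ.filter fun y => J x y).filter fun v => b v = ⟨b x + 1, hx⟩ := by
        ext y; simp [hH, Fin.ext_iff]
      rw [h1]
      refine Nat.le_floor ?_
      have := (abs_le.1 (hbout x ⟨b x + 1, hx⟩)).2
      linarith
    · have h1 : (Finset.univ.filter fun y => H x y) = ∅ := by
        refine Finset.filter_eq_empty_iff.2 fun y _ hy => ?_
        have := (b y).2
        have := ((hH _ _).1 hy).2
        omega
      simp [h1]
  have hHin : ∀ y, (Finset.univ.filter fun x => H x y).card ≤ D := by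
    intro y
    by_cases hy : (b y : ℕ) = 0
    · have h1 : (Finset.univ.filter fun x => H x y) = ∅ := by
        refine Finset.filter_eq_empty_iff.2 fun x _ hx => ?_
        have := ((hH _ _).1 hx).2
        omega
      simp [h1]
    · have hlt : (b y : ℕ) - 1 < p := by have := (b y).2; omega
      have h1 : (Finset.univ.filter fun x => H x y) =
          (Finset.univ.filter fun x => J x y).filter fun v => b v = ⟨b y - 1, hlt⟩ := by
        ext x
        simp only [hH, Fin.ext_iff, Finset.mem_filter, Finset.mem_univ, true_and]
        refine and_congr_right fun _ => ?_
        omega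
      rw [h1]
      refine Nat.le_floor ?_
      have := (abs_le.1 (hbin y ⟨b y - 1, hlt⟩)).2
      linarith
  obtain ⟨F, hFH, -, hFfun, hFinj, hFout, -⟩ := exists_matching_decomposition H D hHout hHin
  have hmiss : ∀ x, (b x : ℕ) + 1 < p →
      ((Finset.univ.filter fun l => ∀ y, ¬ F l x y).card : ℝ) ≤ 2 * (ε * N) := by
    intro x hx
    have h1 : (Finset.univ.filter fun y => H x y) =
        (Finset.univ.filter fun y => J x y).filter fun v => b v = ⟨b x + 1, hx⟩ := by
      ext y; simp [hH, Fin.ext_iff]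
    have h2 := hFout x
    rw [h1] at h2
    have h3 := (abs_le.1 (hbout x ⟨b x + 1, hx⟩)).1
    have h4 : ((Finset.univ.filter fun l => ∀ y, ¬ F l x y).card : ℝ) +
      (((Finset.univ.filter fun y => J x y).filter fun v => b v = ⟨b x + 1, hx⟩).card : ℝ) = D := by
      rw [← Nat.cast_add, h2]
    linarith
  have hsum : ∑ l, ((Finset.univ.filter fun x => ∀ y, ¬ F l x y).card : ℝ) ≤
      N * (2 * (ε * N)) + (N / p + ε * N) * D := by
    have h1 : ∑ l, ((Finset.univ.filter fun x => ∀ y, ¬ F l x y).card : ℝ) =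
        ∑ x, ((Finset.univ.filter fun l => ∀ y, ¬ F l x y).card : ℝ) := by
      simp only [Finset.card_filter, Nat.cast_sum]
      exact Finset.sum_comm
    rw [h1]
    have h2 : ∀ x ∈ (Finset.univ : Finset Y),
        ((Finset.univ.filter fun l => ∀ y, ¬ F l x y).card : ℝ) ≤
        2 * (ε * N) + if b x = ⟨p - 1, by omega⟩ then (D : ℝ) else 0 := by
      intro x _
      split_ifs with hx
      · have h3 : (Finset.univ.filter fun l => ∀ y, ¬ F l x y).card ≤ D := by
          have := hFout x
          omega
        have h4 : ((Finset.univ.filter fun l => ∀ y, ¬ F l x y).card : ℝ) ≤ D := Nat.cast_le.2 h3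
        linarith
      · rw [add_zero]
        refine hmiss x ?_
        rw [Fin.ext_iff] at hx
        have := (b x).2
        simp only at hx
        omega
    refine (Finset.sum_le_sum h2).trans ?_
    rw [Finset.sum_add_distrib, Finset.sum_const, nsmul_eq_mul, ← Finset.sum_filter,
      Finset.sum_const, nsmul_eq_mul, Finset.card_univ]
    refine add_le_add le_rfl (mul_le_mul_of_nonneg_right ?_ (Nat.cast_nonneg _))
    have := (abs_le.1 (hbuniv ⟨p - 1, by omega⟩)).2
    linarith
  have hD0 : 0 < (D : ℝ) := hrp.trans_lt hDge
  obtain ⟨l, hl⟩ : ∃ l, ((Finset.univ.filter fun x => ∀ y, ¬ F l x y).card : ℝ) ≤ c * N := by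
    by_contra hcon
    push Not at hcon
    have h1 : ∑ _l : Fin D, c * N ≤ ∑ l, ((Finset.univ.filter fun x => ∀ y, ¬ F l x y).card : ℝ) :=
      Finset.sum_le_sum fun l _ => (hcon l).le
    rw [Finset.sum_const, nsmul_eq_mul, Finset.card_univ, Fintype.card_fin] at h1
    have h2 : ξ * N < D * p := by
      rw [div_lt_iff₀ hpR] at hDge
      linarith
    have h3 : ε * (8 * p) ≤ c * ξ := (le_div_iff₀ (by positivity)).1 hε3
    have h4 : ε * N * 8 ≤ c * D := by
      have h5 : ε * (8 * p) * N ≤ c * ξ * N := mul_le_mul_of_nonneg_right h3 hN0.le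
      have h6 : c * (ξ * N) ≤ c * (D * p) := mul_le_mul_of_nonneg_left h2.le hc.le
      have h7 : ε * N * 8 * p ≤ c * D * p := by linarith
      exact le_of_mul_le_mul_right h7 hpR
    have h5 : 1 / (p : ℝ) ≤ c / 4 := by
      rw [div_lt_iff₀ hc] at hp
      rw [div_le_div_iff₀ hpR (by norm_num)]
      linarith
    have h6 : N / p + ε * N ≤ 3 / 8 * c * N := by
      have : N / p = 1 / p * N := by ring
      rw [this]
      have h7 := mul_le_mul_of_nonneg_right h5 hN0.le
      have h8 := mul_le_mul_of_nonneg_right hε2 hN0.le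
      linarith
    have h7 : (N / p + ε * N) * D ≤ 3 / 8 * c * N * D := mul_le_mul_of_nonneg_right h6 hD0.le
    have h8 : N * (ε * N * 8) ≤ N * (c * D) := mul_le_mul_of_nonneg_left h4 hN0.le
    have h9 : 0 < c * N * D := by positivity
    linarith
  obtain ⟨L, hLw, hLnd, hLm, hLl⟩ := exists_walk_partition (F l) (fun x => (b x : ℕ))
    (fun x y hxy => by have := ((hH _ _).1 (hFH l x y hxy)).2; omega) (hFfun l) (hFinj l) Finset.univ
  refine ⟨L, ?_, hLnd, fun x => (hLm x).2 (Finset.mem_univ x), ?_⟩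
  · intro I hI
    obtain ⟨a, a', hw, -⟩ := hLw I hI
    exact ⟨a, a', hw.1.imp fun x y hxy => ((hH _ _).1 (hFH l x y hxy)).1, hw.2⟩
  · rw [hLl]
    simpa using hl

theorem IsWalk.map {X Y : Type*} {E : X → X → Prop} {F : Y → Y → Prop} {a b : Y} {l : List Y} (h : IsWalk F a b l)
    (f : Y → X) (hf : ∀ x y, F x y → E (f x) (f y)) : IsWalk E (f a) (f b) (l.map f) := by
  refine ⟨?_, ?_, ?_⟩
  · rw [List.isChain_map]
    exact h.1.imp hf
  · simp [h.2.1]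
  · simp [h.2.2]

section hamilton
variable {X : Type*} [Fintype X] {E : X → X → Prop} {ν τ δ : ℝ}

theorem IsExpander.exists_regular_compl (h : IsExpander E ν τ δ) (hντ : ν + τ ≤ δ)
    (Z : Finset X) (r : ℕ) (hr : (r : ℝ) + Z.card ≤ ν * Fintype.card X) :
    ∃ J : {x // x ∉ Z} → {x // x ∉ Z} → Prop, (∀ x y, J x y → E x y) ∧
      (∀ x, (Finset.univ.filter fun y => J x y).card = r) ∧
      ∀ y, (Finset.univ.filter fun x => J x y).card = r := by
  refine exists_regular_subrelation (fun x y : {x // x ∉ Z} => E x y) r fun S => ?_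
  set m : ℝ := (Fintype.card X : ℝ) with hm
  set S' : Finset X := S.map (Function.Embedding.subtype _) with hS'
  have hSc : (S'.card : ℝ) = S.card := by rw [hS', Finset.card_map]
  have hr0 : (0 : ℝ) ≤ r := Nat.cast_nonneg _
  have hZ0 : (0 : ℝ) ≤ Z.card := Nat.cast_nonneg _
  have hm0 : 0 ≤ m := Nat.cast_nonneg _
  have hδm : ν * m + τ * m ≤ δ * m := by rw [← add_mul]; gcongr
  have hT : ∀ T : Finset X, (∀ y ∈ T, (r : ℝ) ≤ ((S'.filter fun x => E x y).card : ℝ)) →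
      (T.card : ℝ) ≤
        ((robustNbhd (fun x y : {x // x ∉ Z} => E x y) r S).card : ℝ) + Z.card := by
    intro T hT
    rw [← Nat.cast_add]
    refine Nat.cast_le.2 (Finset.card_le_card_sdiff_add_card.trans (add_le_add ?_ le_rfl))
    rw [← Finset.card_map (Function.Embedding.subtype _)]
    refine Finset.card_le_card fun y hy => ?_
    rw [Finset.mem_sdiff] at hy
    refine Finset.mem_map.2 ⟨⟨y, hy.2⟩, ?_, rfl⟩
    rw [mem_robustNbhd]
    refine (hT y hy.1).trans (Nat.cast_le.2 (le_of_eq ?_))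
    rw [hS', Finset.filter_map, Finset.card_map]
    rfl
  by_cases h1 : (S.card : ℝ) < τ * m
  · rcases S.eq_empty_or_nonempty with rfl | ⟨x, hx⟩
    · exact Or.inl (by simp)
    · refine Or.inr ⟨x, hx, ?_⟩
      have h2 := h.out_deg x
      have h3 : (Finset.univ.filter fun y => E x y).card ≤
          (Finset.univ.filter fun y : {x // x ∉ Z} => E x y).card + Z.card := by
        refine Finset.card_le_card_sdiff_add_card.trans (add_le_add ?_ le_rfl)
        rw [← Finset.card_map (Function.Embedding.subtype _)]
        refine Finset.card_le_card fun y hy => ?_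
        rw [Finset.mem_sdiff, Finset.mem_filter] at hy
        exact Finset.mem_map.2 ⟨⟨y, hy.2⟩, by simpa using hy.1.2, rfl⟩
      have h4 : ((Finset.univ.filter fun y => E x y).card : ℝ) ≤
          ((Finset.univ.filter fun y : {x // x ∉ Z} => E x y).card : ℝ) + Z.card := by
        rw [← Nat.cast_add]
        exact Nat.cast_le.2 h3
      have h5 : ((S.card + r : ℕ) : ℝ) ≤
          ((Finset.univ.filter fun y : {x // x ∉ Z} => E x y).card : ℝ) := by
        rw [Nat.cast_add]
        linarith
      exact Nat.cast_le.1 h5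
  · left
    push Not at h1
    refine (Nat.cast_le (α := ℝ)).1 ?_
    by_cases h2 : (S.card : ℝ) < (1 - τ) * m - Z.card
    · have h3 := hT (robustNbhd E (ν * m) S') (fun y hy => by
        rw [mem_robustNbhd] at hy
        linarith)
      have h4 := h.expand S' (by rw [hSc]; exact h1)
      have h5 : (S.card : ℝ) + Z.card ≤ min (S'.card + ν * m) ((1 - τ) * m) := by
        refine le_min ?_ ?_
        · rw [hSc]; linarith
        · linarith
      linarith
    · push Not at h2
      have h3 := hT Finset.univ (fun y _ => by
        have h4 := h.in_deg y
        have h5 : (Finset.univ.filter fun x => E x y) ⊆ (S'.filter fun x => E x y) ∪ S'ᶜ := by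
          intro x hx
          simp only [Finset.mem_filter, Finset.mem_univ, true_and, Finset.mem_union,
            Finset.mem_compl] at hx ⊢
          tauto
        have h6 := (Finset.card_le_card h5).trans (Finset.card_union_le _ _)
        have h7 : ((Finset.univ.filter fun x => E x y).card : ℝ) ≤
            ((S'.filter fun x => E x y).card : ℝ) + (S'ᶜ.card : ℝ) := by
          rw [← Nat.cast_add]
          exact Nat.cast_le.2 h6
        have h8 : (S'.card : ℝ) + (S'ᶜ.card : ℝ) = m := by
          rw [← Nat.cast_add, Finset.card_add_card_compl]
        rw [hSc] at h8
        linarith)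
      rw [Finset.card_univ] at h3
      have h4 : (S'.card : ℝ) + Z.card ≤ m := by
        have hdisj : Disjoint S' Z := by
          rw [Finset.disjoint_left]
          intro x hx
          obtain ⟨y, -, rfl⟩ := Finset.mem_map.1 hx
          exact y.2
        rw [← Nat.cast_add, ← Finset.card_union_of_disjoint hdisj]
        exact Nat.cast_le.2 (Finset.card_le_univ _)
      rw [hSc] at h4
      linarith

/-- Robust expanders of large minimum semidegree have a closed flexible walk which is short and
can absorb linearly many walks. -/
theorem exists_closed_flexWalk (hν : 0 < ν) (hτ0 : 0 ≤ τ)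
    (hτ : 2 * τ ≤ 1) (hντ : ν + τ ≤ δ) (hδ : δ ≤ 1) :
    ∃ κ : ℝ, 0 < κ ∧ ∃ m₀ : ℕ, ∀ (X : Type) [Fintype X] (E : X → X → Prop),
      m₀ ≤ Fintype.card X → IsExpander E ν τ δ →
      ∃ a b P R, IsFlexWalk E a b P R ∧ E b a ∧ P.Nodup ∧
        (P.length : ℝ) ≤ ν / 4 * Fintype.card X ∧
        ∀ p q, κ * Fintype.card X ≤ absorbCount R p q := by
  obtain ⟨c, hc⟩ : ∃ c, c = ⌈1 / ν⌉₊ + 2 := ⟨_, rfl⟩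
  obtain ⟨L, hL⟩ : ∃ L, L = c * (2 * c + 20) := ⟨_, rfl⟩
  have hδ0 : 0 < δ := by linarith
  have hc2 : 2 ≤ c := by omega
  have hcL : c ≤ L := by rw [hL]; nlinarith
  have hL0 : 0 < L := by omega
  have hLR : (0 : ℝ) < L := Nat.cast_pos.2 hL0
  set θ : ℝ := ν / (8 * L) with hθ
  have hθ0 : 0 < θ := by positivity
  set κ : ℝ := δ ^ 2 * θ / 16 with hκ
  have hκ0 : 0 < κ := by positivity
  obtain ⟨m₁, hm₁⟩ := eventually_pow_mul_exp_lt (Real.exp 1) κ hκ0 2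
  obtain ⟨m₂, hm₂⟩ := exists_nat_gt ((c + 3) / (ν / 8))
  refine ⟨κ, hκ0, max m₁ (max m₂ 1), fun X _ E hX h => ?_⟩
  have hX1 : m₁ ≤ Fintype.card X := (le_max_left _ _).trans hX
  have hX2 : m₂ ≤ Fintype.card X := (le_max_left _ _).trans ((le_max_right _ _).trans hX)
  have hX3 : 1 ≤ Fintype.card X := (le_max_right _ _).trans ((le_max_right _ _).trans hX)
  obtain ⟨x₀⟩ := Fintype.card_pos_iff.1 hX3
  have hdecay := hm₁ _ hX1
  set m : ℝ := (Fintype.card X : ℝ) with hm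
  have hm0 : 0 < m := Nat.cast_pos.2 hX3
  have hcm : (c : ℝ) + 3 < ν / 8 * m := by
    have : ((c : ℝ) + 3) / (ν / 8) < m := hm₂.trans_le (Nat.cast_le.2 hX2)
    rwa [div_lt_iff₀' (by positivity)] at this
  obtain ⟨N, hN⟩ : ∃ N, N = ⌊θ * m⌋₊ := ⟨_, rfl⟩
  have hNle : (N : ℝ) ≤ θ * m := hN ▸ Nat.floor_le (by positivity)
  have hNge : θ * m < N + 1 := hN ▸ Nat.lt_floor_add_one _
  have hNL : ((1 + N * L : ℕ) : ℝ) ≤ 1 + ν / 8 * m := by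
    push_cast
    have : (N : ℝ) * L ≤ θ * m * L := mul_le_mul_of_nonneg_right hNle hLR.le
    have h2 : θ * m * L = ν / 8 * m := by rw [hθ]; field_simp
    linarith
  have hc0 : (0 : ℝ) ≤ c := Nat.cast_nonneg _
  obtain ⟨a, b, P, R, hflex, hnd, hlen, hpot⟩ := h.exists_flexWalk hν hτ0 hτ hντ hδ x₀ c hc N (by
    rw [← hL]
    have : 0 < ν / 8 * m := by positivity
    linarith)
  rw [← hL] at hlen
  have hPR : (P.length : ℝ) ≤ 1 + ν / 8 * m := (Nat.cast_le.2 hlen).trans hNL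
  have hPZ : (P.toFinset.card : ℝ) ≤ P.length := Nat.cast_le.2 (List.toFinset_card_le P)
  have hνδ : ν * m ≤ δ * m := by gcongr; linarith
  have hνm : 0 < ν * m := by positivity
  obtain ⟨y, hy, hyZ⟩ : ∃ y ∈ Finset.univ.filter fun y => E y a, y ∉ P.toFinset := by
    refine Finset.exists_mem_notMem_of_card_lt_card ?_
    have h1 := h.in_deg a
    have h2 : (P.toFinset.card : ℝ) < ((Finset.univ.filter fun y => E y a).card : ℝ) := by linarith
    exact Nat.cast_lt.1 h2
  rw [Finset.mem_filter] at hy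
  obtain ⟨a₁, C, hba, hC, hCnd, hCZ, hClen⟩ := h.exists_walk hν hτ0 hτ hντ b y P.toFinset hyZ (by
    have h1 : ((⌈1 / ν⌉₊ + 1 : ℕ) : ℝ) ≤ (c : ℕ) := Nat.cast_le.2 (by omega)
    linarith)
  refine ⟨a, y, P ++ C, R ++ [], .append hflex (.base hC) hba, hy.2, ?_, ?_, ?_⟩
  · rw [List.nodup_append]
    refine ⟨hnd, hCnd, ?_⟩
    rintro z hz _ hz' rfl
    exact hCZ z hz' (by simp [hz])
  · rw [List.length_append, Nat.cast_add]
    have : (C.length : ℝ) ≤ c := Nat.cast_le.2 (by omega)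
    linarith
  · intro p q
    rw [List.append_nil]
    by_contra hcon
    push Not at hcon
    have h1 : (1 / 2 : ℝ) ^ absorbCount R p q ≤ m ^ 2 * (1 - δ ^ 2 / 8) ^ N :=
      (Finset.single_le_sum (f := fun x : X × X => (1 / 2 : ℝ) ^ absorbCount R x.1 x.2)
        (fun x _ => by positivity) (Finset.mem_univ (p, q))).trans hpot
    have hδ1 : δ ^ 2 ≤ 1 := by nlinarith
    have h2 : (1 - δ ^ 2 / 8) ^ N ≤ Real.exp (1 - 2 * κ * m) := by
      have h3 : 1 - δ ^ 2 / 8 ≤ Real.exp (-(δ ^ 2 / 8)) := by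
        have := Real.add_one_le_exp (-(δ ^ 2 / 8))
        linarith
      refine (pow_le_pow_left₀ (by linarith) h3 N).trans ?_
      rw [← Real.exp_nat_mul, Real.exp_le_exp]
      have h4 : 2 * κ * m = δ ^ 2 / 8 * (θ * m) := by rw [hκ]; ring
      rw [h4]
      have h5 : δ ^ 2 / 8 * (θ * m) ≤ δ ^ 2 / 8 * (N + 1) := by gcongr
      linarith
    have h3 : Real.exp (-(κ * m)) ≤ (1 / 2 : ℝ) ^ absorbCount R p q := by
      have h4 : Real.exp (-1) ≤ 1 / 2 := by
        rw [Real.exp_neg, ← one_div]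
        refine one_div_le_one_div_of_le (by norm_num) ?_
        have := Real.add_one_le_exp (1 : ℝ)
        linarith
      refine le_trans ?_ (pow_le_pow_left₀ (Real.exp_pos _).le ?_ _ : Real.exp (-1) ^ absorbCount R p q ≤ _)
      · rw [← Real.exp_nat_mul, Real.exp_le_exp]
        linarith
      · exact h4
    have h4 : Real.exp (-(κ * m)) ≤ m ^ 2 * Real.exp (1 - 2 * κ * m) :=
      h3.trans (h1.trans (mul_le_mul_of_nonneg_left h2 (by positivity)))
    have h5 : Real.exp (1 - 2 * κ * m) =
        Real.exp 1 * Real.exp (-(κ * m)) * Real.exp (-(κ * m)) := by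
      rw [← Real.exp_add, ← Real.exp_add]
      ring_nf
    rw [h5] at h4
    have h6 := Real.exp_pos (-(κ * m))
    nlinarith

/-- Large robust expanders of linear minimum semidegree are Hamiltonian. -/
theorem IsExpander.exists_hamilton (hν : 0 < ν) (hτ0 : 0 ≤ τ)
    (hτ : 2 * τ ≤ 1) (hντ : ν + τ ≤ δ) (hδ : δ ≤ 1) :
    ∃ m₀ : ℕ, ∀ (X : Type) [Fintype X] (E : X → X → Prop),
      m₀ ≤ Fintype.card X → IsExpander E ν τ δ →
      ∃ a b l, IsWalk E a b l ∧ E b a ∧ l.Nodup ∧ ∀ x, x ∈ l := by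
  obtain ⟨κ, hκ, m₁, hm₁⟩ := exists_closed_flexWalk hν hτ0 hτ hντ hδ
  obtain ⟨N₀, hN₀⟩ := exists_path_cover (ξ := ν / 8) (c := κ) (by positivity) hκ
  obtain ⟨m₂, hm₂⟩ := exists_nat_gt (1 / (ν / 8))
  refine ⟨max m₁ (max m₂ (2 * N₀)), fun X _ E hX h => ?_⟩
  have hX1 : m₁ ≤ Fintype.card X := (le_max_left _ _).trans hX
  have hX2 : m₂ ≤ Fintype.card X := (le_max_left _ _).trans ((le_max_right _ _).trans hX)
  have hX3 : 2 * N₀ ≤ Fintype.card X := (le_max_right _ _).trans ((le_max_right _ _).trans hX)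
  obtain ⟨a, b, P, R, hflex, hba, hnd, hlen, hcount⟩ := hm₁ X E hX1 h
  set m : ℝ := (Fintype.card X : ℝ) with hm
  have hm0 : 0 ≤ m := Nat.cast_nonneg _
  have hνm : 1 < ν / 8 * m := by
    have : 1 / (ν / 8) < m := hm₂.trans_le (Nat.cast_le.2 hX2)
    rwa [div_lt_iff₀' (by positivity)] at this
  obtain ⟨r, hr⟩ : ∃ r, r = ⌊ν / 4 * m⌋₊ := ⟨_, rfl⟩
  have hrle : (r : ℝ) ≤ ν / 4 * m := hr ▸ Nat.floor_le (by positivity)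
  have hrge : ν / 4 * m < r + 1 := hr ▸ Nat.lt_floor_add_one _
  have hPZ : (P.toFinset.card : ℝ) ≤ P.length := Nat.cast_le.2 (List.toFinset_card_le P)
  obtain ⟨J, hJE, hJout, hJin⟩ := h.exists_regular_compl hντ P.toFinset r (by
    have : 0 ≤ ν * m := by positivity
    linarith)
  have hYc : Fintype.card {x // x ∉ P.toFinset} + P.toFinset.card = Fintype.card X := by
    rw [Fintype.card_subtype_compl, Fintype.card_coe]
    exact Nat.sub_add_cancel (Finset.card_le_univ _)
  have hYR : (Fintype.card {x // x ∉ P.toFinset} : ℝ) + P.toFinset.card = m := by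
    rw [← Nat.cast_add, hYc]
  have hP0 : (0 : ℝ) ≤ P.toFinset.card := Nat.cast_nonneg _
  obtain ⟨W, hWw, hWnd, hWm, hWl⟩ := hN₀ {x // x ∉ P.toFinset} (by
    have h1 : (2 * N₀ : ℝ) ≤ m := by
      have : ((2 * N₀ : ℕ) : ℝ) ≤ m := Nat.cast_le.2 hX3
      simpa using this
    have h2 : ν * m ≤ 1 * m := by gcongr; linarith
    have h3 : (N₀ : ℝ) ≤ Fintype.card {x // x ∉ P.toFinset} := by linarith
    exact Nat.cast_le.1 h3) J r (by
      have : ν / 8 * Fintype.card {x // x ∉ P.toFinset} ≤ ν / 8 * m := by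
        gcongr
        linarith
      linarith) hJout hJin
  obtain ⟨P', hperm, hwalk⟩ := hflex.absorb_all (W.map (List.map Subtype.val)) P R
    (by
      intro I hI
      obtain ⟨I', hI', rfl⟩ := List.mem_map.1 hI
      obtain ⟨p, q, hpq⟩ := hWw I' hI'
      exact ⟨p, q, hpq.map Subtype.val hJE⟩)
    (by
      intro p q
      rw [List.length_map]
      have h1 : (W.length : ℝ) ≤ absorbCount R p q :=
        hWl.trans (le_trans (by gcongr; linarith) (hcount p q))
      exact Nat.cast_le.1 h1)
  have hflat : (W.map (List.map Subtype.val)).flatten = W.flatten.map Subtype.val := by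
    rw [List.map_flatten]
  rw [hflat] at hperm
  refine ⟨a, b, P', hwalk, hba, ?_, ?_⟩
  · rw [hperm.nodup_iff, List.nodup_append]
    refine ⟨hnd, hWnd.map Subtype.val_injective, ?_⟩
    rintro x hx _ hy rfl
    obtain ⟨y, -, hyx⟩ := List.mem_map.1 hy
    exact y.2 (by simp [hyx, hx])
  · intro x
    rw [hperm.mem_iff, List.mem_append]
    by_cases hx : x ∈ P
    · exact Or.inl hx
    · exact Or.inr (List.mem_map.2 ⟨⟨x, by simpa using hx⟩, hWm _, rfl⟩)

end hamilton

theorem IsWalk.flatMap {X Y : Type*} {E : X → X → Prop} {R : Y → Y → Prop} {path : X → List Y}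
    {hd tl : X → Y} (hp : ∀ x, IsWalk R (hd x) (tl x) (path x))
    (hE : ∀ x y, E x y → R (tl x) (hd y)) {b : X} :
    ∀ {a : X} {l : List X}, IsWalk E a b l → IsWalk R (hd a) (tl b) (l.flatMap path)
  | a, [], h => by simp [IsWalk] at h
  | a, [x], h => by
    obtain ⟨-, h1, h2⟩ := h
    simp only [List.head?_cons, List.getLast?_singleton, Option.some.injEq] at h1 h2
    subst h1 h2
    simpa using hp x
  | a, x :: y :: l, h => by
    obtain ⟨h0, h1, h2⟩ := h
    simp only [List.head?_cons, Option.some.injEq] at h1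
    subst h1
    rw [List.isChain_cons_cons] at h0
    rw [List.getLast?_cons_cons] at h2
    have ih := IsWalk.flatMap hp hE (a := y) (l := y :: l) ⟨h0.2, rfl, h2⟩
    rw [List.flatMap_cons]
    exact (hp x).append ih (hE x y h0.1)

/-- A closed spanning walk without repetitions gives a cyclic permutation. -/
theorem exists_isCycle_of_isWalk {V : Type*} {R : V → V → Prop} {a b : V} {l : List V}
    (h : IsWalk R a b l) (hba : R b a) (hnd : l.Nodup) (hmem : ∀ v, v ∈ l) (hl : 2 ≤ l.length) :
    ∃ σ : Equiv.Perm V, σ.IsCycle ∧ ∀ v, σ v ≠ v ∧ R v (σ v) := by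
  refine ⟨l.formPerm, List.isCycle_formPerm hnd hl, fun v => ?_⟩
  obtain ⟨i, hi, rfl⟩ := List.mem_iff_getElem.1 (hmem v)
  rw [List.formPerm_apply_getElem _ hnd]
  constructor
  · rw [Ne, hnd.getElem_inj_iff]
    by_cases hi' : i + 1 < l.length
    · rw [Nat.mod_eq_of_lt hi']; omega
    · have : i + 1 = l.length := by omega
      rw [this, Nat.mod_self]; omega
  · by_cases hi' : i + 1 < l.length
    · simp only [Nat.mod_eq_of_lt hi']
      exact (List.isChain_iff_getElem.1 h.1) i hi'
    · have h1 : i + 1 = l.length := by omega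
      simp only [h1, Nat.mod_self]
      have h2 : l[0] = a := by
        have := h.2.1
        rw [List.head?_eq_getElem?, List.getElem?_eq_getElem (by omega)] at this
        simpa using this
      have h3 : l[i] = b := by
        have := h.2.2
        rw [List.getLast?_eq_getElem?, List.getElem?_eq_getElem (by omega)] at this
        simp only [← h1, Nat.add_sub_cancel, Option.some.injEq] at this
        exact this
      rw [h2, h3]
      exact hba

/-- Adding few vertices to a robustly expanding digraph preserves robust expansion. -/
theorem robustNbhd_sum_expand {A B : Type*} [Fintype A] [Fintype B] {E' : A → A → Prop}
    {E : A ⊕ B → A ⊕ B → Prop} {ν τ : ℝ} (hν : 0 < ν) (hντ : ν ≤ τ) (hτ1 : τ ≤ 1)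
    (hB : (Fintype.card B : ℝ) ≤ ν / 4 * Fintype.card A)
    (hE : ∀ a a', E' a a' → E (Sum.inl a) (Sum.inl a'))
    (hexp : ∀ S : Finset A, τ * Fintype.card A ≤ S.card →
      robustNbhd E' (ν * Fintype.card A) S = Finset.univ ∨
      (S.card + ν * Fintype.card A ≤ ((robustNbhd E' (ν * Fintype.card A) S).card : ℝ)))
    (S : Finset (A ⊕ B)) (hS : 2 * τ * Fintype.card (A ⊕ B) ≤ S.card) :
    min (S.card + ν / 2 * Fintype.card (A ⊕ B)) ((1 - 2 * τ) * Fintype.card (A ⊕ B)) ≤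
      ((robustNbhd E (ν / 2 * Fintype.card (A ⊕ B)) S).card : ℝ) := by
  rw [Fintype.card_sum, Nat.cast_add] at hS ⊢
  set m : ℝ := (Fintype.card A : ℝ) with hm
  set k : ℝ := (Fintype.card B : ℝ) with hk
  have hm0 : 0 ≤ m := Nat.cast_nonneg _
  have hk0 : 0 ≤ k := Nat.cast_nonneg _
  have hνm : 0 ≤ ν * m := by positivity
  have hντm : ν * m ≤ τ * m := by gcongr
  have hτm : τ * m ≤ m := by nlinarith
  have hτk : 0 ≤ τ * k := mul_nonneg (hν.le.trans hντ) hk0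
  have hνk : ν * k ≤ k := by nlinarith
  set S' : Finset A := Finset.univ.filter fun a => Sum.inl a ∈ S with hS'
  have hSc : (S.card : ℝ) ≤ S'.card + k := by
    have h1 : S ⊆ S'.map Function.Embedding.inl ∪ Finset.univ.map Function.Embedding.inr := by
      intro x hx
      rcases x with a | b
      · exact Finset.mem_union_left _ (Finset.mem_map.2 ⟨a, by simp [hS', hx], rfl⟩)
      · exact Finset.mem_union_right _ (Finset.mem_map.2 ⟨b, by simp, rfl⟩)
    have h2 := (Finset.card_le_card h1).trans (Finset.card_union_le _ _)
    rw [Finset.card_map, Finset.card_map, Finset.card_univ] at h2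
    rw [hk, ← Nat.cast_add]
    exact Nat.cast_le.2 h2
  have hrob : ((robustNbhd E' (ν * m) S').card : ℝ) ≤
      ((robustNbhd E (ν / 2 * (m + k)) S).card : ℝ) := by
    refine Nat.cast_le.2 ?_
    rw [← Finset.card_map (Function.Embedding.inl (β := B))]
    refine Finset.card_le_card fun x hx => ?_
    obtain ⟨a, ha, rfl⟩ := Finset.mem_map.1 hx
    rw [mem_robustNbhd] at ha ⊢
    have h1 : ((S'.filter fun u => E' u a).map Function.Embedding.inl) ⊆
        S.filter fun u => E u (Function.Embedding.inl a) := by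
      intro y hy
      obtain ⟨a', ha', rfl⟩ := Finset.mem_map.1 hy
      simp only [hS', Finset.mem_filter, Finset.mem_univ, true_and] at ha'
      exact Finset.mem_filter.2 ⟨ha'.1, hE _ _ ha'.2⟩
    have h2 := Finset.card_le_card h1
    rw [Finset.card_map] at h2
    refine le_trans ?_ (ha.trans (Nat.cast_le.2 h2))
    linarith
  have hS'c : τ * m ≤ S'.card := by nlinarith
  rcases hexp S' hS'c with h | h
  · refine (min_le_right _ _).trans (le_trans ?_ hrob)
    rw [h, Finset.card_univ]
    nlinarith
  · refine (min_le_left _ _).trans (le_trans ?_ hrob)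
    nlinarith

theorem card_filter_sum_inl {A B : Type*} [Fintype A] [Fintype B] (p : A ⊕ B → Prop) :
    (Finset.univ.filter fun a => p (Sum.inl a)).card ≤ (Finset.univ.filter p).card := by
  rw [← Finset.card_map (Function.Embedding.inl (β := B))]
  refine Finset.card_le_card fun x hx => ?_
  obtain ⟨a, ha, rfl⟩ := Finset.mem_map.1 hx
  simpa using ha

theorem card_filter_subtype {V : Type*} [Fintype V] (W : Finset V) (p : V → Prop) :
    (Finset.univ.filter fun a : {w // w ∈ W} => p a).card = (W.filter p).card := by
  rw [← Finset.card_map (Function.Embedding.subtype _)]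
  congr 1
  ext x
  simp [and_comm]

/-- A path system outside a set `W` with few paths extends to a Hamilton cycle whose remaining
edges come from an oriented graph which is dense inside `W` and whose connections to `W` at the
ends of the paths are dense. -/
theorem exists_isCycle_of_path_system {γ β : ℝ} (hγ : 0 < γ) (hβ : 0 < β) :
    ∃ ε : ℝ, 0 < ε ∧ ∃ m₀ : ℕ, ∀ (V : Type) [Fintype V] (W : Finset V) (R F : V → V → Prop)
      (rk : V → ℕ), m₀ ≤ W.card →
      (∀ u v, R u v → ¬ R v u) →
      (∀ w ∈ W, (3 / 8 + γ) * W.card ≤ ((W.filter fun u => R w u).card : ℝ)) →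
      (∀ w ∈ W, (3 / 8 + γ) * W.card ≤ ((W.filter fun u => R u w).card : ℝ)) →
      (∀ v ∉ W, (∀ u, ¬ F v u) → β * W.card ≤ ((W.filter fun w => R v w).card : ℝ)) →
      (∀ v ∉ W, (∀ u, ¬ F u v) → β * W.card ≤ ((W.filter fun w => R w v).card : ℝ)) →
      (∀ u v, F u v → rk u < rk v) →
      (∀ u v v', F u v → F u v' → v = v') → (∀ u u' v, F u v → F u' v → u = u') →
      (∀ u v, F u v → u ∉ W ∧ v ∉ W) →
      ((Finset.univ.filter fun v => v ∉ W ∧ ∀ u, ¬ F v u).card : ℝ) ≤ ε * W.card →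
      ∃ σ : Equiv.Perm V, σ.IsCycle ∧ ∀ v, σ v ≠ v ∧ (F v (σ v) ∨ R v (σ v) ∧
        (v ∉ W → ∀ u, ¬ F v u) ∧ (σ v ∉ W → ∀ u, ¬ F u (σ v))) := by
  set δ : ℝ := min β (3 / 8) / 2 with hδ
  have hδ0 : 0 < δ := by positivity
  have hδβ : 2 * δ ≤ β := by have := min_le_left β (3 / 8); linarith
  have hδ1 : 2 * δ ≤ 3 / 8 := by have := min_le_right β (3 / 8); linarith
  obtain ⟨ν, hν, hντ, hexp⟩ := oriented_robust_expansion hγ (show 0 < δ / 8 by positivity)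
  obtain ⟨m₀, hm₀⟩ := IsExpander.exists_hamilton (ν := ν / 2) (τ := 2 * (δ / 8)) (δ := δ)
    (by positivity) (by positivity) (by linarith) (by linarith) (by linarith)
  refine ⟨ν / 4, by positivity, max m₀ 2, ?_⟩
  intro V _ W R F rk hW hor hWout hWin hvout hvin hrk hfun hinj hFW hends
  have hW1 : m₀ ≤ W.card := (le_max_left _ _).trans hW
  have hW2 : 2 ≤ W.card := (le_max_right _ _).trans hW
  obtain ⟨J, hJw, hJnd, hJm, hJl⟩ := exists_walk_partition F rk hrk hfun hinj Wᶜ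
  simp only [Finset.mem_compl] at hJw hJm
  have hJw' : ∀ j : Fin J.length, ∃ a b, IsWalk F a b (J.get j) ∧ (∀ y, ¬ F y a) ∧
      (∀ y, ¬ F b y) ∧ a ∉ W ∧ b ∉ W := by
    intro j
    obtain ⟨a, b, hw, ha, hb⟩ := hJw _ (J.get_mem j)
    refine ⟨a, b, hw, fun y hy => ha y (hFW _ _ hy).1 hy, fun y hy => hb y (hFW _ _ hy).2 hy, ?_, ?_⟩
    · exact (hJm a).1 (List.mem_flatten.2 ⟨_, J.get_mem j, hw.head_mem⟩)
    · exact (hJm b).1 (List.mem_flatten.2 ⟨_, J.get_mem j, hw.last_mem⟩)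
  choose a b hab ha hb haW hbW using hJw'
  set R' : V → V → Prop := fun u v => F u v ∨ R u v ∧
        (u ∉ W → ∀ x, ¬ F u x) ∧ (v ∉ W → ∀ x, ¬ F x v) with hR'
  set hd : {w // w ∈ W} ⊕ Fin J.length → V := Sum.elim Subtype.val a with hhd
  set tl : {w // w ∈ W} ⊕ Fin J.length → V := Sum.elim Subtype.val b with htl
  set path : {w // w ∈ W} ⊕ Fin J.length → List V := Sum.elim (fun w => [w.1]) J.get with hpath
  set E : {w // w ∈ W} ⊕ Fin J.length → {w // w ∈ W} ⊕ Fin J.length → Prop :=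
    fun x y => R (tl x) (hd y) with hE
  have hcW : Fintype.card {w // w ∈ W} = W.card := Fintype.card_coe W
  have hB : (Fintype.card (Fin J.length) : ℝ) ≤ ν / 4 * Fintype.card {w // w ∈ W} := by
    rw [hcW, Fintype.card_fin, hJl]
    refine le_trans (Nat.cast_le.2 (Finset.card_le_card fun v hv => ?_)) hends
    simp only [Finset.mem_filter, Finset.mem_compl, Finset.mem_univ, true_and] at hv ⊢
    exact ⟨hv.1, fun u hu => hv.2 u (hFW _ _ hu).2 hu⟩
  have hoW : ∀ v : {w // w ∈ W}, (3 / 8 + γ) * Fintype.card {w // w ∈ W} ≤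
      ((Finset.univ.filter fun u : {w // w ∈ W} => R v u).card : ℝ) := by
    intro v
    rw [card_filter_subtype W fun u => R v u, hcW]
    exact hWout v v.2
  have hiW : ∀ v : {w // w ∈ W}, (3 / 8 + γ) * Fintype.card {w // w ∈ W} ≤
      ((Finset.univ.filter fun u : {w // w ∈ W} => R u v).card : ℝ) := by
    intro v
    rw [card_filter_subtype W fun u => R u v, hcW]
    exact hWin v v.2
  have hsize : δ * Fintype.card ({w // w ∈ W} ⊕ Fin J.length) ≤ 2 * δ * W.card := by
    rw [Fintype.card_sum, Nat.cast_add]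
    have h1 : ν / 4 * Fintype.card {w // w ∈ W} ≤ 1 * Fintype.card {w // w ∈ W} := by
      gcongr
      linarith
    rw [hcW] at hB h1 ⊢
    nlinarith
  have hWR : (0 : ℝ) ≤ W.card := Nat.cast_nonneg _
  have hexpander : IsExpander E (ν / 2) (2 * (δ / 8)) δ := by
    refine ⟨?_, ?_, ?_, ?_⟩
    · intro x
      refine hsize.trans (le_trans ?_ (Nat.cast_le.2 (card_filter_sum_inl fun y => E x y)))
      have h1 : 2 * δ * W.card ≤ ((W.filter fun w => R (tl x) w).card : ℝ) := by
        rcases x with w | j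
        · refine le_trans ?_ (hWout w w.2)
          gcongr
          linarith
        · refine le_trans ?_ (hvout _ (hbW j) (hb j))
          gcongr
      rw [← card_filter_subtype] at h1
      exact h1
    · intro x
      refine hsize.trans (le_trans ?_ (Nat.cast_le.2 (card_filter_sum_inl fun y => E y x)))
      have h1 : 2 * δ * W.card ≤ ((W.filter fun w => R w (hd x)).card : ℝ) := by
        rcases x with w | j
        · refine le_trans ?_ (hWin w w.2)
          gcongr
          linarith
        · refine le_trans ?_ (hvin _ (haW j) (ha j))
          gcongr
      rw [← card_filter_subtype] at h1
      exact h1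
    · exact robustNbhd_sum_expand hν hντ (by linarith) hB (fun _ _ h => h)
        (hexp _ (fun u v : {w // w ∈ W} => R u v) (fun u v => hor u v) hoW hiW)
    · exact robustNbhd_sum_expand hν hντ (by linarith) hB (fun _ _ h => h)
        (hexp _ (fun u v : {w // w ∈ W} => R v u) (fun u v => hor v u) hiW hoW)
  obtain ⟨x, y, l, hl, hyx, hlnd, hlm⟩ := hm₀ _ E (by
    rw [Fintype.card_sum, hcW]
    omega) hexpander
  have hER : ∀ x y, E x y → R' (tl x) (hd y) := by
    intro x y hxy
    refine Or.inr ⟨hxy, ?_, ?_⟩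
    · rcases x with w | j
      · exact fun h => absurd w.2 h
      · exact fun _ => hb j
    · rcases y with w | j
      · exact fun h => absurd w.2 h
      · exact fun _ => ha j
  have hpw : ∀ x, IsWalk R' (hd x) (tl x) (path x) := by
    rintro (w | j)
    · exact IsWalk.singleton w.1
    · exact ⟨(hab j).1.imp fun u v huv => Or.inl huv, (hab j).2⟩
  have hwalk := hl.flatMap hpw hER
  have hJW : ∀ j : Fin J.length, ∀ v ∈ J.get j, v ∉ W := fun j v hv =>
    (hJm v).1 (List.mem_flatten.2 ⟨_, J.get_mem j, hv⟩)
  rw [List.nodup_flatten] at hJnd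
  have hnd : (l.flatMap path).Nodup := by
    rw [List.nodup_flatMap]
    constructor
    · rintro (w | j) -
      · exact List.nodup_singleton _
      · exact hJnd.1 _ (J.get_mem j)
    · refine List.Pairwise.imp ?_ hlnd
      rintro (w | j) (w' | j') hne v hv hv'
      · simp only [hpath, Sum.elim_inl, List.mem_singleton] at hv hv'
        exact hne (congrArg Sum.inl (Subtype.ext (hv.symm.trans hv')))
      · simp only [hpath, Sum.elim_inl, List.mem_singleton] at hv
        exact hJW j' v hv' (hv ▸ w.2)
      · simp only [hpath, Sum.elim_inl, List.mem_singleton] at hv'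
        exact hJW j v hv (hv' ▸ w'.2)
      · have h2 := List.pairwise_iff_get.1 hJnd.2
        rcases lt_trichotomy j j' with h | h | h
        · exact h2 j j' h hv hv'
        · exact hne (congrArg Sum.inr h)
        · exact h2 j' j h hv' hv
  have hmem : ∀ v, v ∈ l.flatMap path := by
    intro v
    rw [List.mem_flatMap]
    by_cases hv : v ∈ W
    · exact ⟨Sum.inl ⟨v, hv⟩, hlm _, by simp [hpath]⟩
    · obtain ⟨I, hI, hvI⟩ := List.mem_flatten.1 ((hJm v).2 hv)
      obtain ⟨j, rfl⟩ := List.mem_iff_get.1 hI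
      exact ⟨Sum.inr j, hlm _, hvI⟩
  have hlen : 2 ≤ (l.flatMap path).length := by
    rw [← List.toFinset_card_of_nodup hnd]
    refine hW2.trans (Finset.card_le_card fun v _ => ?_)
    rw [List.mem_toFinset]
    exact hmem v
  exact exists_isCycle_of_isWalk hwalk (hER _ _ hyx) hnd hmem hlen

/-- Edge-disjoint path systems outside a set `W` extend to edge-disjoint Hamilton cycles. -/
theorem exists_edge_disjoint_isCycle {γ β : ℝ} (hγ : 0 < γ) (hβ : 0 < β) :
    ∃ ε : ℝ, 0 < ε ∧ ∃ m₀ : ℕ, ∀ (V ι : Type) [Fintype V] [Fintype ι] (W : Finset V)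
      (R : V → V → Prop) (F : ι → V → V → Prop), m₀ ≤ W.card →
      (∀ u v, R u v → ¬ R v u) →
      (∀ w ∈ W, (3 / 8 + γ) * W.card ≤ ((W.filter fun u => R w u).card : ℝ)) →
      (∀ w ∈ W, (3 / 8 + γ) * W.card ≤ ((W.filter fun u => R u w).card : ℝ)) →
      (∀ v ∉ W, β * W.card ≤ ((W.filter fun w => R v w).card : ℝ)) →
      (∀ v ∉ W, β * W.card ≤ ((W.filter fun w => R w v).card : ℝ)) →
      (∀ i, ∃ rk : V → ℕ, ∀ u v, F i u v → rk u < rk v) →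
      (∀ i u v v', F i u v → F i u v' → v = v') →
      (∀ i u u' v, F i u v → F i u' v → u = u') →
      (∀ i u v, F i u v → u ∉ W ∧ v ∉ W) →
      (∀ i, ((Finset.univ.filter fun v => v ∉ W ∧ ∀ u, ¬ F i v u).card : ℝ) ≤ ε * W.card) →
      (∀ v ∉ W, ((Finset.univ.filter fun i => ∀ u, ¬ F i v u).card : ℝ) ≤ β / 2 * W.card) →
      (∀ v ∉ W, ((Finset.univ.filter fun i => ∀ u, ¬ F i u v).card : ℝ) ≤ β / 2 * W.card) →
      (∀ i u v, F i u v → ¬ R u v) → (∀ i j u v, F i u v → F j u v → i = j) →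
      (Fintype.card ι : ℝ) ≤ γ / 2 * W.card →
      ∃ σ : ι → Equiv.Perm V, (∀ i, (σ i).IsCycle ∧
        ∀ v, σ i v ≠ v ∧ (F i v (σ i v) ∨ R v (σ i v))) ∧
        ∀ i j, i ≠ j → ∀ v, σ i v ≠ σ j v := by
  obtain ⟨ε, hε, m₀, hm₀⟩ := exists_isCycle_of_path_system (γ := γ / 2) (β := β / 2)
    (by positivity) (by positivity)
  refine ⟨ε, hε, m₀, ?_⟩
  intro V ι _ _ W R F hW hor hWout hWin hvout hvin hrk hfun hinj hFW hends hlout hlin hFR hFF hι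
  suffices H : ∀ I : Finset ι, ∃ σ : ι → Equiv.Perm V, (∀ i ∈ I, (σ i).IsCycle ∧
      ∀ v, σ i v ≠ v ∧ (F i v (σ i v) ∨ R v (σ i v) ∧
        (v ∉ W → ∀ u, ¬ F i v u) ∧ (σ i v ∉ W → ∀ u, ¬ F i u (σ i v)))) ∧
      ∀ i ∈ I, ∀ j ∈ I, i ≠ j → ∀ v, σ i v ≠ σ j v by
    obtain ⟨σ, h1, h2⟩ := H Finset.univ
    refine ⟨σ, fun i => ⟨(h1 i (Finset.mem_univ i)).1, fun v => ?_⟩, fun i j =>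
      h2 i (Finset.mem_univ i) j (Finset.mem_univ j)⟩
    obtain ⟨h3, h4⟩ := (h1 i (Finset.mem_univ i)).2 v
    exact ⟨h3, h4.imp_right And.left⟩
  intro I
  induction I using Finset.induction_on with
  | empty => exact ⟨fun _ => 1, by simp⟩
  | insert i I hi ih =>
    obtain ⟨σ, hσ, hdisj⟩ := ih
    obtain ⟨R', hR'⟩ : ∃ R' : V → V → Prop, ∀ u v, R' u v ↔ R u v ∧ ∀ j ∈ I, σ j u ≠ v :=
      ⟨_, fun _ _ => Iff.rfl⟩
    have hIc : (I.card : ℝ) ≤ γ / 2 * W.card :=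
      le_trans (Nat.cast_le.2 (Finset.card_le_univ I)) hι
    have hsub : ∀ (P Q : V → Prop) (K : Finset ι) (f : ι → V) (c d : ℝ),
        (∀ w ∈ W, P w → ¬ Q w → ∃ j ∈ K, f j = w) → d ≤ ((W.filter P).card : ℝ) →
        (K.card : ℝ) ≤ c → d - c ≤ ((W.filter Q).card : ℝ) := by
      intro P Q K f c d h hd hc
      have h1 : W.filter P ⊆ W.filter Q ∪ K.image f := by
        intro w hw
        rw [Finset.mem_filter] at hw
        by_cases hq : Q w
        · exact Finset.mem_union_left _ (Finset.mem_filter.2 ⟨hw.1, hq⟩)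
        · obtain ⟨j, hj, hjw⟩ := h w hw.1 hw.2 hq
          exact Finset.mem_union_right _ (Finset.mem_image.2 ⟨j, hj, hjw⟩)
      have h2 := (Finset.card_le_card h1).trans ((Finset.card_union_le _ _).trans
        (add_le_add le_rfl Finset.card_image_le))
      have h3 : ((W.filter P).card : ℝ) ≤ ((W.filter Q).card : ℝ) + K.card := by
        rw [← Nat.cast_add]
        exact Nat.cast_le.2 h2
      linarith
    have hnot : ∀ u v, R u v → ¬ R' u v → ∃ j ∈ I, σ j u = v := by
      intro u v huv h
      rw [hR'] at h
      push Not at h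
      exact h huv
    have hnot' : ∀ u v, R u v → ¬ R' u v → ∃ j ∈ I, (σ j).symm v = u := by
      intro u v huv h
      obtain ⟨j, hj, hjv⟩ := hnot u v huv h
      exact ⟨j, hj, by rw [← hjv, Equiv.symm_apply_apply]⟩
    obtain ⟨rk, hrk'⟩ := hrk i
    obtain ⟨τ, hτ, hτ'⟩ := hm₀ V W R' (F i) rk hW
      (fun u v h h' => hor u v ((hR' _ _).1 h).1 ((hR' _ _).1 h').1)
      (fun w hw => by
        have := hsub (fun u => R w u) (fun u => R' w u) I (fun j => σ j w) _ _
          (fun u _ => hnot w u) (hWout w hw) hIc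
        linarith)
      (fun w hw => by
        have := hsub (fun u => R u w) (fun u => R' u w) I (fun j => (σ j).symm w) _ _
          (fun u _ => hnot' u w) (hWin w hw) hIc
        linarith)
      (fun v hv _ => by
        have := hsub (fun u => R v u) (fun u => R' v u)
          (Finset.univ.filter fun j => ∀ u, ¬ F j v u) (fun j => σ j v) _ _ (by
            intro w hw hvw h
            obtain ⟨j, hj, hjw⟩ := hnot v w hvw h
            refine ⟨j, ?_, hjw⟩
            rcases ((hσ j hj).2 v).2 with h1 | h1
            · exact absurd (hjw ▸ hw) (hFW _ _ _ h1).2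
            · simpa using h1.2.1 hv) (hvout v hv) (hlout v hv)
        linarith)
      (fun v hv _ => by
        have := hsub (fun u => R u v) (fun u => R' u v)
          (Finset.univ.filter fun j => ∀ u, ¬ F j u v) (fun j => (σ j).symm v) _ _ (by
            intro w hw hvw h
            obtain ⟨j, hj, hjw⟩ := hnot w v hvw h
            refine ⟨j, ?_, by rw [← hjw, Equiv.symm_apply_apply]⟩
            rcases ((hσ j hj).2 w).2 with h1 | h1
            · exact absurd hw (hFW _ _ _ h1).1
            · rw [hjw] at h1
              simpa using h1.2.2 hv) (hvin v hv) (hlin v hv)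
        linarith)
      hrk' (hfun i) (hinj i) (hFW i) (hends i)
    have hnew : ∀ j ∈ I, ∀ v, τ v ≠ σ j v := by
      intro j hj v hv
      have hij : i ≠ j := fun h => hi (h ▸ hj)
      rcases (hτ' v).2 with h1 | h1
      · rcases ((hσ j hj).2 v).2 with h2 | h2
        · exact hij (hFF i j v _ h1 (hv ▸ h2))
        · exact hFR i v _ h1 (hv ▸ h2.1)
      · exact ((hR' _ _).1 h1.1).2 j hj hv.symm
    refine ⟨Function.update σ i τ, ?_, ?_⟩
    · intro j hj
      rcases Finset.mem_insert.1 hj with rfl | hj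
      · rw [Function.update_self]
        exact ⟨hτ, fun v => ⟨(hτ' v).1, (hτ' v).2.imp_right fun h => ⟨((hR' _ _).1 h.1).1, h.2⟩⟩⟩
      · have hji : j ≠ i := fun h => hi (h ▸ hj)
        rw [Function.update_of_ne hji]
        exact hσ j hj
    · intro j hj k hk hjk v
      rcases Finset.mem_insert.1 hj with rfl | hjI <;>
        rcases Finset.mem_insert.1 hk with rfl | hkI
      · exact absurd rfl hjk
      · rw [Function.update_self, Function.update_of_ne hjk.symm]
        exact hnew k hkI v
      · rw [Function.update_self, Function.update_of_ne hjk]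
        exact (hnew j hjI v).symm
      · rw [Function.update_of_ne (ne_of_mem_of_not_mem hjI hi),
          Function.update_of_ne (ne_of_mem_of_not_mem hkI hi)]
        exact hdisj j hjI k hkI hjk v

theorem abs_card_filter_mem_sub_le {V K : Type*} [Fintype K] (S : Finset V) (f : V → K) {d θ : ℝ}
    (h : ∀ c, |((S.filter fun v => f v = c).card : ℝ) - d| ≤ θ) (C : Finset K) :
    |((S.filter fun v => f v ∈ C).card : ℝ) - C.card * d| ≤ Fintype.card K * θ := by
  have h1 : (S.filter fun v => f v ∈ C).card = ∑ c ∈ C, (S.filter fun v => f v = c).card := by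
    rw [Finset.card_eq_sum_card_fiberwise (f := f) (t := C) (fun v hv => by simpa using
      (Finset.mem_filter.1 hv).2)]
    refine Finset.sum_congr rfl fun c hc => ?_
    congr 1
    ext v
    simp only [Finset.mem_filter]
    constructor
    · rintro ⟨⟨h1, -⟩, h2⟩
      exact ⟨h1, h2⟩
    · rintro ⟨h1, rfl⟩
      exact ⟨⟨h1, hc⟩, rfl⟩
  have h2 : ((S.filter fun v => f v ∈ C).card : ℝ) - C.card * d =
      ∑ c ∈ C, (((S.filter fun v => f v = c).card : ℝ) - d) := by
    rw [h1, Finset.sum_sub_distrib, Finset.sum_const, nsmul_eq_mul, Nat.cast_sum]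
  rw [h2]
  refine (Finset.abs_sum_le_sum_abs _ _).trans ((Finset.sum_le_sum fun c _ => h c).trans ?_)
  rw [Finset.sum_const, nsmul_eq_mul]
  by_cases hK : Nonempty K
  · obtain ⟨c⟩ := hK
    exact mul_le_mul_of_nonneg_right (Nat.cast_le.2 (Finset.card_le_univ C))
      ((abs_nonneg _).trans (h c))
  · have : IsEmpty K := not_nonempty_iff.1 hK
    simp [Finset.eq_empty_of_isEmpty C]

/-- Vertex labels such that all vertices are joined to all unions of label classes with the
expected density `α`, up to an error of `ω n`. -/
structure IsBalanced {V : Type*} [Fintype V] {s q p : ℕ} (G : V → V → Prop)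
    (a : V → Fin s → Fin q) (b : V → ZMod p) (α ω : ℝ) : Prop where
  out_card : ∀ v (X : Finset (Fin s → Fin q)) (Y : Finset (ZMod p)),
    |((Finset.univ.filter fun u => G v u ∧ a u ∈ X ∧ b u ∈ Y).card : ℝ) -
      X.card * Y.card / (q ^ s * p) * (α * Fintype.card V)| ≤ ω * Fintype.card V
  in_card : ∀ v (X : Finset (Fin s → Fin q)) (Y : Finset (ZMod p)),
    |((Finset.univ.filter fun u => G u v ∧ a u ∈ X ∧ b u ∈ Y).card : ℝ) -
      X.card * Y.card / (q ^ s * p) * (α * Fintype.card V)| ≤ ω * Fintype.card V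
  card : ∀ (X : Finset (Fin s → Fin q)) (Y : Finset (ZMod p)),
    |((Finset.univ.filter fun u => a u ∈ X ∧ b u ∈ Y).card : ℝ) -
      X.card * Y.card / (q ^ s * p) * Fintype.card V| ≤ ω * Fintype.card V

theorem exists_isBalanced (s q p : ℕ) [NeZero p] (hq : 0 < q) {ω : ℝ} (hω : 0 < ω) (hω1 : ω ≤ 1) :
    ∃ n₀ : ℕ, ∃ η : ℝ, 0 < η ∧ ∀ (V : Type) [Fintype V] (G : V → V → Prop) (α : ℝ),
      n₀ ≤ Fintype.card V →
      (∀ v, |((Finset.univ.filter fun u => G v u).card : ℝ) - α * Fintype.card V| ≤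
        η * Fintype.card V) →
      (∀ v, |((Finset.univ.filter fun u => G u v).card : ℝ) - α * Fintype.card V| ≤
        η * Fintype.card V) →
      ∃ (a : V → Fin s → Fin q) (b : V → ZMod p), IsBalanced G a b α ω := by
  have hp : 0 < p := NeZero.pos p
  have hk : 0 < q ^ s * p := by positivity
  obtain ⟨k, hkdef⟩ : ∃ k, k = q ^ s * p := ⟨_, rfl⟩
  rw [← hkdef] at hk
  have hkR : (1 : ℝ) ≤ k := by exact_mod_cast hk
  have hkR' : (k : ℝ) = q ^ s * p := by rw [hkdef]; push_cast; rfl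
  have hcardK : Fintype.card ((Fin s → Fin q) × ZMod p) = k := by
    simp [hkdef, ZMod.card]
  set η : ℝ := ω / (2 * k) with hη
  have hη0 : 0 < η := by positivity
  have hη1 : η ≤ 1 := by
    rw [hη, div_le_one (by positivity)]
    linarith
  have hkη : (k : ℝ) * (2 * η) = ω := by rw [hη]; field_simp
  obtain ⟨n₀, hn₀⟩ := exists_balanced_coloring k hk η hη0 hη1
  refine ⟨max n₀ 1, η, hη0, fun V _ G α hV hout hin => ?_⟩
  have hV1 : 1 ≤ Fintype.card V := (le_max_right _ _).trans hV
  set n : ℝ := (Fintype.card V : ℝ) with hn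
  have hn0 : 0 ≤ n := Nat.cast_nonneg _
  obtain ⟨f, hf⟩ := hn₀ _ ((le_max_left _ _).trans hV) V ((Fin s → Fin q) × ZMod p)
    (V ⊕ V ⊕ Unit) rfl hcardK (by
      simp only [Fintype.card_sum, Fintype.card_unit]; omega)
    (Sum.elim (fun x => Finset.univ.filter fun y => G x y)
      (Sum.elim (fun y => Finset.univ.filter fun x => G x y) fun _ => Finset.univ))
  have hconv : ∀ (S : Finset V) (d : ℝ), |(S.card : ℝ) - d * n| ≤ η * n →
      (∀ c, |((S.filter fun v => f v = c).card : ℝ) - S.card / k| ≤ η * n) →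
      ∀ (X : Finset (Fin s → Fin q)) (Y : Finset (ZMod p)),
      |((S.filter fun u => (f u).1 ∈ X ∧ (f u).2 ∈ Y).card : ℝ) -
        X.card * Y.card / (q ^ s * p) * (d * n)| ≤ ω * n := by
    intro S d hS hc X Y
    have h1 : ∀ c, |((S.filter fun v => f v = c).card : ℝ) - d * n / k| ≤ 2 * η * n := by
      intro c
      have h2 : |(S.card : ℝ) / k - d * n / k| ≤ η * n := by
        rw [← sub_div, abs_div, abs_of_nonneg (by linarith : (0 : ℝ) ≤ k)]
        refine (div_le_self (abs_nonneg _) hkR).trans hS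
      have h3 := abs_add_le (((S.filter fun v => f v = c).card : ℝ) - S.card / k)
        ((S.card : ℝ) / k - d * n / k)
      rw [sub_add_sub_cancel] at h3
      linarith [hc c]
    have h2 := abs_card_filter_mem_sub_le S f (d := d * n / k) (θ := 2 * η * n)
      (fun c => by convert h1 c) (X ×ˢ Y)
    rw [hcardK, Finset.card_product, Nat.cast_mul] at h2
    have h3 : (X.card : ℝ) * Y.card / (q ^ s * p) * (d * n) = X.card * Y.card * (d * n / k) := by
      rw [hkR']; ring
    have h4 : ω * n = k * (2 * η * n) := by rw [← hkη]; ring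
    rw [h3, h4]
    convert h2 using 6
    simp [Finset.mem_product]
  refine ⟨fun v => (f v).1, fun v => (f v).2, ?_, ?_, ?_⟩
  · intro v X Y
    have := hconv (Finset.univ.filter fun u => G v u) α (hout v) (fun c => by
      have := hf (Sum.inl v) c
      simp only [Sum.elim_inl] at this
      convert this) X Y
    rwa [Finset.filter_filter] at this
  · intro v X Y
    have := hconv (Finset.univ.filter fun u => G u v) α (hin v) (fun c => by
      have := hf (Sum.inr (Sum.inl v)) c
      simp only [Sum.elim_inl, Sum.elim_inr] at this
      convert this) X Y
    rwa [Finset.filter_filter] at this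
  · intro X Y
    have := hconv Finset.univ 1 (by
      rw [Finset.card_univ, one_mul, sub_self, abs_zero]; positivity) (fun c => by
      have := hf (Sum.inr (Sum.inr ())) c
      simp only [Sum.elim_inr] at this
      convert this) X Y
    rwa [one_mul] at this

theorem card_pi_filter {s q : ℕ} (σ : Fin s) (A : Finset (Fin q)) (B : Fin s → Finset (Fin q))
    (r : ℕ) (hB : ∀ i, (B i).card = r) :
    (Finset.univ.filter fun x : Fin s → Fin q => x σ ∈ A ∧ ∀ i ≠ σ, x i ∈ B i).card =
      A.card * r ^ (s - 1) := by
  have h1 : (Finset.univ.filter fun x : Fin s → Fin q => x σ ∈ A ∧ ∀ i ≠ σ, x i ∈ B i) =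
      Fintype.piFinset (Function.update B σ A) := by
    ext x
    simp only [Finset.mem_filter, Finset.mem_univ, true_and, Fintype.mem_piFinset]
    constructor
    · rintro ⟨h1, h2⟩ i
      by_cases hi : i = σ
      · subst hi; simpa using h1
      · rw [Function.update_of_ne hi]; exact h2 i hi
    · intro h
      refine ⟨by simpa using h σ, fun i hi => ?_⟩
      have := h i
      rwa [Function.update_of_ne hi] at this
  rw [h1, Fintype.card_piFinset, ← Finset.mul_prod_erase _ _ (Finset.mem_univ σ),
    Function.update_self]
  congr 1
  rw [Finset.prod_congr rfl (g := fun _ => r), Finset.prod_const]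
  · simp
  · intro i hi
    rw [Function.update_of_ne (Finset.ne_of_mem_erase hi), hB]

/-- König's theorem for nearly regular digraphs. -/
theorem exists_matchings {V : Type*} [Fintype V] (H : V → V → Prop) {d e : ℝ} (hd : 0 ≤ d)
    (he : 1 ≤ e) (hout : ∀ u, ((Finset.univ.filter fun v => H u v).card : ℝ) ≤ d + e)
    (hin : ∀ v, ((Finset.univ.filter fun u => H u v).card : ℝ) ≤ d + e) :
    ∃ D : ℕ, d ≤ D ∧ D ≤ d + e ∧ ∃ F : Fin D → V → V → Prop,
      (∀ l u v, F l u v → H u v) ∧ (∀ l l' u v, F l u v → F l' u v → l = l') ∧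
      (∀ l u v v', F l u v → F l u v' → v = v') ∧
      (∀ l u u' v, F l u v → F l u' v → u = u') ∧
      (∀ u, d - e ≤ ((Finset.univ.filter fun v => H u v).card : ℝ) →
        ((Finset.univ.filter fun l => ∀ v, ¬ F l u v).card : ℝ) ≤ 2 * e) ∧
      (∀ v, d - e ≤ ((Finset.univ.filter fun u => H u v).card : ℝ) →
        ((Finset.univ.filter fun l => ∀ u, ¬ F l u v).card : ℝ) ≤ 2 * e) := by
  have hle : ((⌊d + e⌋₊ : ℕ) : ℝ) ≤ d + e := Nat.floor_le (by linarith)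
  have hge := Nat.lt_floor_add_one (d + e)
  obtain ⟨F, hFH, hu, hfun, hinj, ho, hi⟩ := exists_matching_decomposition H ⌊d + e⌋₊
    (fun u => Nat.le_floor (hout u)) (fun v => Nat.le_floor (hin v))
  refine ⟨⌊d + e⌋₊, by linarith, hle, F, hFH, ?_, hfun, hinj, ?_, ?_⟩
  · intro l l' u v h h'
    exact (hu u v (hFH _ _ _ h)).unique h h'
  · intro u h
    have h1 := ho u
    have h2 : ((Finset.univ.filter fun l => ∀ v, ¬ F l u v).card : ℝ) +
        ((Finset.univ.filter fun v => H u v).card : ℝ) = (⌊d + e⌋₊ : ℕ) := by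
      rw [← Nat.cast_add, h1]
    linarith
  · intro v h
    have h1 := hi v
    have h2 : ((Finset.univ.filter fun l => ∀ u, ¬ F l u v).card : ℝ) +
        ((Finset.univ.filter fun u => H u v).card : ℝ) = (⌊d + e⌋₊ : ℕ) := by
      rw [← Nat.cast_add, h1]
    linarith

/-- If most vertices are rarely unmatched, then few matchings leave many vertices unmatched. -/
theorem card_bad_mul_le {V ι : Type*} [Fintype V] [Fintype ι] (P : V → ι → Prop) (B : Finset V)
    (good : V → Prop) {e y : ℝ} (he : 0 ≤ e)
    (hP : ∀ v, good v → v ∉ B → ((Finset.univ.filter fun l => P v l).card : ℝ) ≤ e) :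
    ((Finset.univ.filter fun l =>
      y < ((Finset.univ.filter fun v => good v ∧ P v l).card : ℝ)).card : ℝ) * y ≤
      Fintype.card V * e + B.card * Fintype.card ι := by
  set bad := Finset.univ.filter fun l =>
      y < ((Finset.univ.filter fun v => good v ∧ P v l).card : ℝ) with hbad
  have h1 : (bad.card : ℝ) * y ≤
      ∑ l ∈ bad, ((Finset.univ.filter fun v => good v ∧ P v l).card : ℝ) := by
    rw [← nsmul_eq_mul, ← Finset.sum_const]
    exact Finset.sum_le_sum fun l hl => (Finset.mem_filter.1 hl).2.le
  have h2 : ∑ l ∈ bad, ((Finset.univ.filter fun v => good v ∧ P v l).card : ℝ) ≤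
      ∑ l, ((Finset.univ.filter fun v => good v ∧ P v l).card : ℝ) :=
    Finset.sum_le_sum_of_subset_of_nonneg (Finset.subset_univ _) fun _ _ _ => Nat.cast_nonneg _
  have h3 : ∑ l, ((Finset.univ.filter fun v => good v ∧ P v l).card : ℝ) =
      ∑ v, ((Finset.univ.filter fun l => good v ∧ P v l).card : ℝ) := by
    simp only [Finset.card_filter, Nat.cast_sum]
    exact Finset.sum_comm
  have h4 : ∀ v ∈ (Finset.univ : Finset V),
      ((Finset.univ.filter fun l => good v ∧ P v l).card : ℝ) ≤
      e + if v ∈ B then (Fintype.card ι : ℝ) else 0 := by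
    intro v _
    split_ifs with hv
    · have : ((Finset.univ.filter fun l => good v ∧ P v l).card : ℝ) ≤ Fintype.card ι :=
        Nat.cast_le.2 (Finset.card_le_univ _)
      linarith
    · rw [add_zero]
      by_cases hg : good v
      · simpa [hg] using hP v hg hv
      · simpa [hg] using he
  have h5 := Finset.sum_le_sum h4
  rw [Finset.sum_add_distrib, Finset.sum_const, nsmul_eq_mul, ← Finset.sum_filter,
    Finset.sum_const, nsmul_eq_mul, Finset.card_univ, Finset.filter_mem_eq_inter,
    Finset.univ_inter] at h5
  linarith

theorem IsBalanced.swap {V : Type*} [Fintype V] {s q p : ℕ} {G : V → V → Prop}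
    {a : V → Fin s → Fin q} {b : V → ZMod p} {α ω : ℝ} (h : IsBalanced G a b α ω) :
    IsBalanced (fun u v => G v u) a b α ω :=
  ⟨h.in_card, h.out_card, h.card⟩

theorem card_pi_filter_ne {s q : ℕ} (σ : Fin s) (A : Finset (Fin q)) (x : Fin s → Fin q) :
    ((Finset.univ.filter fun x' : Fin s → Fin q => x' σ ∈ A ∧ ∀ i ≠ σ, x' i ≠ x i).card : ℝ) / q ^ s =
      (((q : ℝ) - 1) / q) ^ (s - 1) * (A.card / q) := by
  have hs : s - 1 + 1 = s := Nat.sub_add_cancel (by have := σ.2; omega)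
  have hq : 1 ≤ q := by have := (x σ).2; omega
  have h := card_pi_filter σ A (fun i => {x i}ᶜ) (q - 1) (fun i => by
    simp [Finset.card_compl])
  have h' : (Finset.univ.filter fun x' : Fin s → Fin q => x' σ ∈ A ∧ ∀ i ≠ σ, x' i ≠ x i).card =
      A.card * (q - 1) ^ (s - 1) := by
    rw [← h]
    refine congrArg Finset.card (?_ : _ = _)
    ext; simp
  rw [h']
  push_cast [Nat.cast_sub hq]
  have hq0 : (q : ℝ) ≠ 0 := by positivity
  rw [div_pow]
  conv_lhs => rw [← hs, pow_succ, Nat.add_sub_cancel]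
  field_simp

theorem IsBalanced.out_card_ne {V : Type*} [Fintype V] {s q p : ℕ} {G : V → V → Prop}
    {a : V → Fin s → Fin q} {b : V → ZMod p} {α ω : ℝ} (h : IsBalanced G a b α ω)
    (v : V) (σ : Fin s) (A : Finset (Fin q)) (x : Fin s → Fin q) (Y : Finset (ZMod p)) :
    |((Finset.univ.filter fun u =>
        G v u ∧ (a u σ ∈ A ∧ ∀ i ≠ σ, a u i ≠ x i) ∧ b u ∈ Y).card : ℝ) -
      (((q : ℝ) - 1) / q) ^ (s - 1) * (A.card / q) * (Y.card / p) * (α * Fintype.card V)| ≤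
      ω * Fintype.card V := by
  have h1 := h.out_card v
    (Finset.univ.filter fun x' : Fin s → Fin q => x' σ ∈ A ∧ ∀ i ≠ σ, x' i ≠ x i) Y
  rw [mul_div_mul_comm, card_pi_filter_ne] at h1
  convert h1 using 6
  simp

theorem IsBalanced.card_group {V : Type*} [Fintype V] {s q p : ℕ} [NeZero p] {G : V → V → Prop}
    {a : V → Fin s → Fin q} {b : V → ZMod p} {α ω : ℝ} (h : IsBalanced G a b α ω)
    (σ : Fin s) (c : Fin q) :
    |((Finset.univ.filter fun u => a u σ = c).card : ℝ) - Fintype.card V / q| ≤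
      ω * Fintype.card V := by
  have hs : s - 1 + 1 = s := Nat.sub_add_cancel (by have := σ.2; omega)
  have hq : 0 < q := by have := c.2; omega
  have h1 := h.card (Finset.univ.filter fun x : Fin s → Fin q =>
    x σ ∈ ({c} : Finset (Fin q)) ∧ ∀ i ≠ σ, x i ∈ (Finset.univ : Finset (Fin q))) Finset.univ
  have h2 := card_pi_filter σ {c} (fun _ => (Finset.univ : Finset (Fin q))) q (by simp)
  rw [h2, Finset.card_univ, ZMod.card, Finset.card_singleton, one_mul] at h1
  have hp : (p : ℝ) ≠ 0 := Nat.cast_ne_zero.2 (NeZero.ne p)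
  have hq0 : (q : ℝ) ≠ 0 := by positivity
  have h3 : (((q ^ (s - 1) : ℕ) : ℝ) * p / (q ^ s * p)) * Fintype.card V =
      (Fintype.card V : ℝ) / q := by
    rw [mul_div_mul_right _ _ hp]
    conv_lhs => rw [← hs, pow_succ, Nat.add_sub_cancel]
    push_cast
    field_simp
  rw [h3] at h1
  convert h1 using 5
  simp

theorem IsBalanced.card_label_le {V : Type*} [Fintype V] {s q p : ℕ} {G : V → V → Prop}
    {a : V → Fin s → Fin q} {b : V → ZMod p} {α ω : ℝ} (h : IsBalanced G a b α ω)
    (hq : 0 < q) (y : ZMod p) :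
    ((Finset.univ.filter fun u => b u = y).card : ℝ) ≤
      Fintype.card V / p + ω * Fintype.card V := by
  have h1 := h.card Finset.univ {y}
  rw [Finset.card_univ, Finset.card_singleton, Fintype.card_pi] at h1
  simp only [Fintype.card_fin, Finset.prod_const, Finset.card_univ, Finset.mem_univ, true_and,
    Finset.mem_singleton, Nat.cast_pow, Nat.cast_one, mul_one] at h1
  have hq0 : (q : ℝ) ^ s ≠ 0 := by positivity
  rw [div_mul_eq_div_div, div_self hq0, one_div, inv_mul_eq_div] at h1
  linarith [(abs_le.1 h1).2]

/-- The edges outside `{v | a v σ = c}` along which the label `b` increases by `d`, except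
for those starting at label `d`. -/
def LinkEdge {V : Type*} {s q p : ℕ} (G : V → V → Prop) (a : V → Fin s → Fin q) (b : V → ZMod p)
    (σ : Fin s) (c : Fin q) (d : ZMod p) (u v : V) : Prop :=
  G u v ∧ (∀ i, a u i ≠ a v i) ∧ a u σ ≠ c ∧ a v σ ≠ c ∧ b v = b u + d ∧ b u ≠ d

/-- The edges reserved for joining up paths through `{v | a v σ = c}`. -/
def ReservedEdge {V : Type*} {s q p : ℕ} (G : V → V → Prop) (a : V → Fin s → Fin q)
    (b : V → ZMod p) (σ : Fin s) (c : Fin q) (Dp Dm : Finset (ZMod p)) (u v : V) : Prop :=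
  G u v ∧ ((a u σ = c ∧ a v σ = c ∧ ∀ i ≠ σ, a u i ≠ a v i) ∨
    (∀ i, a u i ≠ a v i) ∧ ((a v σ = c ∧ b v - b u ∈ Dp) ∨ (a u σ = c ∧ b v - b u ∈ Dm)))

theorem IsBalanced.linkEdge_out {V : Type*} [Fintype V] {s q p : ℕ} {G : V → V → Prop}
    {a : V → Fin s → Fin q} {b : V → ZMod p} {α ω : ℝ} (h : IsBalanced G a b α ω)
    (σ : Fin s) (c : Fin q) (d : ZMod p) (u : V) (hu : a u σ ≠ c) :
    |((Finset.univ.filter fun v =>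
        G u v ∧ (∀ i, a u i ≠ a v i) ∧ a v σ ≠ c ∧ b v = b u + d).card : ℝ) -
      (((q : ℝ) - 1) / q) ^ (s - 1) * ((q - 2) / q) * α * Fintype.card V / p| ≤
      ω * Fintype.card V := by
  have h1 := h.out_card_ne u σ ({c, a u σ}ᶜ) (a u) {b u + d}
  have hq2 : 2 ≤ q := by
    have h2 := Finset.card_le_univ ({c, a u σ} : Finset (Fin q))
    rw [Finset.card_pair (Ne.symm hu), Fintype.card_fin] at h2
    exact h2
  have hcard : (({c, a u σ}ᶜ : Finset (Fin q)).card : ℝ) = q - 2 := by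
    rw [Finset.card_compl, Finset.card_pair (Ne.symm hu), Fintype.card_fin]
    push_cast [Nat.cast_sub hq2]
    ring
  rw [hcard, Finset.card_singleton, Nat.cast_one] at h1
  have h2 : (((q : ℝ) - 1) / q) ^ (s - 1) * ((q - 2) / q) * (1 / p) * (α * Fintype.card V) =
      (((q : ℝ) - 1) / q) ^ (s - 1) * ((q - 2) / q) * α * Fintype.card V / p := by ring
  rw [h2] at h1
  convert h1 using 5
  ext v
  simp only [Finset.mem_compl, Finset.mem_insert, Finset.mem_singleton, not_or]
  simp only [Finset.mem_filter, Finset.mem_univ, true_and]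
  constructor
  · rintro ⟨h1, h2, h3, h4⟩
    exact ⟨h1, ⟨⟨h3, (h2 σ).symm⟩, fun i _ => (h2 i).symm⟩, h4⟩
  · rintro ⟨h1, ⟨⟨h3, h5⟩, h2⟩, h4⟩
    refine ⟨h1, fun i => ?_, h3, h4⟩
    by_cases hi : i = σ
    · subst hi; exact fun h => h5 h.symm
    · exact (h2 i hi).symm

theorem LinkEdge.rank_lt {V : Type*} {s q p : ℕ} [Fact p.Prime] {G : V → V → Prop}
    {a : V → Fin s → Fin q} {b : V → ZMod p} {σ : Fin s} {c : Fin q} {d : ZMod p}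
    {u v : V} (h : LinkEdge G a b σ c d u v) (hd : d ≠ 0) :
    (b u * d⁻¹ - 2).val < (b v * d⁻¹ - 2).val := by
  obtain ⟨-, -, -, -, hv, hu⟩ := h
  have h1 : b v * d⁻¹ - 2 = (b u * d⁻¹ - 2) + 1 := by rw [hv, add_mul, mul_inv_cancel₀ hd]; ring
  have h2 : (b u * d⁻¹ - 2) + 1 ≠ 0 := fun h => hu (by
    have h3 : b u * d⁻¹ = 1 := by linear_combination h
    rwa [← div_eq_mul_inv, div_eq_one_iff_eq hd] at h3)
  have : Fact (1 < p) := ⟨(Fact.out : p.Prime).one_lt⟩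
  rw [h1]
  by_contra hlt
  have h3 := ZMod.val_lt (b u * d⁻¹ - 2)
  rcases Nat.lt_or_ge ((b u * d⁻¹ - 2).val + (1 : ZMod p).val) p with h4 | h4
  · rw [ZMod.val_add_of_lt h4, ZMod.val_one] at hlt
    omega
  · rw [ZMod.val_one] at h4
    apply h2
    rw [← ZMod.val_eq_zero, ZMod.val_add, ZMod.val_one, show (b u * d⁻¹ - 2).val + 1 = p by omega,
      Nat.mod_self]

theorem IsBalanced.exists_linkMatchings {V : Type*} [Fintype V] {s q p : ℕ}
    {G : V → V → Prop} {a : V → Fin s → Fin q} {b : V → ZMod p} {α ω : ℝ}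
    (h : IsBalanced G a b α ω) (hω : 1 ≤ ω * Fintype.card V) (hq : 2 ≤ q) (hα : 0 ≤ α)
    (σ : Fin s) (c : Fin q) (d : ZMod p) {d₀ : ℝ}
    (hd₀ : d₀ = (((q : ℝ) - 1) / q) ^ (s - 1) * ((q - 2) / q) * α * Fintype.card V / p) :
    ∃ D : ℕ, d₀ ≤ D ∧ D ≤ d₀ + ω * Fintype.card V ∧ ∃ F : Fin D → V → V → Prop,
      (∀ l u v, F l u v → LinkEdge G a b σ c d u v) ∧
      (∀ l l' u v, F l u v → F l' u v → l = l') ∧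
      (∀ l u v v', F l u v → F l u v' → v = v') ∧
      (∀ l u u' v, F l u v → F l u' v → u = u') ∧
      (∀ u, a u σ ≠ c → b u ≠ d →
        ((Finset.univ.filter fun l => ∀ v, ¬ F l u v).card : ℝ) ≤ 2 * (ω * Fintype.card V)) ∧
      (∀ v, a v σ ≠ c → b v ≠ d + d →
        ((Finset.univ.filter fun l => ∀ u, ¬ F l u v).card : ℝ) ≤ 2 * (ω * Fintype.card V)) := by
  have hq' : (2 : ℝ) ≤ q := by exact_mod_cast hq
  have hd0 : 0 ≤ d₀ := by
    rw [hd₀]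
    have : (0 : ℝ) ≤ q - 1 := by linarith
    have : (0 : ℝ) ≤ q - 2 := by linarith
    positivity
  have hout : ∀ u, a u σ ≠ c → b u ≠ d →
      |((Finset.univ.filter fun v => LinkEdge G a b σ c d u v).card : ℝ) - d₀| ≤
        ω * Fintype.card V := by
    intro u hu hb
    have h1 := h.linkEdge_out σ c d u hu
    rw [← hd₀] at h1
    convert h1 using 5
    ext v
    simp only [Finset.mem_filter, Finset.mem_univ, true_and]
    unfold LinkEdge
    tauto
  have hin : ∀ v, a v σ ≠ c → b v ≠ d + d →
      |((Finset.univ.filter fun u => LinkEdge G a b σ c d u v).card : ℝ) - d₀| ≤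
        ω * Fintype.card V := by
    intro v hv hb
    have h1 := h.swap.linkEdge_out σ c (-d) v hv
    rw [← hd₀] at h1
    convert h1 using 5
    ext u
    simp only [Finset.mem_filter, Finset.mem_univ, true_and]
    unfold LinkEdge
    constructor
    · rintro ⟨h1, h2, h3, h4, h5, h6⟩
      exact ⟨h1, fun i => (h2 i).symm, h3, by rw [h5]; ring⟩
    · rintro ⟨h1, h2, h3, h5⟩
      refine ⟨h1, fun i => (h2 i).symm, h3, hv, by rw [h5]; ring, fun h6 => hb ?_⟩
      rw [h6] at h5
      linear_combination -h5
  have hout' : ∀ u, ((Finset.univ.filter fun v => LinkEdge G a b σ c d u v).card : ℝ) ≤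
      d₀ + ω * Fintype.card V := by
    intro u
    by_cases hu : a u σ ≠ c ∧ b u ≠ d
    · linarith [(abs_le.1 (hout u hu.1 hu.2)).2]
    · rw [Finset.filter_false_of_mem (fun v _ hv => hu ⟨hv.2.2.1, hv.2.2.2.2.2⟩)]
      simp only [Finset.card_empty, Nat.cast_zero]
      linarith
  have hin' : ∀ v, ((Finset.univ.filter fun u => LinkEdge G a b σ c d u v).card : ℝ) ≤
      d₀ + ω * Fintype.card V := by
    intro v
    by_cases hv : a v σ ≠ c ∧ b v ≠ d + d
    · linarith [(abs_le.1 (hin v hv.1 hv.2)).2]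
    · rw [Finset.filter_false_of_mem (fun u _ hu => hv ⟨hu.2.2.2.1, fun h0 => hu.2.2.2.2.2
        (by linear_combination h0 - hu.2.2.2.2.1)⟩)]
      simp only [Finset.card_empty, Nat.cast_zero]
      linarith
  obtain ⟨D, h1, h2, F, h3, h4, h5, h6, h7, h8⟩ := exists_matchings _ hd0 hω hout' hin'
  exact ⟨D, h1, h2, F, h3, h4, h5, h6,
    fun u hu hb => h7 u (by linarith [(abs_le.1 (hout u hu hb)).1]),
    fun v hv hb => h8 v (by linarith [(abs_le.1 (hin v hv hb)).1])⟩

theorem IsBalanced.le_card_inside {V : Type*} [Fintype V] {s q p : ℕ} [NeZero p]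
    {G : V → V → Prop} {a : V → Fin s → Fin q} {b : V → ZMod p} {α ω : ℝ}
    (h : IsBalanced G a b α ω) (σ : Fin s) (c : Fin q) (w : V) :
    (((q : ℝ) - 1) / q) ^ (s - 1) * α * (Fintype.card V / q) - ω * Fintype.card V ≤
      (((Finset.univ.filter fun v => a v σ = c).filter fun u =>
        G w u ∧ ∀ i ≠ σ, a u i ≠ a w i).card : ℝ) := by
  have h1 := h.out_card_ne w σ {c} (a w) Finset.univ
  have hp : (p : ℝ) ≠ 0 := Nat.cast_ne_zero.2 (NeZero.ne p)
  rw [Finset.card_singleton, Finset.card_univ, ZMod.card, div_self hp, Nat.cast_one] at h1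
  have h2 : (((q : ℝ) - 1) / q) ^ (s - 1) * (1 / q) * 1 * (α * Fintype.card V) =
    (((q : ℝ) - 1) / q) ^ (s - 1) * α * (Fintype.card V / q) := by ring
  rw [h2] at h1
  have h3 := (abs_le.1 h1).1
  have h4 : ((Finset.univ.filter fun u =>
      G w u ∧ (a u σ ∈ ({c} : Finset (Fin q)) ∧ ∀ i ≠ σ, a u i ≠ a w i) ∧
        b u ∈ (Finset.univ : Finset (ZMod p))).card : ℝ) =
      (((Finset.univ.filter fun v => a v σ = c).filter fun u =>
        G w u ∧ ∀ i ≠ σ, a u i ≠ a w i).card : ℝ) := by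
    rw [Finset.filter_filter]
    refine congrArg (fun S : Finset V => (S.card : ℝ)) ?_
    ext u
    simp only [Finset.mem_filter, Finset.mem_univ, true_and, Finset.mem_singleton]
    tauto
  linarith

theorem IsBalanced.le_card_connect {V : Type*} [Fintype V] {s q p : ℕ}
    {G : V → V → Prop} {a : V → Fin s → Fin q} {b : V → ZMod p} {α ω : ℝ}
    (h : IsBalanced G a b α ω) (σ : Fin s) (c : Fin q) (v : V) (hv : a v σ ≠ c)
    (Y : Finset (ZMod p)) :
    (((q : ℝ) - 1) / q) ^ (s - 1) * α * (Y.card / p) * (Fintype.card V / q) -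
      ω * Fintype.card V ≤
      (((Finset.univ.filter fun w => a w σ = c).filter fun w =>
        G v w ∧ (∀ i, a w i ≠ a v i) ∧ b w ∈ Y).card : ℝ) := by
  have h1 := h.out_card_ne v σ {c} (a v) Y
  rw [Finset.card_singleton, Nat.cast_one] at h1
  have h2 : (((q : ℝ) - 1) / q) ^ (s - 1) * (1 / q) * (Y.card / p) * (α * Fintype.card V) =
    (((q : ℝ) - 1) / q) ^ (s - 1) * α * (Y.card / p) * (Fintype.card V / q) := by ring
  rw [h2] at h1
  have h3 := (abs_le.1 h1).1
  have h4 : ((Finset.univ.filter fun u =>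
      G v u ∧ (a u σ ∈ ({c} : Finset (Fin q)) ∧ ∀ i ≠ σ, a u i ≠ a v i) ∧ b u ∈ Y).card : ℝ) =
      (((Finset.univ.filter fun w => a w σ = c).filter fun w =>
        G v w ∧ (∀ i, a w i ≠ a v i) ∧ b w ∈ Y).card : ℝ) := by
    rw [Finset.filter_filter]
    refine congrArg (fun S : Finset V => (S.card : ℝ)) ?_
    ext u
    simp only [Finset.mem_filter, Finset.mem_univ, true_and, Finset.mem_singleton]
    constructor
    · rintro ⟨h1, ⟨h2, h3⟩, h4⟩
      refine ⟨h2, h1, fun i => ?_, h4⟩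
      by_cases hi : i = σ
      · subst hi; rw [h2]; exact hv.symm
      · exact h3 i hi
    · rintro ⟨h2, h1, h3, h4⟩
      exact ⟨h1, ⟨h2, fun i _ => h3 i⟩, h4⟩
  linarith

theorem card_bad_le {γ β ε z y n p N d₀ Δ B w bad : ℝ} (hγ : 0 < γ) (hβ1 : β ≤ 1) (hε : 0 < ε)
    (hzε : 1000 * z ≤ γ * β * ε) (hΔ : 0 ≤ Δ) (hd₀ : d₀ ≤ Δ) (hnd : n / p ≤ 4 * d₀)
    (hnp : n / p ≤ z * y) (hNz : N ≤ z * y) (hNp : N * p ≤ z * y) (hp : 0 < p) (hN : 0 ≤ N)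
    (hy : 0 < y) (hw : y / 2 ≤ w) (hB : B ≤ n / p + N)
    (hbad : bad * (ε * w) ≤ n * (2 * N) + B * Δ) : bad ≤ γ / 8 * Δ := by
  have h1 : n * N ≤ 4 * Δ * (z * y) := by
    calc n * N = n / p * (N * p) := by field_simp
      _ ≤ 4 * Δ * (N * p) := mul_le_mul_of_nonneg_right (by linarith) (by positivity)
      _ ≤ 4 * Δ * (z * y) := mul_le_mul_of_nonneg_left hNp (by positivity)
  have h2 : B * Δ ≤ 2 * (z * y) * Δ := mul_le_mul_of_nonneg_right (by linarith) hΔ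
  have h3 : 1000 * z ≤ γ * ε := by
    refine hzε.trans (mul_le_mul_of_nonneg_right ?_ hε.le)
    exact mul_le_of_le_one_right hγ.le hβ1
  have h4 : 1000 * (z * y * Δ) ≤ γ * ε * y * Δ := by
    have := mul_le_mul_of_nonneg_right h3 (by positivity : 0 ≤ y * Δ)
    linarith
  have h5 : γ * ε * y * Δ ≤ γ * Δ * ε * (2 * w) := by
    have := mul_le_mul_of_nonneg_left hw (by positivity : 0 ≤ 2 * (γ * Δ * ε))
    linarith
  have hw0 : 0 < w := by linarith
  refine le_of_mul_le_mul_right ?_ (by positivity : 0 < ε * w)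
  have h6 : 0 ≤ γ * Δ * ε * w := by positivity
  linarith

theorem card_filter_sigma_le {D : Type*} [Fintype D] {Δ : D → ℕ} (good : ∀ d, Fin (Δ d) → Prop)
    (P : ∀ d, Fin (Δ d) → Prop) :
    (Finset.univ.filter fun i : Σ d, {l : Fin (Δ d) // good d l} => P i.1 i.2.1).card ≤
      ∑ d, (Finset.univ.filter fun l => P d l).card := by
  rw [Finset.card_filter, Fintype.sum_sigma]
  refine Finset.sum_le_sum fun d _ => ?_
  rw [← Finset.card_filter]
  refine Finset.card_le_card_of_injOn Subtype.val (fun l hl => ?_)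
    (Set.injOn_of_injective Subtype.val_injective)
  simpa using hl

/-- The edges available to the Hamilton cycles of the group with reserved set
`{v | a v σ = c}`. -/
def GroupEdge {V : Type*} {s q p : ℕ} (G : V → V → Prop) (a : V → Fin s → Fin q)
    (b : V → ZMod p) (σ : Fin s) (c : Fin q) (D₀ Dp Dm : Finset (ZMod p)) (u v : V) : Prop :=
  ReservedEdge G a b σ c Dp Dm u v ∨ ∃ d ∈ D₀, LinkEdge G a b σ c d u v

theorem link_degree_bounds {γ α lam q p n : ℝ} (hγ : 0 < γ) (hγ1 : γ ≤ 1 / 8)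
    (hα : 3 / 8 + γ ≤ α) (hα1 : α ≤ 1 / 2) (hlam : 1 - γ / 8 ≤ lam) (hlam1 : lam ≤ 1)
    (hq : 128 ≤ q) (hp : 0 < p) (hn : 0 ≤ n) :
    lam * ((q - 2) / q) * α * n / p ≤ n / p / 2 ∧
      n / p ≤ 4 * (lam * ((q - 2) / q) * α * n / p) := by
  have hq1 : (63 : ℝ) / 64 ≤ (q - 2) / q := by
    rw [div_le_div_iff₀ (by norm_num) (by linarith)]; linarith
  have hq2 : (q - 2) / q ≤ 1 := by
    rw [div_le_one (by linarith)]; linarith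
  have h0 : lam * ((q - 2) / q) * α * n / p = lam * ((q - 2) / q) * α * (n / p) := by ring
  have hnp : 0 ≤ n / p := by positivity
  have h1 : lam * ((q - 2) / q) * α ≤ 1 / 2 := by
    calc lam * ((q - 2) / q) * α ≤ 1 * 1 * (1 / 2) := by
          have : 0 ≤ (q - 2) / q := by linarith
          gcongr
          linarith
      _ = 1 / 2 := by norm_num
  have h2 : 1 / 4 ≤ lam * ((q - 2) / q) * α := by
    calc (1 / 4 : ℝ) ≤ (63 / 64) * (63 / 64) * (3 / 8) := by norm_num
      _ ≤ lam * ((q - 2) / q) * α := by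
          have : 0 ≤ lam * ((q - 2) / q) := mul_nonneg (by linarith) (by linarith)
          gcongr <;> linarith
  rw [h0]
  constructor
  · linarith [mul_le_mul_of_nonneg_right h1 hnp]
  · linarith [mul_le_mul_of_nonneg_right h2 hnp]

theorem reserved_degree_bounds {γ β α lam L r y w N z : ℝ} (hγ : 0 < γ) (hγ1 : γ ≤ 1 / 8)
    (hα : 3 / 8 + γ ≤ α) (hα1 : α ≤ 1 / 2) (hlam : 1 - γ / 8 ≤ lam)
    (hL : 0 < L) (hβ : β = 1 / (32 * L)) (hr : 1 / (2 * L) ≤ r) (hy : 0 < y)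
    (hzγ : 1000 * (z * y) ≤ γ * y) (hzβ : 1000 * (z * y) ≤ β * y) (hNz : N ≤ z * y)
    (hw : w ≤ y + N) :
    (3 / 8 + γ / 2) * w ≤ lam * α * y - N ∧ β * w ≤ lam * α * r * y - N := by
  have h1 : 3 / 8 + 15 / 16 * γ ≤ lam * α := by
    have := mul_le_mul hlam (le_refl α) (by linarith) (by linarith)
    have h2 : γ * α ≤ γ * (1 / 2) := mul_le_mul_of_nonneg_left hα1 hγ.le
    linarith
  have h2 : (3 / 8 + 15 / 16 * γ) * y ≤ lam * α * y := mul_le_mul_of_nonneg_right h1 hy.le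
  have hβ0 : 0 < β := by rw [hβ]; positivity
  have hγy : 0 < γ * y := mul_pos hγ hy
  have hγy1 : γ * y ≤ y / 8 := by
    have := mul_le_mul_of_nonneg_right hγ1 hy.le
    linarith
  have hβr : 16 * β ≤ r := by
    refine le_trans (le_of_eq ?_) hr
    rw [hβ]; field_simp; norm_num
  constructor
  · have h3 : (3 / 8 + γ / 2) * w ≤ (3 / 8 + γ / 2) * (y + γ * y / 1000) :=
      mul_le_mul_of_nonneg_left (by linarith) (by linarith)
    have h4 : γ * (γ * y) ≤ 1 / 8 * (γ * y) := mul_le_mul_of_nonneg_right hγ1 hγy.le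
    linarith
  · have h3 : β * w ≤ β * (2 * y) := mul_le_mul_of_nonneg_left (by linarith) hβ0.le
    have h4 : 3 / 8 * (16 * β) ≤ lam * α * r := by
      gcongr
      · linarith
      · linarith
    have h5 := mul_le_mul_of_nonneg_right h4 hy.le
    have h6 : 0 < β * y := mul_pos hβ0 hy
    linarith

theorem IsBalanced.exists_group_isCycle {γ β : ℝ} (hγ : 0 < γ) (hγ1 : γ ≤ 1 / 8) (hβ : 0 < β)
    (hβ1 : β ≤ 1) :
    ∃ ε : ℝ, 0 < ε ∧ ∃ m₀ : ℕ, ∀ (V : Type) [Fintype V] (s q p t L : ℕ) [Fact p.Prime]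
      (G : V → V → Prop) (a : V → Fin s → Fin q) (b : V → ZMod p) (α ω z d₀ : ℝ),
      IsBalanced G a b α ω → (∀ u v, G u v → ¬ G v u) → 3 / 8 + γ ≤ α → α ≤ 1 / 2 →
      1 - γ / 8 ≤ (((q : ℝ) - 1) / q) ^ (s - 1) → 16 ≤ γ * q → 8 * q ≤ γ * L →
      β = 1 / (32 * L) → t * L + 1 = p → 0 < z → 1000 * z ≤ γ * β → 1000 * z ≤ γ * β * ε →
      ω * Fintype.card V * p ≤ z * (Fintype.card V / q) →
      Fintype.card V / p ≤ z * (Fintype.card V / q) → 1 ≤ ω * Fintype.card V →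
      2 * m₀ ≤ (Fintype.card V : ℝ) / q →
      d₀ = (((q : ℝ) - 1) / q) ^ (s - 1) * ((q - 2) / q) * α * Fintype.card V / p →
      ∀ (σ : Fin s) (c : Fin q) (D₀ Dp Dm : Finset (ZMod p)), 0 ∉ D₀ →
      D₀.card = t → Dp.card = t → Dm.card = t →
      ∃ (ι : Type) (_ : Fintype ι), t * ((1 - γ / 8) * d₀) ≤ Fintype.card ι ∧
        ∃ τ : ι → Equiv.Perm V, (∀ i, (τ i).IsCycle ∧
          ∀ v, τ i v ≠ v ∧ GroupEdge G a b σ c D₀ Dp Dm v (τ i v)) ∧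
          ∀ i j, i ≠ j → ∀ v, τ i v ≠ τ j v := by
  obtain ⟨ε, hε, m₀, hmain⟩ := exists_edge_disjoint_isCycle (half_pos hγ) hβ
  refine ⟨ε, hε, m₀, ?_⟩
  intro V _ s q p t L _ G a b α ω z d₀ hbal hG hα hα1 hlam hq hL hβL htL hz hzβ hzε hωp hnp hωn
    hm₀ hd₀ σ c D₀ Dp Dm h0 hD₀ hDp hDm
  set n : ℝ := (Fintype.card V : ℝ) with hn
  obtain ⟨lam, hlamdef⟩ : ∃ x, x = (((q : ℝ) - 1) / q) ^ (s - 1) := ⟨_, rfl⟩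
  obtain ⟨y, hy⟩ : ∃ x, x = n / q := ⟨_, rfl⟩
  obtain ⟨N, hN⟩ : ∃ x, x = ω * n := ⟨_, rfl⟩
  obtain ⟨W, hW⟩ : ∃ W : Finset V, W = Finset.univ.filter fun v => a v σ = c := ⟨_, rfl⟩
  have hmemW : ∀ v, v ∈ W ↔ a v σ = c := fun v => by rw [hW]; simp
  have hp0 : (0 : ℝ) < p := Nat.cast_pos.2 (Fact.out : p.Prime).pos
  have hp1 : (1 : ℝ) ≤ p := Nat.one_le_cast.2 (Fact.out : p.Prime).one_lt.le
  have hp2 : (2 : ℝ) ≤ p := by exact_mod_cast (Fact.out : p.Prime).two_le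
  have hq128 : (128 : ℝ) ≤ q := by
    have : γ * q ≤ 1 / 8 * q := mul_le_mul_of_nonneg_right hγ1 (Nat.cast_nonneg _)
    linarith
  have hq2 : 2 ≤ q := by
    have : (2 : ℝ) ≤ q := by linarith
    exact_mod_cast this
  have hwabs := hbal.card_group σ c
  rw [← hW, ← hn, ← hy, ← hN] at hwabs
  rw [← hlamdef] at hlam hd₀
  rw [← hy] at hωp hnp hm₀
  rw [← hN] at hωn hωp
  have hlam1 : lam ≤ 1 := by
    rw [hlamdef]
    apply pow_le_one₀
    · apply div_nonneg <;> linarith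
    · rw [div_le_one (by linarith)]; linarith
  have hn0 : 0 ≤ n := Nat.cast_nonneg _
  have hnpos : 0 < n := hn0.lt_of_ne fun h => by
    rw [hN, ← h, mul_zero] at hωn
    exact absurd hωn (by norm_num)
  have hypos : 0 < y := by rw [hy]; positivity
  have hzy : 0 < z * y := by positivity
  have hNzy : N ≤ z * y := (le_mul_of_one_le_right (by linarith) hp1).trans hωp
  have hzγ : 1000 * z ≤ γ := hzβ.trans (mul_le_of_le_one_right hγ.le hβ1)
  have hzβ' : 1000 * z ≤ β := hzβ.trans (mul_le_of_le_one_left hβ.le (by linarith))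
  have hzyγ : 1000 * (z * y) ≤ γ * y := by
    rw [← mul_assoc]; exact mul_le_mul_of_nonneg_right hzγ hypos.le
  have hzyβ : 1000 * (z * y) ≤ β * y := by
    rw [← mul_assoc]; exact mul_le_mul_of_nonneg_right hzβ' hypos.le
  have hzy1 : 1000 * (z * y) ≤ y :=
    hzyβ.trans (mul_le_of_le_one_left hypos.le hβ1)
  have hw1 : y - N ≤ W.card := by linarith [(abs_le.1 hwabs).1]
  have hw2 : (W.card : ℝ) ≤ y + N := by linarith [(abs_le.1 hwabs).2]
  have hwhalf : y / 2 ≤ W.card := by linarith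
  have hwpos : (0 : ℝ) < W.card := by linarith
  have hLpos : (0 : ℝ) < L := pos_of_mul_pos_right (lt_of_lt_of_le (by linarith) hL) hγ.le
  have htLR : (t : ℝ) * L + 1 = p := by exact_mod_cast htL
  have ht1 : (t : ℝ) / p ≤ 1 / L := by
    rw [div_le_div_iff₀ hp0 hLpos]; linarith
  have ht2 : 1 / (2 * L) ≤ (t : ℝ) / p := by
    rw [div_le_div_iff₀ (by positivity) hp0]; linarith
  have hL2 : (2 : ℝ) ≤ L := by
    have : γ * L ≤ 1 / 8 * L := mul_le_mul_of_nonneg_right hγ1 hLpos.le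
    linarith
  have htp : (t : ℝ) ≤ p := by
    have : (t : ℝ) ≤ t * L := le_mul_of_one_le_right (Nat.cast_nonneg _) (by linarith)
    linarith
  have htN : (t : ℝ) * N ≤ z * y :=
    (mul_comm _ _).le.trans ((mul_le_mul_of_nonneg_left htp (by linarith)).trans hωp)
  obtain ⟨hd₀le, hd₀ge⟩ := link_degree_bounds hγ hγ1 hα hα1 hlam hlam1 hq128 hp0 hn0
  rw [← hd₀] at hd₀le hd₀ge
  have hnp0 : 0 ≤ n / p := by positivity
  obtain ⟨hBnum, hCnum⟩ := reserved_degree_bounds hγ hγ1 hα hα1 hlam hLpos hβL ht2 hypos hzyγ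
    hzyβ hNzy hw2
  rw [hy] at hBnum hCnum
  have hmatch := fun d => hbal.exists_linkMatchings (hN ▸ hωn) hq2 (by linarith) σ c d
    (d₀ := d₀) (by rw [hd₀, hlamdef])
  rw [← hn, ← hN] at hmatch
  choose Δ hΔ1 hΔ2 F hFlink hFdisj hFfun hFinj hFout hFin using hmatch
  have hΔzy : ∀ d, (Δ d : ℝ) ≤ 2 * (z * y) := fun d => by
    linarith [hΔ2 d]
  obtain ⟨good, hgood⟩ : ∃ good : ∀ d : {d // d ∈ D₀}, Fin (Δ d) → Prop, ∀ d l, good d l ↔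
      ((Finset.univ.filter fun v => v ∉ W ∧ ∀ u, ¬ F d l v u).card : ℝ) ≤ ε * W.card :=
    ⟨_, fun _ _ => Iff.rfl⟩
  have hbad : ∀ d : {d // d ∈ D₀},
      (1 - γ / 8) * d₀ ≤ ((Finset.univ.filter fun l => good d l).card : ℝ) := by
    intro d
    obtain ⟨P, hP⟩ : ∃ P : V → Fin (Δ d) → Prop, ∀ v l, P v l ↔ ∀ u, ¬ F d l v u :=
      ⟨_, fun _ _ => Iff.rfl⟩
    obtain ⟨out, hout⟩ : ∃ out : V → Prop, ∀ v, out v ↔ v ∉ W := ⟨_, fun _ => Iff.rfl⟩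
    have h1 := card_bad_mul_le P
      (Finset.univ.filter fun v => b v = (d : ZMod p)) out (e := 2 * N)
      (y := ε * W.card) (by linarith) (fun v hv hb => by
        simp only [hP]
        convert hFout d v (mt (hmemW v).2 ((hout v).1 hv)) (fun h => hb (by simpa using h)))
    have h2 : (Finset.univ.filter fun l : Fin (Δ d) => ε * W.card <
        ((Finset.univ.filter fun v => out v ∧ P v l).card : ℝ)) =
        Finset.univ.filter fun l => ¬ good d l := by
      ext l
      simp only [Finset.mem_filter, Finset.mem_univ, true_and, hgood, not_le, hP, hout]
    rw [h2, Fintype.card_fin, ← hn] at h1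
    have h3 : ((Finset.univ.filter fun l => good d l).card : ℝ) +
        ((Finset.univ.filter fun l => ¬ good d l).card : ℝ) = Δ d := by
      rw [← Nat.cast_add, Finset.card_filter_add_card_filter_not, Finset.card_univ,
        Fintype.card_fin]
    have h4 := hbal.card_label_le (by omega) (d : ZMod p)
    rw [← hn, ← hN] at h4
    have h5 := card_bad_le hγ hβ1 hε hzε (Nat.cast_nonneg _) (hΔ1 d) hd₀ge hnp hNzy hωp hp0 (by linarith)
      hypos hwhalf h4 h1
    have h6 := mul_le_mul_of_nonneg_left (hΔ1 d) (by linarith : 0 ≤ 1 - γ / 8)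
    linarith
  have hcard1 : (Fintype.card (Σ d : {d // d ∈ D₀}, {l // good d l}) : ℝ) =
      ∑ d : {d // d ∈ D₀}, ((Finset.univ.filter fun l => good d l).card : ℝ) := by
    rw [Fintype.card_sigma, Nat.cast_sum]
    refine Finset.sum_congr rfl fun d _ => ?_
    rw [Fintype.card_subtype]
  have hload : ∀ (P : ∀ d : {d // d ∈ D₀}, Fin (Δ d) → Prop) (g : ZMod p → ZMod p) (x : ZMod p),
      Function.Injective g →
      (∀ d, x ≠ g d.1 → ((Finset.univ.filter fun l => P d l).card : ℝ) ≤ 2 * N) →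
      ((Finset.univ.filter fun i : Σ d : {d // d ∈ D₀}, {l // good d l} => P i.1 i.2.1).card : ℝ) ≤
        β / 2 * W.card := by
    intro P g x hg hP
    have h1 : ∀ d ∈ (Finset.univ : Finset {d // d ∈ D₀}),
        ((Finset.univ.filter fun l => P d l).card : ℝ) ≤
        2 * N + if x = g d.1 then 2 * (z * y) else 0 := by
      intro d _
      split_ifs with hx
      · have : ((Finset.univ.filter fun l => P d l).card : ℝ) ≤ Δ d := by
          refine Nat.cast_le.2 ((Finset.card_le_univ _).trans ?_)
          rw [Fintype.card_fin]
        linarith [hΔzy d]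
      · linarith [hP d hx]
    have h2 := (Nat.cast_le (α := ℝ)).2 (card_filter_sigma_le good P)
    rw [Nat.cast_sum] at h2
    have h3 := h2.trans (Finset.sum_le_sum h1)
    have h4 : ((Finset.univ.filter fun d : {d // d ∈ D₀} => x = g d.1).card : ℝ) ≤ 1 := by
      refine Nat.cast_le_one.2 (Finset.card_le_one.2 fun d hd d' hd' => Subtype.ext (hg ?_))
      rw [← (Finset.mem_filter.1 hd).2, ← (Finset.mem_filter.1 hd').2]
    rw [Finset.sum_add_distrib, Finset.sum_const, ← Finset.sum_filter, Finset.sum_const,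
      Finset.card_univ, Fintype.card_coe, hD₀, nsmul_eq_mul, nsmul_eq_mul] at h3
    have h5 := mul_le_mul_of_nonneg_right h4 (by linarith : 0 ≤ 2 * (z * y))
    have h6 := mul_le_mul_of_nonneg_left hwhalf hβ.le
    linarith
  have hRW : ∀ u v, ReservedEdge G a b σ c Dp Dm u v → u ∈ W ∨ v ∈ W := by
    rintro u v ⟨-, ⟨h1, -⟩ | ⟨-, ⟨h1, -⟩ | ⟨h1, -⟩⟩⟩
    · exact Or.inl ((hmemW u).2 h1)
    · exact Or.inr ((hmemW v).2 h1)
    · exact Or.inl ((hmemW u).2 h1)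
  have hsize : (Fintype.card (Σ d : {d // d ∈ D₀}, {l // good d l}) : ℝ) ≤ γ / 2 / 2 * W.card := by
    have h1 : ∀ d ∈ (Finset.univ : Finset {d // d ∈ D₀}),
        ((Finset.univ.filter fun l => good d l).card : ℝ) ≤ n / p / 2 + N := by
      intro d _
      have : ((Finset.univ.filter fun l => good d l).card : ℝ) ≤ Δ d := by
        refine Nat.cast_le.2 ((Finset.card_le_univ _).trans ?_)
        rw [Fintype.card_fin]
      linarith [hΔ2 d]
    have h2 := Finset.sum_le_sum h1
    rw [Finset.sum_const, Finset.card_univ, Fintype.card_coe, hD₀, nsmul_eq_mul, ← hcard1] at h2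
    have h3 : (t : ℝ) * (n / p) ≤ γ * y / 8 := by
      calc (t : ℝ) * (n / p) = t / p * n := by ring
        _ ≤ 1 / L * n := mul_le_mul_of_nonneg_right ht1 hn0
        _ = n / L := by ring
        _ ≤ γ * y / 8 := by
            rw [hy, div_le_iff₀ hLpos]
            have h4 : 8 * q * (n / q) ≤ γ * L * (n / q) :=
              mul_le_mul_of_nonneg_right hL (by positivity)
            have h5 : 8 * q * (n / q) = 8 * n := by field_simp
            linarith
    have h4 := mul_le_mul_of_nonneg_left hwhalf hγ.le
    linarith
  have hdouble : Function.Injective fun d : ZMod p => d + d := by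
    intro d d' h
    have h2 : (2 : ZMod p) ≠ 0 := by
      intro h
      have h2 := (ZMod.natCast_eq_zero_iff 2 p).1 (by exact_mod_cast h)
      have h3 := Nat.le_of_dvd (by norm_num) h2
      have h4 : 1 ≤ t := by
        by_contra h
        have := (Fact.out : p.Prime).one_lt
        rw [← htL, show t = 0 by omega] at this
        omega
      have h5 := Nat.mul_le_mul h4 (Nat.ofNat_le_cast.1 hL2)
      omega
    exact mul_left_cancel₀ h2 (by simpa [two_mul] using h)
  obtain ⟨τ, hτ1, hτ2⟩ := hmain V (Σ d : {d // d ∈ D₀}, {l // good d l}) W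
    (ReservedEdge G a b σ c Dp Dm) (fun i => F i.1 i.2.1)
    (by
      have : (m₀ : ℝ) ≤ W.card := by linarith
      exact_mod_cast this)
    (fun u v h h' => hG u v h.1 h'.1)
    (fun w hw => by
      refine hBnum.trans (le_trans ?_ (Nat.cast_le.2 (Finset.card_le_card
        (Finset.monotone_filter_right W (p := fun u => G w u ∧ ∀ i ≠ σ, a u i ≠ a w i)
        (fun u hu h => ?_)))))
      · have := hbal.le_card_inside σ c w
        rw [← hlamdef, ← hN, ← hW] at this
        exact this
      · exact ⟨h.1, Or.inl ⟨(hmemW w).1 hw, (hmemW u).1 hu, fun i hi => (h.2 i hi).symm⟩⟩)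
    (fun w hw => by
      refine hBnum.trans (le_trans ?_ (Nat.cast_le.2 (Finset.card_le_card
        (Finset.monotone_filter_right W (p := fun u => G u w ∧ ∀ i ≠ σ, a u i ≠ a w i)
        (fun u hu h => ?_)))))
      · have := hbal.swap.le_card_inside σ c w
        rw [← hlamdef, ← hN, ← hW] at this
        exact this
      · exact ⟨h.1, Or.inl ⟨(hmemW u).1 hu, (hmemW w).1 hw, fun i hi => h.2 i hi⟩⟩)
    (fun v hv => by
      have h1 := hbal.le_card_connect σ c v (mt (hmemW v).2 hv) (Dp.image (b v + ·))
      rw [Finset.card_image_of_injective _ (add_right_injective _), hDp, ← hlamdef, ← hN, ← hW] at h1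
      refine hCnum.trans (h1.trans (Nat.cast_le.2 (Finset.card_le_card
        (Finset.monotone_filter_right W (fun u hu h => ?_)))))
      obtain ⟨d, hd, hdv⟩ := Finset.mem_image.1 h.2.2
      exact ⟨h.1, Or.inr ⟨fun i => (h.2.1 i).symm, Or.inl ⟨(hmemW u).1 hu, by
        rw [← hdv]; simpa using hd⟩⟩⟩)
    (fun v hv => by
      have h1 := hbal.swap.le_card_connect σ c v (mt (hmemW v).2 hv) (Dm.image (b v - ·))
      rw [Finset.card_image_of_injective _ (sub_right_injective), hDm, ← hlamdef, ← hN, ← hW] at h1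
      refine hCnum.trans (h1.trans (Nat.cast_le.2 (Finset.card_le_card
        (Finset.monotone_filter_right W (fun u hu h => ?_)))))
      obtain ⟨d, hd, hdv⟩ := Finset.mem_image.1 h.2.2
      exact ⟨h.1, Or.inr ⟨fun i => h.2.1 i, Or.inr ⟨(hmemW u).1 hu, by
        rw [← hdv]; simpa using hd⟩⟩⟩)
    (fun i => ⟨fun v => (b v * (i.1.1)⁻¹ - 2).val, fun u v h =>
      (hFlink _ _ _ _ h).rank_lt fun h => h0 (h ▸ i.1.2)⟩)
    (fun i => hFfun _ _) (fun i => hFinj _ _)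
    (fun i u v h => ⟨mt (hmemW u).1 (hFlink _ _ _ _ h).2.2.1,
      mt (hmemW v).1 (hFlink _ _ _ _ h).2.2.2.1⟩)
    (fun i => (hgood _ _).1 i.2.2)
    (fun v hv => by
      have h1 := hload (fun d l => ∀ u, ¬ F d l v u) id (b v) Function.injective_id fun d hd => by
        convert hFout d v (mt (hmemW v).2 hv) hd
      convert h1)
    (fun v hv => by
      have h1 := hload (fun d l => ∀ u, ¬ F d l u v) (fun d => d + d) (b v) hdouble fun d hd => by
        convert hFin d v (mt (hmemW v).2 hv) hd
      convert h1)
    (fun i u v h h' => (hRW u v h').elim (fun h1 => (hFlink _ _ _ _ h).2.2.1 ((hmemW u).1 h1))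
      fun h1 => (hFlink _ _ _ _ h).2.2.2.1 ((hmemW v).1 h1))
    (by
      rintro ⟨⟨d, hd⟩, l, hl⟩ ⟨⟨d', hd'⟩, l', hl'⟩ u v h h'
      have h1 := (hFlink _ _ _ _ h).2.2.2.2.1
      have h2 := (hFlink _ _ _ _ h').2.2.2.2.1
      have h3 : d = d' := add_left_cancel (h1.symm.trans h2)
      subst h3
      have h4 := hFdisj _ _ _ _ _ h h'
      simp only at h4
      subst h4
      rfl)
    hsize
  refine ⟨_, inferInstance, ?_, τ, fun i => ⟨(hτ1 i).1, fun v => ⟨((hτ1 i).2 v).1, ?_⟩⟩, hτ2⟩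
  · rw [hcard1]
    have := Finset.sum_le_sum fun d (_ : d ∈ Finset.univ) => hbad d
    rwa [Finset.sum_const, Finset.card_univ, Fintype.card_coe, hD₀, nsmul_eq_mul] at this
  · rcases ((hτ1 i).2 v).2 with h | h
    · exact Or.inr ⟨i.1.1, i.1.2, hFlink _ _ _ _ h⟩
    · exact Or.inl h

theorem exists_disjoint_classes {K : Type} [Fintype K] {p t : ℕ} [NeZero p]
    (h : t * Fintype.card K + 1 = p) :
    ∃ D : K → Finset (ZMod p), (∀ k, 0 ∉ D k) ∧ (∀ k, (D k).card = t) ∧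
      ∀ k k' d, d ∈ D k → d ∈ D k' → k = k' := by
  have hc : Fintype.card (K × Fin t) = Fintype.card {d : ZMod p // d ≠ 0} := by
    have h1 : Fintype.card {d : ZMod p // d ≠ 0} = p - 1 := by
      rw [Fintype.card_subtype_compl, ZMod.card, Fintype.card_subtype_eq]
    rw [h1, Fintype.card_prod, Fintype.card_fin, mul_comm]
    omega
  let e := Fintype.equivOfCardEq hc
  refine ⟨fun k => Finset.univ.image fun j => (e (k, j)).1, ?_, ?_, ?_⟩
  · intro k h0
    obtain ⟨j, -, hj⟩ := Finset.mem_image.1 h0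
    exact (e (k, j)).2 hj
  · intro k
    rw [Finset.card_image_of_injective, Finset.card_univ, Fintype.card_fin]
    intro j j' hj
    exact (Prod.ext_iff.1 (e.injective (Subtype.ext hj))).2
  · intro k k' d hd hd'
    obtain ⟨j, -, hj⟩ := Finset.mem_image.1 hd
    obtain ⟨j', -, hj'⟩ := Finset.mem_image.1 hd'
    exact (Prod.ext_iff.1 (e.injective (Subtype.ext (hj.trans hj'.symm)))).1

theorem GroupEdge.adj {V : Type*} {s q p : ℕ} {G : V → V → Prop} {a : V → Fin s → Fin q}
    {b : V → ZMod p} {σ : Fin s} {c : Fin q} {D₀ Dp Dm : Finset (ZMod p)} {u v : V}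
    (h : GroupEdge G a b σ c D₀ Dp Dm u v) : G u v := by
  rcases h with h | ⟨_, _, h⟩
  · exact h.1
  · exact h.1

theorem GroupEdge.unique {V : Type*} {s q p : ℕ} {G : V → V → Prop} {a : V → Fin s → Fin q}
    {b : V → ZMod p} {D : (Fin s × Fin q) ⊕ (Fin s × Bool) → Finset (ZMod p)}
    (hD : ∀ k k' d, d ∈ D k → d ∈ D k' → k = k') {g g' : Fin s × Fin q} {u v : V}
    (h : GroupEdge G a b g.1 g.2 (D (.inl g)) (D (.inr (g.1, true))) (D (.inr (g.1, false))) u v)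
    (h' : GroupEdge G a b g'.1 g'.2 (D (.inl g')) (D (.inr (g'.1, true)))
      (D (.inr (g'.1, false))) u v) : g = g' := by
  have key : ∀ g : Fin s × Fin q,
      GroupEdge G a b g.1 g.2 (D (.inl g)) (D (.inr (g.1, true))) (D (.inr (g.1, false))) u v →
      (a u g.1 = g.2 ∧ a v g.1 = g.2 ∧ ∀ i ≠ g.1, a u i ≠ a v i) ∨
        (∀ i, a u i ≠ a v i) ∧ ∃ k, b v - b u ∈ D k ∧ (k = .inl g ∨
          (k = .inr (g.1, true) ∧ a v g.1 = g.2) ∨ (k = .inr (g.1, false) ∧ a u g.1 = g.2)) := by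
    rintro g (⟨-, h | ⟨h, ⟨h1, h2⟩ | ⟨h1, h2⟩⟩⟩ | ⟨d, hd, h⟩)
    · exact Or.inl h
    · exact Or.inr ⟨h, _, h2, Or.inr (Or.inl ⟨rfl, h1⟩)⟩
    · exact Or.inr ⟨h, _, h2, Or.inr (Or.inr ⟨rfl, h1⟩)⟩
    · refine Or.inr ⟨h.2.1, _, ?_, Or.inl rfl⟩
      rw [h.2.2.2.2.1]
      simpa using hd
  obtain ⟨σ, c⟩ := g
  obtain ⟨σ', c'⟩ := g'
  rcases key _ h with ⟨h1, h2, h3⟩ | ⟨h1, k, hk, h2⟩ <;>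
    rcases key _ h' with ⟨h1', h2', h3'⟩ | ⟨h1', k', hk', h2'⟩
  · have hσ : σ = σ' := by
      by_contra hne
      exact h3 σ' (Ne.symm hne) (h1'.trans h2'.symm)
    subst hσ
    exact Prod.ext rfl (h1.symm.trans h1')
  · exact absurd (h1.trans h2.symm) (h1' σ)
  · exact absurd (h1'.trans h2'.symm) (h1 σ')
  · have hkk := hD _ _ _ hk hk'
    subst hkk
    rcases h2 with rfl | ⟨rfl, h2⟩ | ⟨rfl, h2⟩ <;> rcases h2' with h4 | ⟨h4, h5⟩ | ⟨h4, h5⟩ <;>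
      first
      | exact Sum.inl.inj h4
      | (cases h4; exact Prod.ext rfl (h2.symm.trans h5))
      | cases h4

theorem final_count {γ α lam s q t L p n : ℝ} (hγ : 0 < γ) (hγ1 : γ ≤ 1 / 8)
    (hα0 : 0 ≤ α) (hα1 : α ≤ 1 / 2) (hlam : 1 - γ / 8 ≤ lam) (hs : 0 < s) (hq : 16 ≤ γ * q)
    (hL : L = s * (q + 2)) (ht : t * L + 1 = p) (hp : 1 / p ≤ γ / 8) (hp0 : 0 < p) (hn : 0 ≤ n) :
    (α - γ) * n ≤ s * q * (t * ((1 - γ / 8) * (lam * ((q - 2) / q) * α * n / p))) := by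
  have hq0 : 0 < q := pos_of_mul_pos_right (lt_of_lt_of_le (by norm_num) hq) hγ.le
  have hq2 : 2 < q := by
    have : γ * q ≤ 1 / 8 * q := mul_le_mul_of_nonneg_right hγ1 hq0.le
    linarith
  have h1 : s * q * (t * ((1 - γ / 8) * (lam * ((q - 2) / q) * α * n / p))) =
      (1 - 1 / p) * ((q - 2) / (q + 2)) * ((1 - γ / 8) * lam) * (α * n) := by
    have ht' : t = (p - 1) / (s * (q + 2)) := by
      rw [eq_div_iff (by positivity), ← hL]; linarith
    rw [ht']
    field_simp
  have h2 : 1 - γ / 4 ≤ (q - 2) / (q + 2) := by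
    rw [le_div_iff₀ (by linarith)]
    linarith
  have h3 : (1 - γ / 8) * (1 - γ / 4) * ((1 - γ / 8) * (1 - γ / 8)) ≤
      (1 - 1 / p) * ((q - 2) / (q + 2)) * ((1 - γ / 8) * lam) := by
    have h5 : 0 ≤ (1 - γ / 8) * (1 - γ / 8) := mul_self_nonneg _
    have h6 : 0 ≤ (1 - 1 / p) * ((q - 2) / (q + 2)) := mul_nonneg (by linarith) (by linarith)
    gcongr <;> linarith
  have h4 : 1 - γ ≤ (1 - γ / 8) * (1 - γ / 4) * ((1 - γ / 8) * (1 - γ / 8)) := by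
    have e1 : 1 - 3 * γ / 8 ≤ (1 - γ / 8) * (1 - γ / 4) := by nlinarith
    have e2 : 1 - γ / 4 ≤ (1 - γ / 8) * (1 - γ / 8) := by nlinarith
    have e3 := mul_le_mul e1 e2 (by linarith) (by linarith)
    nlinarith
  have h5 : (1 - γ) * (α * n) ≤
      (1 - 1 / p) * ((q - 2) / (q + 2)) * ((1 - γ / 8) * lam) * (α * n) :=
    mul_le_mul_of_nonneg_right (h4.trans h3) (by positivity)
  have h6 : (α - γ) * n ≤ (1 - γ) * (α * n) := by
    have := mul_le_mul_of_nonneg_left (mul_le_mul_of_nonneg_right hα1 hn) hγ.le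
    have : 0 ≤ γ * n := by positivity
    linarith
  rw [h1]
  exact h6.trans h5

/-- for every `γ > 0` there are `n₀` and `η > 0` such that whenever
`3/8 + γ ≤ α < 1/2` and `G` is an oriented graph on `n ≥ n₀` vertices with
`δ⁰(G) ≥ (α − η)n` and `Δ⁰(G) ≤ (α + η)n`, then `G` contains at least `(α − γ)n`
pairwise edge-disjoint Hamilton cycles. -/
theorem almost_regular_oriented_graph_many_edge_disjoint_hamilton_cycles :
    ∀ γ : ℝ, 0 < γ →
    ∃ n₀ : ℕ, ∃ η : ℝ, 0 < η ∧
    ∀ α : ℝ, 3/8 + γ ≤ α → α < 1/2 →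
    ∀ n : ℕ, n₀ ≤ n →
    ∀ (V : Type) [Fintype V] [DecidableEq V], Fintype.card V = n →
    ∀ G : V → V → Prop,
      (∀ v, ¬ G v v) →
      (∀ u v : V, G u v → ¬ G v u) →
      (∀ v, (α - η) * (n : ℝ) ≤ (outDeg G v : ℝ) ∧
            (α - η) * (n : ℝ) ≤ (inDeg G v : ℝ)) →
      (∀ v, (outDeg G v : ℝ) ≤ (α + η) * (n : ℝ) ∧
            (inDeg G v : ℝ) ≤ (α + η) * (n : ℝ)) →
      ∃ H : Finset (Equiv.Perm V),
        (∀ σ ∈ H, IsHamCycle G σ) ∧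
        (∀ σ ∈ H, ∀ τ ∈ H, σ ≠ τ → ∀ v : V, σ v ≠ τ v) ∧
        (α - γ) * (n : ℝ) ≤ (H.card : ℝ) := by
  intro γ hγ
  rcases le_or_gt (1 / 8) γ with hγ1 | hγ1
  · exact ⟨0, 1, one_pos, fun α h1 h2 => absurd h2 (not_lt.2 (by linarith))⟩
  replace hγ1 := hγ1.le
  obtain ⟨s, hsdef⟩ : ∃ s : ℕ, s = ⌈8 / γ⌉₊ := ⟨_, rfl⟩
  have hs : 8 ≤ γ * s := by
    have := Nat.le_ceil (8 / γ)
    rw [← hsdef, div_le_iff₀ hγ] at this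
    linarith
  have hs1 : (1 : ℝ) ≤ s := by
    have : γ * s ≤ 1 / 8 * s := mul_le_mul_of_nonneg_right hγ1 (Nat.cast_nonneg _)
    linarith
  obtain ⟨q, hqdef⟩ : ∃ q : ℕ, q = ⌈16 * s / γ⌉₊ := ⟨_, rfl⟩
  have hqs : 16 * s ≤ γ * q := by
    have := Nat.le_ceil (16 * s / γ)
    rw [← hqdef, div_le_iff₀ hγ] at this
    linarith
  have hq : 16 ≤ γ * q := by linarith
  have hq1 : (1 : ℝ) ≤ q := by
    have : γ * q ≤ 1 / 8 * q := mul_le_mul_of_nonneg_right hγ1 (Nat.cast_nonneg _)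
    linarith
  have hlam : 1 - γ / 8 ≤ (((q : ℝ) - 1) / q) ^ (s - 1) := by
    have h1 := one_add_mul_le_pow (a := -(1 / (q : ℝ))) (by
      have : 1 / (q : ℝ) ≤ 1 := by rw [div_le_one (by linarith)]; exact hq1
      linarith) (s - 1)
    have h2 : 1 + -(1 / (q : ℝ)) = ((q : ℝ) - 1) / q := by field_simp; ring
    rw [h2] at h1
    refine le_trans ?_ h1
    have h3 : ((s - 1 : ℕ) : ℝ) ≤ s := Nat.cast_le.2 (Nat.sub_le _ _)
    have h4 : ((s - 1 : ℕ) : ℝ) * (1 / q) ≤ γ / 8 := by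
      rw [mul_one_div, div_le_iff₀ (by linarith)]
      linarith
    linarith
  obtain ⟨L, hLdef⟩ : ∃ L : ℕ, L = s * (q + 2) := ⟨_, rfl⟩
  have hLR : (L : ℝ) = s * (q + 2) := by rw [hLdef]; push_cast; ring
  have hL : 8 * q ≤ γ * L := by
    have := mul_le_mul_of_nonneg_right hs (by linarith : 0 ≤ (q : ℝ) + 2)
    rw [hLR]
    linarith
  have hL1 : (1 : ℝ) ≤ L := by
    have : γ * L ≤ 1 / 8 * L := mul_le_mul_of_nonneg_right hγ1 (Nat.cast_nonneg _)
    linarith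
  obtain ⟨β, hβdef⟩ : ∃ β : ℝ, β = 1 / (32 * L) := ⟨_, rfl⟩
  have hβ : 0 < β := by rw [hβdef]; positivity
  have hβ1 : β ≤ 1 := by
    rw [hβdef, div_le_one (by positivity)]
    linarith
  obtain ⟨ε, hε, m₀, hgroup⟩ := IsBalanced.exists_group_isCycle hγ hγ1 hβ hβ1
  obtain ⟨z, hzdef⟩ : ∃ z : ℝ, z = γ * β * min ε 1 / 1000 := ⟨_, rfl⟩
  have hz : 0 < z := by
    have := lt_min hε one_pos
    rw [hzdef]; positivity
  have hγβ : 0 ≤ γ * β := by positivity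
  have hzβ : 1000 * z ≤ γ * β := by
    have := mul_le_of_le_one_right hγβ (min_le_right ε 1)
    rw [hzdef]; linarith
  have hzε : 1000 * z ≤ γ * β * ε := by
    have := mul_le_mul_of_nonneg_left (min_le_left ε 1) hγβ
    rw [hzdef]; linarith
  have hzγ : 1000 * z ≤ γ := hzβ.trans (mul_le_of_le_one_right hγ.le hβ1)
  have hx : 0 < z / q := by positivity
  have hxz : z / q ≤ z := div_le_self hz.le hq1
  obtain ⟨p, hp, hpx, hpL⟩ := Nat.exists_prime_gt_modEq_one ⌈1 / (z / q)⌉₊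
    (k := L) (by rintro rfl; norm_num at hL1)
  have : Fact p.Prime := ⟨hp⟩
  have hp0 : (0 : ℝ) < p := Nat.cast_pos.2 hp.pos
  have hpx' : 1 / (p : ℝ) ≤ z / q := by
    rw [one_div_le hp0 hx]
    exact (Nat.le_ceil _).trans (Nat.cast_le.2 hpx.le)
  obtain ⟨t, ht⟩ := (Nat.modEq_iff_dvd' hp.one_lt.le).1 hpL.symm
  have htL : t * L + 1 = p := by
    have := hp.one_lt
    rw [mul_comm, ← ht]
    omega
  obtain ⟨D, hD0, hDt, hDdisj⟩ := exists_disjoint_classes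
    (K := (Fin s × Fin q) ⊕ (Fin s × Bool)) (p := p) (t := t) (by
      rw [← htL, hLdef]
      simp [mul_add])
  have hω : 0 < z / q / p := by positivity
  obtain ⟨n₁, η, hη, hbal⟩ := exists_isBalanced s q p (Nat.cast_pos.1 (by linarith : (0 : ℝ) < q)) hω (by
    refine (div_le_self hx.le (Nat.one_le_cast.2 hp.one_lt.le)).trans ?_
    linarith)
  refine ⟨max n₁ (max ⌈1 / (z / q / p)⌉₊ ⌈2 * m₀ * (q : ℝ)⌉₊), η, hη, ?_⟩
  intro α hα hα1 n hn V _ _ hV G hirr hG hmin hmax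
  subst hV
  have hn1 := (le_max_left _ _).trans hn
  have hn2 := Nat.ceil_le.1 ((le_max_left _ _).trans ((le_max_right _ _).trans hn))
  have hn3 := Nat.ceil_le.1 ((le_max_right _ _).trans ((le_max_right _ _).trans hn))
  have hωn : 1 ≤ z / q / p * (Fintype.card V : ℝ) := by
    rw [div_le_iff₀ hω] at hn2
    linarith
  have hVne : Nonempty V := by
    by_contra h
    rw [not_nonempty_iff] at h
    rw [Fintype.card_eq_zero, Nat.cast_zero, mul_zero] at hωn
    exact absurd hωn (by norm_num)
  obtain ⟨a, b, hab⟩ := hbal V G α hn1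
    (fun v => abs_le.2 ⟨by
      have := (hmin v).1
      unfold outDeg at this
      linarith, by
      have := (hmax v).1
      unfold outDeg at this
      linarith⟩)
    (fun v => abs_le.2 ⟨by
      have := (hmin v).2
      unfold inDeg at this
      linarith, by
      have := (hmax v).2
      unfold inDeg at this
      linarith⟩)
  have hgr := fun g : Fin s × Fin q => hgroup V s q p t L G a b α (z / q / p) z _ hab hG hα hα1.le
    hlam hq hL hβdef htL hz hzβ hzε
    (le_of_eq (by field_simp))
    (by
      have := mul_le_mul_of_nonneg_right hpx' (Nat.cast_nonneg (α := ℝ) (Fintype.card V))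
      calc (Fintype.card V : ℝ) / p = 1 / p * Fintype.card V := by ring
        _ ≤ z / q * Fintype.card V := this
        _ = z * (Fintype.card V / q) := by ring)
    hωn (by rw [le_div_iff₀ (by linarith)]; exact hn3) rfl g.1 g.2
    (D (.inl g)) (D (.inr (g.1, true))) (D (.inr (g.1, false))) (hD0 _) (hDt _) (hDt _) (hDt _)
  choose ι hι hcard τ hτ1 hτ2 using hgr
  have hne : ∀ x y : Σ g, ι g, x ≠ y → ∀ v, τ x.1 x.2 v ≠ τ y.1 y.2 v := by
    rintro ⟨g, i⟩ ⟨g', j⟩ hxy v h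
    by_cases hg : g = g'
    · subst hg
      exact hτ2 g i j (fun hij => hxy (by rw [hij])) v h
    · have h1 := ((hτ1 g i).2 v).2
      have h2 := ((hτ1 g' j).2 v).2
      simp only at h
      rw [← h] at h2
      exact hg (GroupEdge.unique hDdisj h1 h2)
  have hinj : Function.Injective fun x : Σ g, ι g => τ x.1 x.2 := by
    intro x y hxy
    by_contra h
    obtain ⟨v⟩ := hVne
    exact hne x y h v (congrArg (fun π : Equiv.Perm V => π v) hxy)
  refine ⟨Finset.univ.image fun x : Σ g, ι g => τ x.1 x.2, ?_, ?_, ?_⟩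
  · intro π hπ
    obtain ⟨x, -, rfl⟩ := Finset.mem_image.1 hπ
    exact ⟨(hτ1 _ _).1, fun v => ((hτ1 _ _).2 v).1, fun v => ((hτ1 _ _).2 v).2.adj⟩
  · intro π hπ ρ hρ hne'
    obtain ⟨x, -, rfl⟩ := Finset.mem_image.1 hπ
    obtain ⟨y, -, rfl⟩ := Finset.mem_image.1 hρ
    exact hne x y fun h => hne' (by rw [h])
  · rw [Finset.card_image_of_injective _ hinj, Finset.card_univ, Fintype.card_sigma, Nat.cast_sum]
    have h1 := Finset.sum_le_sum fun g (_ : g ∈ Finset.univ) => hcard g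
    rw [Finset.sum_const, Finset.card_univ, Fintype.card_prod, Fintype.card_fin, Fintype.card_fin,
      nsmul_eq_mul, Nat.cast_mul] at h1
    refine le_trans ?_ h1
    exact final_count hγ hγ1 (by linarith) hα1.le hlam (by linarith) hq hLR (by exact_mod_cast htL)
      (by linarith) hp0 (Nat.cast_nonneg _)
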